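/- arXiv:2501.15978 — 2 statements merged into one kernel-verified Lean document; each statement's English description precedes it below -/
import Mathlib

section
/- There exists a constant C > 0 such that the following holds: for every spherical profile (μ, k) with μ_1 ≤ 1, any two path-like square-tiled surfaces with profile (μ, k) can be connected by a sequence of at most C·k powers of cylinder shears (up to isomorphism). -/
/-! Common definitions: square-tiled surfaces as triples of involutions,
cylinder shears, profiles, etc. -/

inductive Color : Type
  | R | G | B
  deriving DecidableEq

/-- A candidate square-tiled surface on `Fin n`: a triple of permutations
indexed by the three colours. -/
abbrev Surf (n : ℕ) := Color → Equiv.Perm (Fin n)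

/-- `f` is a square-tiled surface on `{1,…,n}` (`n ≥ 1`): the three permutations are
involutions and the subgroup they generate acts transitively. -/
def IsSTS (n : ℕ) (f : Surf n) : Prop :=
  1 ≤ n ∧ (∀ X, f X * f X = 1) ∧
    ∀ x y : Fin n,
      ∃ p ∈ Subgroup.closure ({f Color.R, f Color.G, f Color.B} : Set (Equiv.Perm (Fin n))),
        p x = y

/-- Number of fixed points of a permutation of `Fin n`. -/
def fixedCount {n : ℕ} (π : Equiv.Perm (Fin n)) : ℕ :=
  (Finset.univ.filter fun x => π x = x).card

/-- Number of cycles of length `i` of `π`, fixed points counted as cycles of length 1. -/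
def cycleCount {n : ℕ} (π : Equiv.Perm (Fin n)) (i : ℕ) : ℕ :=
  if i = 1 then fixedCount π else Multiset.count i π.cycleType

/-- The product `τ_R · τ_G · τ_B`. -/
def prodRGB {n : ℕ} (f : Surf n) : Equiv.Perm (Fin n) :=
  f Color.R * f Color.G * f Color.B

/-- Total number of fixed points of the three permutations. -/
def totalFixed {n : ℕ} (f : Surf n) : ℕ :=
  fixedCount (f Color.R) + fixedCount (f Color.G) + fixedCount (f Color.B)

/-- `f` has profile `(μ, k)`: `μ i` is the number of cycles of length `i` of
`τ_R·τ_G·τ_B` (for `i ≥ 1`), and `k` is the total number of fixed points of the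
three involutions. -/
def HasProfile {n : ℕ} (f : Surf n) (μ : ℕ → ℕ) (k : ℕ) : Prop :=
  (∀ i, 1 ≤ i → cycleCount (prodRGB f) i = μ i) ∧ totalFixed f = k

open Classical in
/-- The permutation acting as `σ` on the (`σ`-invariant) set `c` and as the identity
outside of `c`. (Junk value `1` if `c` is not `σ`-invariant.) -/
noncomputable def restrictPerm {α : Type*} (σ : Equiv.Perm α) (c : Set α) : Equiv.Perm α :=
  if h : ∀ x, σ x ∈ c ↔ x ∈ c then
    { toFun := fun x => if x ∈ c then σ x else x
      invFun := fun x => if x ∈ c then σ.symm x else x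
      left_inv := fun x => by
        by_cases hx : x ∈ c
        · simp [hx, (h x).mpr hx]
        · simp [hx]
      right_inv := fun x => by
        by_cases hx : x ∈ c
        · have h1 : σ.symm x ∈ c := (h (σ.symm x)).mp (by simpa using hx)
          simp [hx, h1]
        · simp [hx] }
  else 1

/-- `c` is an `{i,j}`-component of `f`: an orbit of the subgroup generated by
`f i` and `f j`. -/
def IsComponent (n : ℕ) (f : Surf n) (i j : Color) (c : Set (Fin n)) : Prop :=
  ∃ x : Fin n,
    c = MulAction.orbit ↥(Subgroup.closure ({f i, f j} : Set (Equiv.Perm (Fin n)))) x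

/-- The cylinder shear `Shear_{c,i,j}`: replace `f i` by `f i · c_i · c_j` and
`f j` by `f j · c_i · c_j`, keeping the third permutation unchanged. -/
noncomputable def shear {n : ℕ} (f : Surf n) (i j : Color) (c : Set (Fin n)) : Surf n :=
  fun X =>
    if X = i ∨ X = j then f X * restrictPerm (f i) c * restrictPerm (f j) c else f X

/-- `m`-th power of the cylinder shear `Shear_{c,i,j}`. -/
noncomputable def shearPow {n : ℕ} (f : Surf n) (i j : Color) (c : Set (Fin n)) : ℕ → Surf n
  | 0 => f
  | m + 1 => shear (shearPow f i j c m) i j c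

/-- The unordered pair `{i,j}` is `{R,G}` or `{G,B}`. -/
def GoodPair (i j : Color) : Prop :=
  ({i, j} : Set Color) = {Color.R, Color.G} ∨ ({i, j} : Set Color) = {Color.G, Color.B}

/-- `A` (together with its complement) witnesses that `f` is Abelian. -/
def IsAbelianWitness (n : ℕ) (f : Surf n) (A : Set (Fin n)) : Prop :=
  A.Nonempty ∧ Aᶜ.Nonempty ∧ ∀ X : Color, (⇑(f X)) '' A = Aᶜ

/-- `f` is Abelian. -/
def IsAbelian (n : ℕ) (f : Surf n) : Prop :=
  ∃ A : Set (Fin n), IsAbelianWitness n f A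

/-- `f` is path-like: `f G` and `f B` alone generate a transitive subgroup and have
exactly two fixed points in total. -/
def IsPathLike (n : ℕ) (f : Surf n) : Prop :=
  (∀ x y : Fin n,
      ∃ p ∈ Subgroup.closure ({f Color.G, f Color.B} : Set (Equiv.Perm (Fin n))),
        p x = y) ∧
    fixedCount (f Color.G) + fixedCount (f Color.B) = 2

/-- `f` and `f'` are isomorphic square-tiled surfaces. -/
def Isomorphic (n : ℕ) (f f' : Surf n) : Prop :=
  ∃ σ : Equiv.Perm (Fin n), ∀ X, f' X = σ * f X * σ⁻¹

/-- One power of a cylinder shear. -/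
def ShearPowStep (n : ℕ) (f f' : Surf n) : Prop :=
  ∃ (i j : Color) (c : Set (Fin n)) (m : ℕ),
    GoodPair i j ∧ IsComponent n f i j c ∧ 1 ≤ m ∧ f' = shearPow f i j c m

/-- A sequence of `L` powers of cylinder shears from `f` to `f'`. -/
def ShearPowSeq (n : ℕ) : ℕ → Surf n → Surf n → Prop
  | 0, f, f' => f = f'
  | L + 1, f, f' => ∃ g, ShearPowStep n f g ∧ ShearPowSeq n L g f'

/-- A single vertical (i.e. `{R,G}`) cylinder shear. -/
def VertStep (n : ℕ) (f f' : Surf n) : Prop :=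
  ∃ (i j : Color) (c : Set (Fin n)),
    ({i, j} : Set Color) = {Color.R, Color.G} ∧ IsComponent n f i j c ∧ f' = shear f i j c

/-- A power of a horizontal (i.e. `{G,B}`) cylinder shear. -/
def HorizPowStep (n : ℕ) (f f' : Surf n) : Prop :=
  ∃ (i j : Color) (c : Set (Fin n)) (m : ℕ),
    ({i, j} : Set Color) = {Color.G, Color.B} ∧ IsComponent n f i j c ∧ 1 ≤ m ∧
      f' = shearPow f i j c m

/-- A sequence of `L` operations, each a single vertical shear or a power of a
horizontal shear. -/
def MixedSeq (n : ℕ) : ℕ → Surf n → Surf n → Prop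
  | 0, f, f' => f = f'
  | L + 1, f, f' => ∃ g, (VertStep n f g ∨ HorizPowStep n f g) ∧ MixedSeq n L g f'

/-- Profile `([2^{μ2}, 4g-2], 0)` (as far as the partition is concerned;
`totalFixed = 0` gives `k = 0`). -/
def ProfileA (n g μ2 : ℕ) (f : Surf n) : Prop :=
  totalFixed f = 0 ∧ cycleCount (prodRGB f) 2 = μ2 ∧
    cycleCount (prodRGB f) (4 * g - 2) = 1 ∧
    ∀ i, 1 ≤ i → i ≠ 2 → i ≠ 4 * g - 2 → cycleCount (prodRGB f) i = 0

/-- Profile `([2^{μ2}, (2g)^2], 0)`. -/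
def ProfileB (n g μ2 : ℕ) (f : Surf n) : Prop :=
  totalFixed f = 0 ∧ cycleCount (prodRGB f) 2 = μ2 ∧
    cycleCount (prodRGB f) (2 * g) = 2 ∧
    ∀ i, 1 ≤ i → i ≠ 2 → i ≠ 2 * g → cycleCount (prodRGB f) i = 0

/-- `α` is an automorphism of `f`. -/
def IsAut {n : ℕ} (f : Surf n) (α : Equiv.Perm (Fin n)) : Prop :=
  ∀ X, α * f X = f X * α

/-- `q` is (a presentation of) the quotient of `f` by the order-2 automorphism `α`:
there is a surjection `p` whose fibers are exactly the `⟨α⟩`-orbits and which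
intertwines the permutations. -/
def IsQuotientBy (n m : ℕ) (f : Surf n) (α : Equiv.Perm (Fin n)) (q : Surf m) : Prop :=
  ∃ p : Fin n → Fin m, Function.Surjective p ∧
    (∀ x y : Fin n, p x = p y ↔ (y = x ∨ y = α x)) ∧
    ∀ X x, p (f X x) = q X (p x)

/-- `4g - 4` where `g` is the genus of `f`, i.e. `Σ_i μ_i (i-2) - k`. -/
noncomputable def genusFour {n : ℕ} (f : Surf n) : ℤ :=
  (∑ i ∈ Finset.Icc 1 n, (cycleCount (prodRGB f) i : ℤ) * ((i : ℤ) - 2)) - (totalFixed f : ℤ)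

/-- `α` is a hyperelliptic involution of `f`: an order-2 automorphism whose quotient
is a square-tiled surface of genus 0. -/
def IsHyperInvolution {n : ℕ} (f : Surf n) (α : Equiv.Perm (Fin n)) : Prop :=
  IsAut f α ∧ α * α = 1 ∧ α ≠ 1 ∧
    ∃ (m : ℕ) (q : Surf m), IsSTS m q ∧ IsQuotientBy n m f α q ∧ genusFour q = -4

/-- `α` sends every point lying on a cycle of length `2g` of `τ_R·τ_G·τ_B` to a
different cycle (hence exchanges the two cycles of length `2g`). -/
def ExchangesTwoCycles {n : ℕ} (f : Surf n) (α : Equiv.Perm (Fin n)) (g : ℕ) : Prop :=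
  ∀ x : Fin n, ((prodRGB f).cycleOf x).support.card = 2 * g →
    ¬ (prodRGB f).SameCycle x (α x)

/-- Membership in `ST^hyp_Ab([2^{μ2}, 4g-2])`. -/
def InSTHypA (n g μ2 : ℕ) (f : Surf n) : Prop :=
  IsSTS n f ∧ IsAbelian n f ∧ ProfileA n g μ2 f ∧ ∃ α, IsHyperInvolution f α

/-- Membership in `ST^hyp_Ab([2^{μ2}, (2g)^2])`. -/
def InSTHypB (n g μ2 : ℕ) (f : Surf n) : Prop :=
  IsSTS n f ∧ IsAbelian n f ∧ ProfileB n g μ2 f ∧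
    ∃ α, IsHyperInvolution f α ∧ ExchangesTwoCycles f α g

section

set_option linter.unusedSectionVars false
set_option linter.unusedDecidableInType false

open Equiv Equiv.Perm Finset

section Cycles

variable {α : Type*} [Fintype α] [DecidableEq α]

/-- All points lie on one cycle of `f`. -/
def OneCycle {α : Type*} (f : Perm α) : Prop := ∀ x y, f.SameCycle x y

theorem mem_of_sameCycle {f : Perm α} {T : Set α} (hT : ∀ t ∈ T, f t ∈ T) {x y : α}
    (hx : x ∈ T) (h : f.SameCycle x y) : y ∈ T := by
  obtain ⟨n, -, rfl⟩ := h.exists_pow_eq'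
  induction n with
  | zero => simpa
  | succ n ih =>
    rw [pow_succ', Perm.mul_apply]
    exact hT _ (ih ⟨n, by simp⟩)

theorem apply_mem_iff_of_closed {f : Perm α} {T : Set α} (hT : ∀ t ∈ T, f t ∈ T) (x : α) :
    f x ∈ T ↔ x ∈ T :=
  ⟨fun h => mem_of_sameCycle hT h (sameCycle_apply_left.2 (SameCycle.refl _ _)), hT x⟩

theorem swap_apply_mem {T : Set α} {x y t : α} (hx : x ∈ T) (hy : y ∈ T) (ht : t ∈ T) :
    swap x y t ∈ T := by
  by_cases h1 : t = x
  · simpa [h1] using hy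
  by_cases h2 : t = y
  · simpa [h2] using hx
  rwa [swap_apply_of_ne_of_ne h1 h2]

theorem swap_mul_cover {f : Perm α} {x y : α} (h : ∀ t, f.SameCycle x t ∨ f.SameCycle y t)
    (t : α) : (swap x y * f).SameCycle x t ∨ (swap x y * f).SameCycle y t := by
  set g := swap x y * f
  set T : Set α := {t | g.SameCycle x t ∨ g.SameCycle y t}
  have hT : ∀ t ∈ T, f t ∈ T := fun t ht => by
    have h1 : f t = swap x y (g t) := by simp [g]
    rw [h1]
    apply swap_apply_mem
    · exact Or.inl (SameCycle.refl _ _)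
    · exact Or.inr (SameCycle.refl _ _)
    · exact ht.imp sameCycle_apply_right.2 sameCycle_apply_right.2
  rcases h t with h | h
  · exact mem_of_sameCycle hT (Or.inl (SameCycle.refl _ _)) h
  · exact mem_of_sameCycle hT (Or.inr (SameCycle.refl _ _)) h

theorem not_sameCycle_swap_mul {f : Perm α} {x y : α} (hxy : x ≠ y) (h : f.SameCycle x y) :
    ¬ (swap x y * f).SameCycle x y := by
  obtain ⟨m, hm, hmin⟩ : ∃ m, (f ^ m) x = y ∧ ∀ j < m, (f ^ j) x ≠ y := by
    obtain ⟨n, -, hn⟩ := h.exists_pow_eq'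
    classical
    have : ∃ n, (f ^ n) x = y := ⟨n, hn⟩
    exact ⟨Nat.find this, Nat.find_spec this, fun j hj => Nat.find_min this hj⟩
  set T : Set α := {t | ∃ j < m, (f ^ j) x = t}
  have hm0 : 0 < m := by
    rcases Nat.eq_zero_or_pos m with h0 | h0
    · subst h0; exact absurd hm hxy
    · exact h0
  have hT : ∀ t ∈ T, (swap x y * f) t ∈ T := by
    rintro t ⟨j, hj, rfl⟩
    have e : (swap x y * f) ((f ^ j) x) = swap x y ((f ^ (j + 1)) x) := by
      simp [pow_succ']
    rw [e]
    rcases Nat.lt_or_ge (j + 1) m with h1 | h1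
    · rw [swap_apply_of_ne_of_ne]
      · exact ⟨j + 1, h1, rfl⟩
      · intro h2
        refine hmin (m - (j + 1)) (by omega) ?_
        rw [← hm]
        conv_rhs => rw [show m = m - (j + 1) + (j + 1) by omega, pow_add, Perm.mul_apply, h2]
      · exact hmin _ h1
    · have : j + 1 = m := by omega
      rw [this, hm, swap_apply_right]
      exact ⟨0, hm0, rfl⟩
  intro hc
  obtain ⟨j, hj, hjy⟩ := mem_of_sameCycle hT ⟨0, hm0, rfl⟩ hc
  exact hmin j hj hjy

theorem oneCycle_swap_mul {f : Perm α} {x y : α} (h : ∀ t, f.SameCycle x t ∨ f.SameCycle y t)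
    (hn : ¬ f.SameCycle x y) : OneCycle (swap x y * f) := by
  have hxy : (swap x y * f).SameCycle x y := by
    by_contra hc
    obtain ⟨m, hm0, hm, hmin⟩ : ∃ m, 0 < m ∧ (f ^ m) x = x ∧ ∀ j, 0 < j → j < m → (f ^ j) x ≠ x := by
      classical
      have : ∃ n, 0 < n ∧ (f ^ n) x = x := ⟨orderOf f, orderOf_pos f, by simp [pow_orderOf_eq_one]⟩
      refine ⟨Nat.find this, (Nat.find_spec this).1, (Nat.find_spec this).2, fun j h0 hj he => ?_⟩
      exact Nat.find_min this hj ⟨h0, he⟩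
    have key : ∀ j < m, ((swap x y * f) ^ j) x = (f ^ j) x := by
      intro j
      induction j with
      | zero => simp
      | succ j ih =>
        intro hj
        rw [pow_succ', Perm.mul_apply, ih (by omega), Perm.mul_apply, ← Perm.mul_apply f,
          ← pow_succ', swap_apply_of_ne_of_ne (hmin _ (by omega) hj)]
        intro he
        exact hn ⟨((j + 1 : ℕ) : ℤ), by rwa [zpow_natCast]⟩
    apply hc
    refine ⟨(m : ℕ), ?_⟩
    obtain ⟨m, rfl⟩ : ∃ k, m = k + 1 := ⟨m - 1, by omega⟩
    rw [zpow_natCast, pow_succ', Perm.mul_apply, key _ (by omega), Perm.mul_apply,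
      ← Perm.mul_apply f, ← pow_succ', hm, swap_apply_left]
  have hx : ∀ t, (swap x y * f).SameCycle x t := fun t =>
    (swap_mul_cover h t).elim id hxy.trans
  exact fun a b => (hx a).symm.trans (hx b)

end Cycles

section Trees

variable {α : Type*} [Fintype α] [DecidableEq α]

/-- The cycle of `P` through `x`, as a finset. -/
def orb (P : Perm α) (x : α) : Finset α := univ.filter fun y => P.SameCycle x y

theorem mem_orb {P : Perm α} {x y : α} : y ∈ orb P x ↔ P.SameCycle x y := by simp [orb]

theorem self_mem_orb (P : Perm α) (x : α) : x ∈ orb P x := mem_orb.2 (SameCycle.refl _ _)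

theorem apply_mem_orb (P : Perm α) (x : α) : P x ∈ orb P x :=
  mem_orb.2 (sameCycle_apply_right.2 (SameCycle.refl _ _))

theorem orb_eq {P : Perm α} {x y : α} (h : y ∈ orb P x) : orb P y = orb P x := by
  ext z
  rw [mem_orb, mem_orb]
  exact ⟨(mem_orb.1 h).trans, (mem_orb.1 h).symm.trans⟩

theorem orb_closed (P : Perm α) (x : α) : ∀ y ∈ orb P x, P y ∈ orb P x := fun _ hy =>
  mem_orb.2 (sameCycle_apply_right.2 (mem_orb.1 hy))

theorem orb_subset {P : Perm α} {S : Finset α} (hS : ∀ x ∈ S, P x ∈ S) {x : α} (hx : x ∈ S) :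
    orb P x ⊆ S := fun _ hy =>
  mem_coe.1 (mem_of_sameCycle (T := (S : Set α)) (fun t ht => hS t ht) hx (mem_orb.1 hy))

theorem mem_iff_of_mem_orb {P : Perm α} {S : Finset α} (hS : ∀ x ∈ S, P x ∈ S) {x y : α}
    (h : y ∈ orb P x) : y ∈ S ↔ x ∈ S :=
  ⟨fun hy => orb_subset hS hy (by rw [orb_eq h]; exact self_mem_orb _ _),
    fun hx => orb_subset hS hx h⟩

theorem disjoint_orb {P : Perm α} {S : Finset α} (hS : ∀ x ∈ S, P x ∈ S) {x : α} (hx : x ∉ S) :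
    Disjoint S (orb P x) := by
  rw [Finset.disjoint_left]
  intro y hy h
  exact hx ((mem_iff_of_mem_orb hS h).1 hy)

/-- The length of the cycle of `P` through `x`. -/
def sz (P : Perm α) (x : α) : ℕ := (orb P x).card

theorem sz_eq {P : Perm α} {x y : α} (h : y ∈ orb P x) : sz P y = sz P x := by
  rw [sz, orb_eq h, sz]

theorem sz_apply (P : Perm α) (x : α) : sz P (P x) = sz P x := sz_eq (apply_mem_orb P x)

theorem sz_pos (P : Perm α) (x : α) : 0 < sz P x := card_pos.2 ⟨x, self_mem_orb P x⟩

theorem sz_eq_one_iff {P : Perm α} {x : α} : sz P x = 1 ↔ P x = x := by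
  constructor
  · intro h
    obtain ⟨a, ha⟩ := card_eq_one.1 h
    have h1 := self_mem_orb P x
    have h2 := apply_mem_orb P x
    rw [ha, mem_singleton] at h1 h2
    rw [h2, ← h1]
  · intro h
    refine card_eq_one.2 ⟨x, ?_⟩
    ext y
    rw [mem_orb, mem_singleton]
    refine ⟨fun hy => ?_, fun hy => hy ▸ SameCycle.refl _ _⟩
    exact mem_of_sameCycle (T := {x}) (by simp [h]) rfl hy

theorem sz_le_two {P : Perm α} {x : α} (h : P (P x) = x) : sz P x ≤ 2 := by
  have : orb P x ⊆ {x, P x} := orb_subset (by simp [h]) (by simp)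
  exact (card_le_card this).trans card_le_two

theorem three_le_sz {P : Perm α} {x : α} : 3 ≤ sz P x ↔ P (P x) ≠ x := by
  constructor
  · intro h h'
    have := sz_le_two h'
    omega
  · intro h
    have h1 : P x ≠ x := fun h1 => h (by rw [h1, h1])
    have h2 : P (P x) ≠ P x := fun h2 => h1 (P.injective h2)
    have : ({x, P x, P (P x)} : Finset α) ⊆ orb P x := by
      intro y
      simp only [mem_insert, mem_singleton]
      rintro (rfl | rfl | rfl)
      · exact self_mem_orb _ _
      · exact apply_mem_orb _ _
      · exact orb_closed _ _ _ (apply_mem_orb _ _)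
    have := card_le_card this
    rwa [card_eq_three.2 ⟨x, P x, P (P x), h1.symm, h.symm, h2.symm, rfl⟩] at this

/-- Each cycle of length `s` gets total weight `s - 2`, spread evenly over its points. -/
def wt (P : Perm α) (x : α) : ℚ := 1 - 2 / sz P x

theorem sum_wt_orb (P : Perm α) (x : α) : ∑ y ∈ orb P x, wt P y = sz P x - 2 := by
  have h : ∀ y ∈ orb P x, wt P y = 1 - 2 / sz P x := fun y hy => by rw [wt, sz_eq hy]
  rw [sum_congr rfl h, sum_const, nsmul_eq_mul, ← sz]
  have : (sz P x : ℚ) ≠ 0 := by exact_mod_cast (sz_pos P x).ne'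
  field_simp

theorem wt_nonneg {P : Perm α} {x : α} (h : P x ≠ x) : 0 ≤ wt P x := by
  have h1 : 2 ≤ sz P x := by
    have := sz_pos P x
    have : sz P x ≠ 1 := fun h' => h (sz_eq_one_iff.1 h')
    omega
  have h2 : (2 : ℚ) ≤ sz P x := by exact_mod_cast h1
  rw [wt, sub_nonneg, div_le_one (by linarith)]
  exact h2

theorem card_fixed_le {P Q : Perm α} (hQ : ∀ x, Q (Q x) = x) {K : Finset α}
    (hP : ∀ x ∈ K, P x ∈ K) (hQK : ∀ x ∈ K, Q x ∈ K) {x₀ : α} (hx₀ : x₀ ∈ K)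
    (hmin : ∀ S : Finset α, x₀ ∈ S → (∀ x ∈ S, P x ∈ S) → (∀ x ∈ S, Q x ∈ S) → K ⊆ S) :
    ((K.filter fun x => Q x = x).card : ℚ) ≤ ∑ x ∈ K, wt P x + 2 := by
  set p : Finset α → Prop := fun S => x₀ ∈ S ∧ S ⊆ K ∧ (∀ x ∈ S, P x ∈ S) ∧
    ((S.filter fun x => Q x = x ∨ Q x ∉ S).card : ℚ) ≤ ∑ x ∈ S, wt P x + 2
  have hne : (univ.filter p).Nonempty := by
    refine ⟨orb P x₀, mem_filter.2 ⟨mem_univ _, self_mem_orb _ _, orb_subset hP hx₀,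
      orb_closed _ _, ?_⟩⟩
    rw [sum_wt_orb, sub_add_cancel]
    exact_mod_cast card_filter_le _ _
  obtain ⟨S, hS, hmax⟩ := exists_max_image _ card hne
  obtain ⟨-, h0, hSK, hSP, hle⟩ := mem_filter.1 hS
  by_cases hcl : ∀ x ∈ S, Q x ∈ S
  · have : K = S := Subset.antisymm (hmin S h0 hSP hcl) hSK
    rw [this]
    refine le_trans ?_ hle
    exact_mod_cast card_le_card fun x hx => by
      rw [mem_filter] at hx ⊢
      exact ⟨hx.1, Or.inl hx.2⟩
  · exfalso
    push Not at hcl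
    obtain ⟨c, hc, hQc⟩ := hcl
    have hd := disjoint_orb hSP hQc
    have hp : p (S ∪ orb P (Q c)) := by
      refine ⟨mem_union_left _ h0, union_subset hSK (orb_subset hP (hQK _ (hSK hc))), ?_, ?_⟩
      · intro x hx
        rcases mem_union.1 hx with hx | hx
        · exact mem_union_left _ (hSP x hx)
        · exact mem_union_right _ (orb_closed _ _ _ hx)
      · have hsub : ((S ∪ orb P (Q c)).filter fun x => Q x = x ∨ Q x ∉ S ∪ orb P (Q c)) ⊆
            ((S.filter fun x => Q x = x ∨ Q x ∉ S).erase c) ∪ (orb P (Q c)).erase (Q c) := by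
          intro x hx
          obtain ⟨h1, h2⟩ := mem_filter.1 hx
          rw [mem_union, not_or] at h2
          rcases mem_union.1 h1 with h1 | h1
          · refine mem_union_left _ (mem_erase.2 ⟨?_, mem_filter.2 ⟨h1, h2.imp id And.left⟩⟩)
            rintro rfl
            rcases h2 with h2 | h2
            · exact hQc (by rwa [h2])
            · exact h2.2 (self_mem_orb _ _)
          · refine mem_union_right _ (mem_erase.2 ⟨?_, h1⟩)
            rintro rfl
            rw [hQ] at h2
            rcases h2 with h2 | h2
            · exact hQc (by rwa [← h2])
            · exact h2.1 hc
        have h1 := (card_le_card hsub).trans (card_union_le _ _)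
        have hcm : c ∈ S.filter fun x => Q x = x ∨ Q x ∉ S := mem_filter.2 ⟨hc, Or.inr hQc⟩
        rw [card_erase_of_mem hcm, card_erase_of_mem (self_mem_orb _ _), ← sz] at h1
        have h3 := card_pos.2 ⟨c, hcm⟩
        have h4 := sz_pos P (Q c)
        rw [sum_union hd, sum_wt_orb]
        have h5 : (((S ∪ orb P (Q c)).filter fun x => Q x = x ∨ Q x ∉ S ∪ orb P (Q c)).card : ℚ)
            + 2 ≤ (S.filter fun x => Q x = x ∨ Q x ∉ S).card + sz P (Q c) := by
          exact_mod_cast (by omega)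
        linarith
    have := hmax _ (mem_filter.2 ⟨mem_univ _, hp⟩)
    rw [card_union_of_disjoint hd] at this
    have := sz_pos P (Q c)
    rw [sz] at this
    omega

/-- `R` is an involution whose contour `R * P` is a single cycle and whose number of fixed
points is that of a planar tree with vertices the cycles of `P`. -/
structure PlaneTree (P R : Perm α) : Prop where
  invol : ∀ x, R (R x) = x
  contour : OneCycle (R * P)
  fixed : ∑ x, wt P x + 2 ≤ ((univ.filter fun x => R x = x).card : ℚ)

/-- The side of `c` in the tree obtained by cutting the edge `{c, R c}`. -/
def side (P R : Perm α) (c : α) : Finset α := orb (swap c (R c) * (R * P)) c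

theorem swap_mul_invol {R : Perm α} (hR : ∀ x, R (R x) = x) (c : α) (x : α) :
    (swap c (R c) * R) x = if x = c ∨ x = R c then x else R x := by
  rw [Perm.mul_apply]
  by_cases h1 : x = c
  · simp [h1]
  by_cases h2 : x = R c
  · simp [h2, hR]
  · rw [if_neg (by tauto), swap_apply_of_ne_of_ne]
    · intro h; exact h2 (by rw [← h, hR])
    · intro h; exact h1 (R.injective h)

namespace PlaneTree

variable {P R : Perm α} {c : α}

theorem univ_subset (h : PlaneTree P R) {T : Set α} {x : α} (hx : x ∈ T)
    (hP : ∀ t ∈ T, P t ∈ T) (hR : ∀ t ∈ T, R t ∈ T) (y : α) : y ∈ T :=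
  mem_of_sameCycle (f := R * P) (fun t ht => hR _ (hP t ht)) hx (h.contour x y)

theorem self_mem_side (P R : Perm α) (c : α) : c ∈ side P R c := self_mem_orb _ _

theorem side_swap (h : PlaneTree P R) (c : α) :
    side P R (R c) = orb (swap c (R c) * (R * P)) (R c) := by
  rw [side, h.invol, swap_comm]

theorem side_apply (h : PlaneTree P R) (hc : R c ≠ c) : side P R (R c) = (side P R c)ᶜ := by
  have h1 := not_sameCycle_swap_mul hc.symm (h.contour c (R c))
  have h2 := swap_mul_cover (y := R c) (fun t => Or.inl (h.contour c t))
  rw [side_swap h]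
  ext x
  rw [mem_compl, side, mem_orb, mem_orb]
  constructor
  · intro h3 h4
    exact h1 (h4.trans h3.symm)
  · intro h3
    exact (h2 x).resolve_left h3

theorem apply_notMem_side (h : PlaneTree P R) (hc : R c ≠ c) : R c ∉ side P R c := by
  rw [← mem_compl, ← h.side_apply hc]
  exact self_mem_orb _ _

theorem side_subset (h : PlaneTree P R) {T : Set α} {z : α} (hz : z ∈ side P R c) (hzT : z ∈ T)
    (hP : ∀ t ∈ T, P t ∈ T) (hR : ∀ t ∈ T, t ≠ c → t ≠ R c → R t ∈ T) :
    ∀ x ∈ side P R c, x ∈ T := by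
  intro x hx
  have hxz : (swap c (R c) * (R * P)).SameCycle z x := (mem_orb.1 hz).symm.trans (mem_orb.1 hx)
  refine mem_of_sameCycle (fun t ht => ?_) hzT hxz
  rw [← mul_assoc, Perm.mul_apply, swap_mul_invol h.invol]
  split_ifs with h1
  · exact hP t ht
  · rw [not_or] at h1
    exact hR _ (hP t ht) h1.1 h1.2

end PlaneTree

end Trees

section Sides

variable {α : Type*} [Fintype α] [DecidableEq α]

/-- Cut the edge `{c, R c}` and join `x` with `y` instead. -/
def reconnect (R : Perm α) (c x y : α) : Perm α := swap x y * (swap c (R c) * R)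

namespace PlaneTree

variable {P R : Perm α} {c : α}

theorem card_fixed_cut (h : ∀ x, R (R x) = x) (hc : R c ≠ c) :
    (univ.filter fun x => (swap c (R c) * R) x = x).card =
      (univ.filter fun x => R x = x).card + 2 := by
  have : (univ.filter fun x => (swap c (R c) * R) x = x) =
      (univ.filter fun x => R x = x) ∪ {c, R c} := by
    ext x
    rw [mem_filter, swap_mul_invol h, mem_union, mem_filter, mem_insert, mem_singleton]
    split_ifs with h1
    · simp [h1]
    · simp [h1]
  rw [this, card_union_of_disjoint, card_pair hc.symm]
  rw [Finset.disjoint_left]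
  intro x hx hx'
  rw [mem_filter] at hx
  rcases mem_insert.1 hx' with rfl | hx'
  · exact hc hx.2
  · rw [mem_singleton] at hx'
    rw [hx', h] at hx
    exact hc hx.2.symm

theorem cut_invol (h : ∀ x, R (R x) = x) (c x : α) :
    (swap c (R c) * R) ((swap c (R c) * R) x) = x := by
  rw [swap_mul_invol h c x]
  split_ifs with h1
  · rw [swap_mul_invol h, if_pos h1]
  · rw [swap_mul_invol h, if_neg, h]
    rintro (h2 | h2)
    · exact h1 (Or.inr (by rw [← h2, h]))
    · exact h1 (Or.inl (R.injective h2))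

theorem cut_mul_apply_mem_side (P R : Perm α) (c : α) {x : α} (hx : x ∈ side P R c) :
    (swap c (R c) * R) (P x) ∈ side P R c := by
  have := orb_closed _ _ _ hx
  rwa [← mul_assoc, Perm.mul_apply] at this

theorem side_closed (h : PlaneTree P R) (hc : R c ≠ c) : ∀ x ∈ side P R c, P x ∈ side P R c := by
  by_contra hn
  have hn' : ¬ ∀ x ∈ side P R (R c), P x ∈ side P R (R c) := by
    intro h1
    apply hn
    intro x hx
    by_contra h2
    rw [← mem_compl, ← h.side_apply hc] at h2
    have := (apply_mem_iff_of_closed (T := (side P R (R c) : Set α)) h1 x).1 h2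
    rw [mem_coe, h.side_apply hc, mem_compl] at this
    exact this hx
  set Q := swap c (R c) * R with hQ
  have hQc : ∀ d x, d = c ∨ d = R c → x ∈ side P R d → Q (P x) ∈ side P R d := by
    rintro d x (rfl | rfl) hx
    · exact cut_mul_apply_mem_side P R d hx
    · have := cut_mul_apply_mem_side P R (R c) hx
      rwa [h.invol, swap_comm] at this
  have key : ∀ S : Finset α, c ∈ S → (∀ x ∈ S, P x ∈ S) → (∀ x ∈ S, Q x ∈ S) → univ ⊆ S := by
    intro S hS hSP hSQ
    have hcov : ∀ d z, d = c ∨ d = R c → z ∈ side P R d → z ∈ S → side P R d ⊆ S := by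
      intro d z hd hz hzS
      have e : side P R d = orb (Q * P) d := by
        rcases hd with rfl | rfl
        · rw [side, hQ, mul_assoc]
        · rw [h.side_swap, hQ, mul_assoc]
      rw [e] at hz ⊢
      rw [← orb_eq hz]
      exact orb_subset (fun x hx => hSQ (P x) (hSP x hx)) hzS
    have h1 := hcov c c (Or.inl rfl) (self_mem_side _ _ _) hS
    push Not at hn
    obtain ⟨x, hx, hPx⟩ := hn
    rw [← mem_compl, ← h.side_apply hc] at hPx
    have h2 := hcov _ _ (Or.inr rfl) hPx (hSP _ (h1 hx))
    rw [h.side_apply hc] at h2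
    intro y _
    by_cases hy : y ∈ side P R c
    · exact h1 hy
    · exact h2 (mem_compl.2 hy)
  have h1 := card_fixed_le (P := P) (Q := Q) (cut_invol h.invol c) (K := univ) (by simp) (by simp)
    (mem_univ c) key
  rw [card_fixed_cut h.invol hc] at h1
  have := h.fixed
  push_cast at h1
  linarith

theorem side_closed' (h : PlaneTree P R) (hc : R c ≠ c) (x : α) :
    P x ∈ side P R c ↔ x ∈ side P R c :=
  apply_mem_iff_of_closed (T := (side P R c : Set α)) (h.side_closed hc) x

theorem cut_mem_side (h : PlaneTree P R) (hc : R c ≠ c) {x : α} (hx : x ∈ side P R c) :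
    (swap c (R c) * R) x ∈ side P R c := by
  have := cut_mul_apply_mem_side P R c (x := P.symm x)
    ((h.side_closed' hc _).1 (by rwa [Equiv.apply_symm_apply]))
  rwa [Equiv.apply_symm_apply] at this

theorem apply_mem_side (h : PlaneTree P R) (hc : R c ≠ c) {x : α} (hx : x ∈ side P R c)
    (hxc : x ≠ c) : R x ∈ side P R c := by
  have h1 := h.cut_mem_side hc hx
  rw [swap_mul_invol h.invol, if_neg] at h1
  · exact h1
  · rintro (h2 | h2)
    · exact hxc h2
    · exact h.apply_notMem_side hc (h2 ▸ hx)

theorem card_fixed_side_le (h : PlaneTree P R) (hc : R c ≠ c) :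
    (((side P R c).filter fun x => R x = x).card : ℚ) ≤ ∑ x ∈ side P R c, wt P x + 1 := by
  have h1 := card_fixed_le (P := P) (Q := swap c (R c) * R) (cut_invol h.invol c)
    (K := side P R c) (h.side_closed hc) (fun x => h.cut_mem_side hc) (self_mem_side P R c) (by
      intro S hS hSP hSQ
      rw [side]
      refine orb_subset (fun x hx => ?_) hS
      exact hSQ (P x) (hSP x hx))
  have h2 : ((side P R c).filter fun x => (swap c (R c) * R) x = x) =
      insert c ((side P R c).filter fun x => R x = x) := by
    ext x
    rw [mem_filter, swap_mul_invol h.invol, mem_insert, mem_filter]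
    split_ifs with h3
    · rcases h3 with rfl | rfl
      · simp [self_mem_side]
      · simp [h.apply_notMem_side hc, hc]
    · simp only [not_or] at h3
      simp [h3.1]
  rw [h2, card_insert_of_notMem] at h1
  · push_cast at h1
    linarith
  · simp [hc]

theorem apply_apply_ne (h : PlaneTree P R) (hc : R c ≠ c) : R (R c) ≠ R c := by
  rw [h.invol]
  exact hc.symm

theorem sum_side_add (h : PlaneTree P R) (hc : R c ≠ c) {M : Type*} [AddCommMonoid M] (f : α → M) :
    ∑ x ∈ side P R c, f x + ∑ x ∈ side P R (R c), f x = ∑ x, f x := by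
  rw [h.side_apply hc, sum_add_sum_compl]

theorem le_card_fixed_side (h : PlaneTree P R) (hc : R c ≠ c) :
    ∑ x ∈ side P R c, wt P x + 1 ≤ (((side P R c).filter fun x => R x = x).card : ℚ) := by
  have h1 := h.card_fixed_side_le (h.apply_apply_ne hc)
  have h2 := h.fixed
  have h3 := h.sum_side_add hc (wt P)
  have h4 : (((side P R c).filter fun x => R x = x).card : ℚ) +
      ((side P R (R c)).filter fun x => R x = x).card = (univ.filter fun x => R x = x).card := by
    simp only [card_filter]
    exact_mod_cast h.sum_side_add hc (fun x => if R x = x then 1 else 0)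
  linarith

theorem reconnect_apply (h : PlaneTree P R) {x y : α} (hx : R x = x) (hy : R y = y)
    (hc : R c ≠ c) (t : α) : reconnect R c x y t =
      if t = c ∨ t = R c then t else if t = x then y else if t = y then x else R t := by
  rw [reconnect, Perm.mul_apply, swap_mul_invol h.invol]
  have ne : ∀ z, R z = z → c ≠ z ∧ R c ≠ z := fun z hz =>
    ⟨fun e => hc (by rw [e, hz]), fun e => hc (by rw [e, ← hz, ← e, h.invol])⟩
  split_ifs with h1 h2 h3
  · rcases h1 with rfl | rfl
    · exact swap_apply_of_ne_of_ne (ne x hx).1 (ne y hy).1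
    · exact swap_apply_of_ne_of_ne (ne x hx).2 (ne y hy).2
  · rw [h2, hx, swap_apply_left]
  · rw [h3, hy, swap_apply_right]
  · apply swap_apply_of_ne_of_ne
    · intro e; exact h2 (by rw [← h.invol t, e, hx])
    · intro e; exact h3 (by rw [← h.invol t, e, hy])

theorem reconnect (h : PlaneTree P R) (hc : R c ≠ c) {x y : α} (hx : x ∈ side P R c)
    (hy : y ∈ side P R (R c)) (hRx : R x = x) (hRy : R y = y) :
    PlaneTree P (reconnect R c x y) := by
  have hxy : x ≠ y := by
    rintro rfl
    rw [h.side_apply hc, mem_compl] at hy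
    exact hy hx
  have ne : ∀ z, R z = z → z ≠ c ∧ z ≠ R c := fun z hz =>
    ⟨fun e => hc (by rw [← e, hz]), fun e => hc (by rw [← e, ← hz, e, h.invol])⟩
  have hxc := ne x hRx
  have hyc := ne y hRy
  have happ := h.reconnect_apply hRx hRy hc
  refine ⟨fun t => ?_, ?_, ?_⟩
  · rw [happ t]
    split_ifs with h1 h2 h3
    · rw [happ, if_pos h1]
    · rw [happ, if_neg (by tauto), if_neg hxy.symm, if_pos rfl, h2]
    · rw [happ, if_neg (by tauto), if_pos rfl, h3]
    · have n : ∀ z, R z = z → t ≠ z → R t ≠ z := fun z hz h4 h5 => h4 (by rw [← h.invol t, h5, hz])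
      rw [happ, if_neg, if_neg (n x hRx h2), if_neg (n y hRy h3), h.invol]
      rintro (h4 | h4)
      · exact h1 (Or.inr (by rw [← h4, h.invol]))
      · exact h1 (Or.inl (R.injective h4))
  · rw [_root_.reconnect, mul_assoc, mul_assoc]
    have h1 := swap_mul_cover (y := R c) (fun t => Or.inl (h.contour c t))
    have h2 := not_sameCycle_swap_mul hc.symm (h.contour c (R c))
    rw [h.side_swap, mem_orb] at hy
    rw [side, mem_orb] at hx
    apply oneCycle_swap_mul
    · intro t
      rcases h1 t with h3 | h3
      · exact Or.inl (hx.symm.trans h3)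
      · exact Or.inr (hy.symm.trans h3)
    · intro h3
      exact h2 (hx.trans (h3.trans hy.symm))
  · refine h.fixed.trans ?_
    have hsub : (univ.filter fun t => R t = t) ∪ {c, R c} ⊆
        (univ.filter fun t => _root_.reconnect R c x y t = t) ∪ {x, y} := by
      intro t ht
      rw [mem_union, mem_filter, mem_insert, mem_singleton] at ht ⊢
      by_cases h1 : t = x ∨ t = y
      · exact Or.inr h1
      · left
        rw [happ]
        rw [not_or] at h1
        rcases ht with ht | ht
        · simp [h1, ht.2]
        · simp [ht]
    have h1 := (card_le_card hsub).trans (card_union_le _ _)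
    rw [card_pair hxy, card_union_of_disjoint, card_pair hc.symm] at h1
    · exact_mod_cast (by omega)
    · rw [Finset.disjoint_left]
      intro z hz hz'
      have h2 := ne z (mem_filter.1 hz).2
      simp only [mem_insert, mem_singleton] at hz'
      tauto

end PlaneTree

end Sides

section Moves

variable {α : Type*} [Fintype α] [DecidableEq α]

/-- Elementary modifications of a plane tree which are realised by boundedly many shears. -/
inductive Move (P : Perm α) : Perm α → Perm α → Prop
  | reconnect {R : Perm α} {c x y : α} : PlaneTree P R → PlaneTree P (reconnect R c x y) →
      R c ≠ c → R x = x → R y = y → x ≠ y → Move P R (reconnect R c x y)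
  | flip {R R' G : Perm α} {T : Finset α} {x : α} {m : ℕ} : PlaneTree P R → PlaneTree P R' →
      (∀ t, G (G t) = t) → (∀ t, G (R (P (G (R (P t))))) = t) →
      (∀ t ∈ T, R t ∈ T) → (∀ t ∈ T, G t ∈ T) → x ∈ T →
      (∀ S : Set α, (∀ t ∈ S, R t ∈ S) → (∀ t ∈ S, G t ∈ S) → x ∈ S → ∀ t ∈ T, t ∈ S) →
      1 ≤ m → (∀ t ∈ T, R' t = R (((R * G) ^ m) t)) → (∀ t ∉ T, R' t = R t) → Move P R R'

/-- `R'` is obtained from `R` by at most `N` elementary moves. -/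
inductive Moves (P : Perm α) : ℕ → Perm α → Perm α → Prop
  | refl (N : ℕ) (R : Perm α) : Moves P N R R
  | step {N : ℕ} {R R' R'' : Perm α} : Moves P N R R' → Move P R' R'' → Moves P (N + 1) R R''

theorem Moves.mono {P R R' : Perm α} {N M : ℕ} (h : Moves P N R R') (hNM : N ≤ M) :
    Moves P M R R' := by
  induction h generalizing M with
  | refl N R => exact .refl M _
  | step h1 h2 ih =>
    obtain ⟨M, rfl⟩ : ∃ k, M = k + 1 := ⟨M - 1, by omega⟩
    exact .step (ih (by omega)) h2

theorem Moves.trans {P R R' R'' : Perm α} {N M : ℕ} (h : Moves P N R R') (h' : Moves P M R' R'') :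
    Moves P (N + M) R R'' := by
  induction h' with
  | refl M R' => exact h.mono (by omega)
  | step h1 h2 ih => exact .step (ih h) h2

theorem Move.moves {P R R' : Perm α} (h : Move P R R') : Moves P 1 R R' := .step (.refl 0 R) h

namespace PlaneTree

variable {P R : Perm α} {c : α}

theorem move_reconnect (h : PlaneTree P R) (hc : R c ≠ c) {x y : α} (hx : x ∈ side P R c)
    (hy : y ∈ side P R (R c)) (hRx : R x = x) (hRy : R y = y) :
    Move P R (_root_.reconnect R c x y) := by
  refine Move.reconnect h (h.reconnect hc hx hy hRx hRy) hc hRx hRy ?_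
  rintro rfl
  rw [h.side_apply hc, mem_compl] at hy
  exact hy hx

theorem exists_fixed_mem_side (h : PlaneTree P R) (hc : R c ≠ c)
    (hs : 0 ≤ ∑ x ∈ side P R c, wt P x) : ∃ x ∈ side P R c, R x = x := by
  have h1 := h.le_card_fixed_side hc
  have h2 : (0 : ℚ) < ((side P R c).filter fun x => R x = x).card := by linarith
  obtain ⟨x, hx⟩ := card_pos.1 (by exact_mod_cast h2)
  exact ⟨x, (mem_filter.1 hx).1, (mem_filter.1 hx).2⟩

theorem exists_fixed_mem_side_ne (h : PlaneTree P R) (hc : R c ≠ c)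
    (hs : 0 < ∑ x ∈ side P R c, wt P x) (y : α) : ∃ x ∈ side P R c, R x = x ∧ x ≠ y := by
  have h1 := h.le_card_fixed_side hc
  have h2 : (1 : ℚ) < ((side P R c).filter fun x => R x = x).card := by linarith
  obtain ⟨x, hx, hxy⟩ := exists_mem_ne (by exact_mod_cast h2) y
  exact ⟨x, (mem_filter.1 hx).1, (mem_filter.1 hx).2, hxy⟩

end PlaneTree

theorem sum_wt_mono {P : Perm α} {S T : Finset α} (hST : S ⊆ T)
    (hleaf : ∀ x ∈ T, P x = x → x ∈ S) : ∑ x ∈ S, wt P x ≤ ∑ x ∈ T, wt P x :=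
  sum_le_sum_of_subset_of_nonneg hST fun x hx hxS => wt_nonneg fun h => hxS (hleaf x hx h)

/-- The union of the cycles of `P` through the entries of `l`. -/
def orbs (P : Perm α) : List α → Finset α
  | [] => ∅
  | a :: l => orb P a ∪ orbs P l

theorem orbs_cons (P : Perm α) (a : α) (l : List α) : orbs P (a :: l) = orb P a ∪ orbs P l := rfl

theorem orbs_closed (P : Perm α) (l : List α) : ∀ x ∈ orbs P l, P x ∈ orbs P l := by
  induction l with
  | nil => simp [orbs]
  | cons a l ih =>
    intro x hx
    rcases mem_union.1 hx with hx | hx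
    · exact mem_union_left _ (orb_closed _ _ _ hx)
    · exact mem_union_right _ (ih x hx)

theorem mem_orbs_self (P : Perm α) (a : α) (l : List α) : a ∈ orbs P (a :: l) :=
  mem_union_left _ (self_mem_orb _ _)

theorem mem_orbs {P : Perm α} {l : List α} {x : α} : x ∈ orbs P l ↔ ∃ a ∈ l, x ∈ orb P a := by
  induction l with
  | nil => simp [orbs]
  | cons a l ih => simp [orbs, ih]

/-- The entries of `l` lie on distinct cycles of `P` which are consecutively joined by `R`:
each entry is joined to the `P`-successor of the next one. -/
inductive Spine (P R : Perm α) : List α → Prop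
  | single (a : α) : Spine P R [a]
  | cons {b a : α} {l : List α} : Spine P R (a :: l) → R (P a) = b → P b ≠ b →
      b ∉ orbs P (a :: l) → Spine P R (b :: a :: l)

namespace Spine

variable {P R : Perm α} {a : α} {l : List α}

theorem subset (h : Spine P R (a :: l)) (hR : ∀ x, R (R x) = x) {T : Finset α}
    (hP : ∀ t ∈ T, P t ∈ T)
    (hT : ∀ t ∈ T, t ∈ orbs P (a :: l) → R t ∈ orbs P (a :: l) → t ≠ P a → R t ∈ T)
    {z : α} (hz : z ∈ orbs P (a :: l)) (hzT : z ∈ T) : orbs P (a :: l) ⊆ T := by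
  generalize hl : a :: l = l' at h
  induction h generalizing a l z with
  | single b =>
    obtain ⟨rfl, rfl⟩ := List.cons.inj hl
    simp only [orbs, union_empty] at hz ⊢
    rw [← orb_eq hz]
    exact orb_subset hP hzT
  | @cons b d l₀ h h1 h2 h3 ih =>
    obtain ⟨rfl, rfl⟩ := List.cons.inj hl
    have hPd : P d ∈ orbs P (d :: l₀) := orbs_closed _ _ _ (mem_orbs_self _ _ _)
    have hsub : orbs P (d :: l₀) ⊆ orbs P (a :: d :: l₀) := subset_union_right
    have key : ∀ z ∈ orbs P (d :: l₀), z ∈ T → orbs P (d :: l₀) ⊆ T := by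
      intro z hz hzT
      refine ih (fun t ht htS hRt _ => hT t ht (hsub htS) (hsub hRt) ?_) hz hzT rfl
      rintro rfl
      exact h3 ((mem_iff_of_mem_orb (orbs_closed _ _) (apply_mem_orb _ _)).1 htS)
    have ha := mem_orbs_self P a (d :: l₀)
    have hda : R a = P d := by rw [← h1, hR]
    have hfst : orbs P (d :: l₀) ⊆ T := by
      rcases mem_union.1 hz with hz | hz
      · refine key (P d) hPd ?_
        rw [← hda]
        refine hT a ?_ ha (by rw [hda]; exact hsub hPd) h2.symm
        exact (mem_iff_of_mem_orb hP hz).1 hzT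
      · exact key z hz hzT
    refine union_subset (orb_subset hP ?_) hfst
    rw [← h1]
    refine hT _ (hfst hPd) (hsub hPd) (by rwa [h1]) ?_
    intro e
    refine h3 ((mem_iff_of_mem_orb (orbs_closed _ _) (apply_mem_orb P a)).1 ?_)
    rwa [← e]

theorem subset_side (h : Spine P R (a :: l)) (hT : PlaneTree P R) {c : α} (hc : R c ≠ c)
    (hcS : c ∉ orbs P (a :: l) ∨ R c ∉ orbs P (a :: l) ∨ c = P a) {z : α}
    (hz : z ∈ orbs P (a :: l)) (hzc : z ∈ side P R c) : orbs P (a :: l) ⊆ side P R c := by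
  refine h.subset hT.invol (hT.side_closed hc) (fun t ht htS hRt hta => ?_) hz hzc
  refine hT.apply_mem_side hc ht ?_
  rintro rfl
  tauto

theorem apply_head (h : Spine P R (a :: l)) (hT : PlaneTree P R) :
    R (P a) = P a ∨ R (P a) ∉ orbs P (a :: l) := by
  by_contra! hc
  have := h.subset_side hT hc.1 (Or.inr (Or.inr rfl)) (orbs_closed _ _ _ (mem_orbs_self _ _ _))
    (PlaneTree.self_mem_side _ _ _) hc.2
  exact hT.apply_notMem_side hc.1 this

theorem congr {R' : Perm α} (h : Spine P R l)
    (hR : ∀ t ∈ orbs P l, R t ∈ orbs P l → R t ≠ t → R' t = R t) : Spine P R' l := by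
  induction h with
  | single a => exact .single a
  | @cons b a l h h1 h2 h3 ih =>
    have hsub : orbs P (a :: l) ⊆ orbs P (b :: a :: l) := subset_union_right
    have hPa : P a ∈ orbs P (a :: l) := orbs_closed _ _ _ (mem_orbs_self _ _ _)
    refine .cons (ih fun t ht htS => hR t (hsub ht) (hsub htS)) ?_ h2 h3
    rw [hR _ (hsub hPa) (by rw [h1]; exact mem_orbs_self _ _ _), h1]
    rw [h1]
    rintro rfl
    exact h3 hPa

theorem reconnect (h : Spine P R l) (hT : PlaneTree P R) {c x y : α} (hc : R c ≠ c)
    (hcS : c ∉ orbs P l ∨ R c ∉ orbs P l) (hx : R x = x) (hy : R y = y) :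
    Spine P (reconnect R c x y) l := by
  refine h.congr fun t ht htS htt => ?_
  rw [hT.reconnect_apply hx hy hc, if_neg, if_neg, if_neg]
  · rintro rfl; exact htt hy
  · rintro rfl; exact htt hx
  · rintro (rfl | rfl)
    · tauto
    · rw [hT.invol] at htS; tauto

theorem free_head (h : Spine P R (a :: l)) (hT : PlaneTree P R)
    (hleaf : ∀ x, P x = x → x ∈ orbs P (a :: l)) (hS : 0 ≤ ∑ x ∈ orbs P (a :: l), wt P x) :
    ∃ R', Moves P 1 R R' ∧ PlaneTree P R' ∧ Spine P R' (a :: l) ∧ R' (P a) = P a := by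
  rcases h.apply_head hT with h1 | h1
  · exact ⟨R, .refl _ _, hT, h, h1⟩
  · have hPa : P a ∈ orbs P (a :: l) := orbs_closed _ _ _ (mem_orbs_self _ _ _)
    have hc : R (P a) ≠ P a := fun e => h1 (by rwa [e])
    have hsub := h.subset_side hT hc (Or.inr (Or.inr rfl)) hPa (PlaneTree.self_mem_side _ _ _)
    obtain ⟨x, hx, hRx⟩ := hT.exists_fixed_mem_side hc
      (hS.trans (sum_wt_mono hsub fun x _ => hleaf x))
    obtain ⟨y, hy, hRy⟩ := hT.exists_fixed_mem_side (hT.apply_apply_ne hc)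
      (sum_nonneg fun y hy => wt_nonneg fun e => by
        rw [hT.side_apply hc, mem_compl] at hy
        exact hy (hsub (hleaf y e)))
    refine ⟨_, (hT.move_reconnect hc hx hy hRx hRy).moves, hT.reconnect hc hx hy hRx hRy,
      h.reconnect hT hc (Or.inr h1) hRx hRy, ?_⟩
    rw [hT.reconnect_apply hRx hRy hc, if_pos (Or.inl rfl)]

theorem free_target (h : Spine P R (a :: l)) (hT : PlaneTree P R)
    (hleaf : ∀ x, P x = x → x ∈ orbs P (a :: l)) (hS : 0 ≤ ∑ x ∈ orbs P (a :: l), wt P x)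
    (hfix : R (P a) = P a) {v : α} (hv : v ∉ orbs P (a :: l)) (hv3 : 3 ≤ sz P v) :
    ∃ R', Moves P 1 R R' ∧ PlaneTree P R' ∧ Spine P R' (a :: l) ∧ R' (P a) = P a ∧
      ∃ b ∈ orb P v, R' b = b := by
  by_cases hb : ∃ b ∈ orb P v, R b = b
  · exact ⟨R, .refl _ _, hT, h, hfix, hb⟩
  push Not at hb
  set S := orbs P (a :: l)
  have hPa : P a ∈ S := orbs_closed _ _ _ (mem_orbs_self _ _ _)
  have hdis : ∀ b ∈ orb P v, b ∉ S := fun b hb' h' =>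
    hv ((mem_iff_of_mem_orb (orbs_closed _ _) hb').1 h')
  obtain ⟨b, hbv, hPab⟩ : ∃ b ∈ orb P v, P a ∈ side P R b := by
    by_contra! hn
    have h1 : ∀ b ∈ orb P v, P a ∈ side P R (R b) := fun b hbv => by
      rw [hT.side_apply (hb b hbv), mem_compl]
      exact hn b hbv
    have n1 := hb v (self_mem_orb _ _)
    have n2 := hb _ (apply_mem_orb P v)
    have hsub : ∀ x ∈ side P R (R v), x ∈ ((side P R (R (P v)) ∪ side P R v : Finset α) : Set α) := by
      refine hT.side_subset (h1 v (self_mem_orb _ _))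
        (mem_coe.2 (mem_union_left _ (h1 _ (apply_mem_orb _ _)))) ?_ ?_
      · intro t ht
        rw [mem_coe, mem_union] at ht ⊢
        exact ht.imp (hT.side_closed (hT.apply_apply_ne n2) t) (hT.side_closed n1 t)
      · intro t ht ht1 ht2
        rw [hT.invol] at ht2
        rw [mem_coe, mem_union] at ht ⊢
        rcases ht with ht | ht
        · by_cases e : t = R (P v)
          · right
            rw [e, hT.invol]
            exact hT.side_closed n1 _ (PlaneTree.self_mem_side _ _ _)
          · exact Or.inl (hT.apply_mem_side (hT.apply_apply_ne n2) ht e)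
        · exact Or.inr (hT.apply_mem_side n1 ht ht2)
    have h2 := hsub _ (PlaneTree.self_mem_side P R (R v))
    rw [mem_coe, mem_union] at h2
    rcases h2 with h2 | h2
    · have h3 := hT.apply_mem_side (hT.apply_apply_ne n2) h2 (by
        intro e
        have h4 := R.injective e
        have : sz P v = 1 := sz_eq_one_iff.2 h4.symm
        omega)
      rw [hT.invol] at h3
      have h4 := hT.side_closed (hT.apply_apply_ne n2) _ h3
      rw [hT.side_apply n2, mem_compl] at h4
      exact h4 (PlaneTree.self_mem_side _ _ _)
    · exact hT.apply_notMem_side n1 h2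
  have hc := hb b hbv
  have hbS := hdis b hbv
  have hsub := h.subset_side hT hc (Or.inl hbS) hPa hPab
  have hsub' : S ∪ orb P b ⊆ side P R b :=
    union_subset hsub (orb_subset (hT.side_closed hc) (PlaneTree.self_mem_side _ _ _))
  have hpos : 0 < ∑ x ∈ side P R b, wt P x := by
    refine lt_of_lt_of_le ?_ (sum_wt_mono hsub' fun x _ hx => mem_union_left _ (hleaf x hx))
    rw [sum_union (disjoint_orb (orbs_closed _ _) hbS), sum_wt_orb, sz_eq hbv]
    have : (3 : ℚ) ≤ sz P v := by exact_mod_cast hv3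
    linarith
  obtain ⟨x, hx, hRx, hxne⟩ := hT.exists_fixed_mem_side_ne hc hpos (P a)
  obtain ⟨y, hy, hRy⟩ := hT.exists_fixed_mem_side (hT.apply_apply_ne hc)
    (sum_nonneg fun y hy => wt_nonneg fun e => by
      rw [hT.side_apply hc, mem_compl] at hy
      exact hy (hsub (hleaf y e)))
  refine ⟨_, (hT.move_reconnect hc hx hy hRx hRy).moves, hT.reconnect hc hx hy hRx hRy,
    h.reconnect hT hc (Or.inl hbS) hRx hRy, ?_, b, hbv, ?_⟩
  · rw [hT.reconnect_apply hRx hRy hc, if_neg hxne.symm, if_neg (c := P a = y), hfix,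
      ite_self]
    rintro rfl
    rw [hT.side_apply hc, mem_compl] at hy
    exact hy hPab
  · rw [hT.reconnect_apply hRx hRy hc, if_pos (Or.inl rfl)]

theorem exists_exit (hT : PlaneTree P R) {S : Finset α} (hS : ∀ x ∈ S, P x ∈ S) {a : α} (ha : a ∈ S)
    {b : α} (hb : b ∉ S) : ∃ c ∈ S, R c ∉ S ∧ R c ≠ c ∧ b ∈ side P R (R c) := by
  set T : Set α := {b | b ∈ S ∨ ∃ c ∈ S, R c ∉ S ∧ b ∈ side P R (R c)}
  have hne : ∀ c ∈ S, R c ∉ S → R c ≠ c := fun c hc hRc e => hRc (by rwa [e])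
  have : b ∈ T := by
    refine hT.univ_subset (T := T) (Or.inl ha) ?_ ?_ b
    · rintro t (ht | ⟨c, hc, hRc, ht⟩)
      · exact Or.inl (hS t ht)
      · exact Or.inr ⟨c, hc, hRc, hT.side_closed (hT.apply_apply_ne (hne c hc hRc)) _ ht⟩
    · rintro t (ht | ⟨c, hc, hRc, ht⟩)
      · by_cases h1 : R t ∈ S
        · exact Or.inl h1
        · exact Or.inr ⟨t, ht, h1, PlaneTree.self_mem_side _ _ _⟩
      · by_cases e : t = R c
        · left
          rwa [e, hT.invol]
        · exact Or.inr ⟨c, hc, hRc, hT.apply_mem_side (hT.apply_apply_ne (hne c hc hRc)) ht e⟩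
  rcases this with h | ⟨c, hc, hRc, h⟩
  · exact absurd h hb
  · exact ⟨c, hc, hRc, hne c hc hRc, h⟩

theorem attach (h : Spine P R (a :: l)) (hT : PlaneTree P R)
    (hfix : R (P a) = P a) {b : α} (hb : b ∉ orbs P (a :: l)) (hb1 : P b ≠ b) (hRb : R b = b) :
    ∃ R', Moves P 1 R R' ∧ PlaneTree P R' ∧ Spine P R' (b :: a :: l) := by
  have hPa : P a ∈ orbs P (a :: l) := orbs_closed _ _ _ (mem_orbs_self _ _ _)
  obtain ⟨c, hcS, hRc, hc, hbc⟩ := exists_exit hT (orbs_closed _ _) hPa hb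
  have hsub := h.subset_side hT hc (Or.inr (Or.inl hRc)) hcS (PlaneTree.self_mem_side _ _ _)
  refine ⟨_, (hT.move_reconnect hc (hsub hPa) hbc hfix hRb).moves,
    hT.reconnect hc (hsub hPa) hbc hfix hRb,
    .cons (h.reconnect hT hc (Or.inr hRc) hfix hRb) ?_ hb1 hb⟩
  rw [hT.reconnect_apply hfix hRb hc, if_neg, if_pos rfl]
  rintro (e | e)
  · exact hc (by rw [← e, hfix])
  · exact hRc (by rwa [← e])

theorem extend (h : Spine P R (a :: l)) (hT : PlaneTree P R)
    (hleaf : ∀ x, P x = x → x ∈ orbs P (a :: l)) (hS : 0 ≤ ∑ x ∈ orbs P (a :: l), wt P x)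
    {v : α} (hv : v ∉ orbs P (a :: l)) (hv3 : 3 ≤ sz P v) :
    ∃ R' b, Moves P 3 R R' ∧ PlaneTree P R' ∧ b ∈ orb P v ∧ Spine P R' (b :: a :: l) := by
  obtain ⟨R₁, m₁, t₁, s₁, f₁⟩ := h.free_head hT hleaf hS
  obtain ⟨R₂, m₂, t₂, s₂, f₂, b, hb, hRb⟩ := s₁.free_target t₁ hleaf hS f₁ hv hv3
  have hbS : b ∉ orbs P (a :: l) := fun h' => hv ((mem_iff_of_mem_orb (orbs_closed _ _) hb).1 h')
  have hb1 : P b ≠ b := fun e => by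
    have := sz_eq_one_iff.2 e
    rw [sz_eq hb] at this
    omega
  obtain ⟨R₃, m₃, t₃, s₃⟩ := s₂.attach t₂ f₂ hbS hb1 hRb
  exact ⟨R₃, b, (m₁.trans m₂).trans m₃, t₃, hb, s₃⟩

end Spine

end Moves

section Greedy

variable {α : Type*} [Fintype α] [DecidableEq α]

/-- The cycle length, except that fixed points are ranked above all longer cycles. -/
def rank (P : Perm α) (x : α) : ℕ := if sz P x = 1 then Fintype.card α + 1 else sz P x

/-- A spine which starts at the fixed point of `P`, if any, and continues with the longest
cycles of `P`. -/
structure Greedy (P R : Perm α) (l : List α) : Prop where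
  spine : Spine P R l
  leaf : ∀ x, P x = x → x ∈ orbs P l
  sorted : l.Pairwise fun b a => rank P b ≤ rank P a
  top : ∀ x ∉ orbs P l, ∀ a ∈ l, rank P x ≤ rank P a

namespace Greedy

variable {P R : Perm α} {a : α} {l : List α}

theorem rank_eq (h : Greedy P R l) {x : α} (hx : x ∉ orbs P l) : rank P x = sz P x :=
  if_neg fun e => hx (h.leaf x (sz_eq_one_iff.1 e))

theorem rank_congr {x y : α} (h : y ∈ orb P x) : rank P y = rank P x := by
  rw [rank, rank, sz_eq h]

theorem cons {R' : Perm α} (h : Greedy P R (a :: l)) {b : α} (hs : Spine P R' (b :: a :: l))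
    (hb : b ∉ orbs P (a :: l)) (htop : ∀ x ∉ orbs P (a :: l), sz P x ≤ sz P b) :
    Greedy P R' (b :: a :: l) where
  spine := hs
  leaf x hx := mem_union_right _ (h.leaf x hx)
  sorted := List.pairwise_cons.2 ⟨h.top b hb, h.sorted⟩
  top x hx c hc := by
    rw [orbs_cons, mem_union, not_or] at hx
    rcases List.mem_cons.1 hc with rfl | hc
    · rw [h.rank_eq hx.2, h.rank_eq hb]
      exact htop x hx.2
    · exact h.top x hx.2 c hc

theorem card_compl_cons_lt {b : α} (hb : b ∉ orbs P (a :: l)) :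
    (orbs P (b :: a :: l))ᶜ.card < (orbs P (a :: l))ᶜ.card := by
  refine card_lt_card ⟨compl_subset_compl.2 subset_union_right, fun hsub => ?_⟩
  exact (mem_compl.1 (hsub (mem_compl.2 hb))) (mem_orbs_self _ _ _)

theorem exhaust_large (h : Greedy P R (a :: l)) (hT : PlaneTree P R)
    (hS : 0 ≤ ∑ x ∈ orbs P (a :: l), wt P x)
    (hcard : ((orbs P (a :: l)).card : ℚ) ≤ 3 * ∑ x ∈ orbs P (a :: l), wt P x + 6) :
    ∃ R' a' l' N, Moves P N R R' ∧
      (N : ℚ) ≤ 3 * (∑ x, wt P x - ∑ x ∈ orbs P (a :: l), wt P x) ∧ PlaneTree P R' ∧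
      Greedy P R' (a' :: l') ∧ (∀ x ∉ orbs P (a' :: l'), sz P x ≤ 2) ∧
      ((orbs P (a' :: l')).card : ℚ) ≤ 3 * ∑ x ∈ orbs P (a' :: l'), wt P x + 6 := by
  induction hk : (orbs P (a :: l))ᶜ.card using Nat.strong_induction_on generalizing R a l with
  | _ k ih =>
  by_cases hall : ∀ x ∉ orbs P (a :: l), sz P x ≤ 2
  · refine ⟨R, a, l, 0, .refl _ _, ?_, hT, h, hall, hcard⟩
    have := sum_wt_mono (subset_univ _) fun x _ => h.leaf x
    push_cast
    linarith
  · push Not at hall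
    obtain ⟨u, hu, hu3⟩ := hall
    obtain ⟨v, hv, hmax⟩ := exists_max_image _ (sz P) ⟨u, mem_compl.2 hu⟩
    have hv3 : 3 ≤ sz P v := lt_of_lt_of_le hu3 (hmax u (mem_compl.2 hu))
    obtain ⟨R', b, m, t, hb, s⟩ := h.spine.extend hT h.leaf hS (mem_compl.1 hv) hv3
    have hbS : b ∉ orbs P (a :: l) := fun h' =>
      (mem_compl.1 hv) ((mem_iff_of_mem_orb (orbs_closed _ _) hb).1 h')
    have g := h.cons s hbS fun x hx => by
      rw [sz_eq hb]
      exact hmax x (mem_compl.2 hx)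
    have hdis := disjoint_orb (orbs_closed _ _) hbS
    have hsum : ∑ x ∈ orbs P (b :: a :: l), wt P x =
        ∑ x ∈ orbs P (a :: l), wt P x + (sz P v - 2) := by
      rw [orbs_cons, sum_union hdis.symm, sum_wt_orb, sz_eq hb, add_comm]
    have hv3' : (3 : ℚ) ≤ sz P v := by exact_mod_cast hv3
    obtain ⟨R₂, a₂, l₂, N, m₂, hN, rest⟩ := ih _ (hk ▸ card_compl_cons_lt hbS) g t
      (by rw [hsum]; linarith) (by
        rw [hsum, orbs_cons, card_union_of_disjoint hdis.symm, ← sz, sz_eq hb]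
        push_cast
        linarith) rfl
    refine ⟨R₂, a₂, l₂, 3 + N, m.trans m₂, ?_, rest⟩
    rw [hsum] at hN
    push_cast
    linarith

/-- The points of the spine, other than its free end, at which further subtrees are attached. -/
def branches (P R : Perm α) (a : α) (l : List α) : Finset α :=
  (orbs P (a :: l)).filter fun c => c ≠ P a ∧ R c ∉ orbs P (a :: l)

theorem exhaust_small (h : Greedy P R (a :: l)) (hT : PlaneTree P R)
    (hsmall : ∀ x ∉ orbs P (a :: l), sz P x ≤ 2) :
    ∃ R' l', Moves P (branches P R a l).card R R' ∧ PlaneTree P R' ∧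
      Greedy P R' l' ∧ orbs P l' = univ := by
  induction hk : (orbs P (a :: l))ᶜ.card using Nat.strong_induction_on generalizing R a l with
  | _ k ih =>
  by_cases huniv : orbs P (a :: l) = univ
  · exact ⟨R, _, .refl _ _, hT, h, huniv⟩
  have hPa : P a ∈ orbs P (a :: l) := orbs_closed _ _ _ (mem_orbs_self _ _ _)
  have hne : ∀ b ∉ orbs P (a :: l), P b ≠ b := fun b hb e => hb (h.leaf b e)
  have hsz : ∀ b ∉ orbs P (a :: l), ∀ x ∉ orbs P (a :: l), sz P x ≤ sz P b := by
    intro b hb x hx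
    have h1 := hsmall x hx
    have h2 : sz P b ≠ 1 := fun e => hne b hb (sz_eq_one_iff.1 e)
    have := sz_pos P b
    omega
  have horb : ∀ b ∉ orbs P (a :: l), ∀ t ∈ orb P b, t = b ∨ t = P b := by
    intro b hb t ht
    have h1 : P (P b) = b := by
      by_contra h1
      have := three_le_sz.2 h1
      have := hsmall b hb
      omega
    have : orb P b ⊆ {b, P b} := orb_subset (by simp [h1]) (by simp)
    simpa using this ht
  have hsm : ∀ b, ∀ x ∉ orbs P (b :: a :: l), sz P x ≤ 2 := fun b x hx =>
    hsmall x fun hx' => hx (mem_union_right _ hx')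
  rcases h.spine.apply_head hT with hfix | hout
  · obtain ⟨b₀, hb₀⟩ : ∃ b, b ∉ orbs P (a :: l) := by
      by_contra! hn
      exact huniv (eq_univ_iff_forall.2 hn)
    obtain ⟨c, hcS, hRc, hc, -⟩ := Spine.exists_exit hT (orbs_closed _ _) hPa hb₀
    have hsub := h.spine.subset_side hT hc (Or.inr (Or.inl hRc)) hcS
      (PlaneTree.self_mem_side _ _ _)
    have hside : ∀ x ∈ side P R (R c), x ∉ orbs P (a :: l) := fun x hx hxS => by
      rw [hT.side_apply hc, mem_compl] at hx
      exact hx (hsub hxS)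
    obtain ⟨x, hx, hRx⟩ := hT.exists_fixed_mem_side (hT.apply_apply_ne hc)
      (sum_nonneg fun y hy => wt_nonneg (hne y (hside y hy)))
    have hxS := hside x hx
    have hcPa : c ≠ P a := fun e => hc (by rw [e, hfix])
    have happ := hT.reconnect_apply hfix hRx hc
    have hR'Pa : reconnect R c (P a) x (P a) = x := by
      rw [happ, if_neg, if_pos rfl]
      rintro (e | e)
      · exact hcPa e.symm
      · exact hRc (by rwa [← e])
    have t' := hT.reconnect hc (hsub hPa) hx hfix hRx
    have s' := Spine.cons (h.spine.reconnect hT hc (Or.inr hRc) hfix hRx) hR'Pa (hne x hxS) hxS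
    obtain ⟨R₂, l₂, m₂, rest⟩ := ih _ (hk ▸ card_compl_cons_lt hxS)
      (h.cons s' hxS (hsz x hxS)) t' (hsm x) rfl
    refine ⟨R₂, l₂, ?_, rest⟩
    refine ((hT.move_reconnect hc (hsub hPa) hx hfix hRx).moves.trans m₂).mono ?_
    have hlt : branches P (reconnect R c (P a) x) x (a :: l) ⊂ branches P R a l := by
      have hcm : c ∈ branches P R a l := mem_filter.2 ⟨hcS, hcPa, hRc⟩
      refine ssubset_iff_of_subset ?_ |>.2 ⟨c, hcm, ?_⟩
      · intro t ht
        obtain ⟨h1, h2, h3⟩ := mem_filter.1 ht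
        rw [orbs_cons, mem_union, not_or] at h3
        rcases mem_union.1 h1 with h4 | h4
        · exfalso
          rcases horb x hxS t h4 with rfl | e
          · apply h3.2
            rw [happ, if_neg, if_neg, if_pos rfl]
            · exact hPa
            · rintro rfl; exact hxS hPa
            · rintro (e | e)
              · exact hc (by rw [← e, hRx])
              · exact hc (by rw [e, hT.invol] at hRx; exact hRx.symm)
          · exact h2 e
        · have e5 : t ≠ x := by rintro rfl; exact hxS h4
          have e1 : t ≠ c := by
            rintro rfl
            rw [happ, if_pos (Or.inl rfl)] at h3
            exact h3.2 hcS
          have e2 : t ≠ R c := by rintro rfl; exact hRc h4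
          have e3 : t ≠ P a := by
            rintro rfl
            rw [hR'Pa] at h3
            exact h3.1 (self_mem_orb _ _)
          rw [happ, if_neg (by tauto), if_neg e3, if_neg e5] at h3
          exact mem_filter.2 ⟨h4, e3, h3.2⟩
      · intro hcm'
        have := (mem_filter.1 hcm').2.2
        rw [happ, if_pos (Or.inl rfl)] at this
        exact this (mem_union_right _ hcS)
    have := card_lt_card hlt
    omega
  · have s' := Spine.cons h.spine rfl (hne _ hout) hout
    obtain ⟨R₂, l₂, m₂, rest⟩ := ih _ (hk ▸ card_compl_cons_lt hout)
      (h.cons s' hout (hsz _ hout)) hT (hsm _) rfl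
    refine ⟨R₂, l₂, m₂.mono (card_le_card ?_), rest⟩
    intro t ht
    obtain ⟨h1, h2, h3⟩ := mem_filter.1 ht
    rw [orbs_cons, mem_union, not_or] at h3
    rcases mem_union.1 h1 with h1 | h1
    · exfalso
      rcases horb _ hout t h1 with rfl | e
      · exact h3.2 (by rwa [hT.invol])
      · exact h2 e
    · refine mem_filter.2 ⟨h1, ?_, h3.2⟩
      rintro rfl
      exact h3.1 (self_mem_orb _ _)

theorem exists_normal (h : Greedy P R (a :: l)) (hT : PlaneTree P R)
    (hS : 0 ≤ ∑ x ∈ orbs P (a :: l), wt P x)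
    (hcard : ((orbs P (a :: l)).card : ℚ) ≤ 3 * ∑ x ∈ orbs P (a :: l), wt P x + 6) :
    ∃ R' l' N, Moves P N R R' ∧ (N : ℚ) ≤ 6 * ∑ x, wt P x + 6 ∧ PlaneTree P R' ∧
      Greedy P R' l' ∧ orbs P l' = univ := by
  obtain ⟨R₁, a₁, l₁, N₁, m₁, hN₁, t₁, g₁, hsm, hc₁⟩ := h.exhaust_large hT hS hcard
  obtain ⟨R₂, l₂, m₂, rest⟩ := g₁.exhaust_small t₁ hsm
  refine ⟨R₂, l₂, _, m₁.trans m₂, ?_, rest⟩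
  have h1 : ((branches P R₁ a₁ l₁).card : ℚ) ≤ (orbs P (a₁ :: l₁)).card := by
    exact_mod_cast card_filter_le _ _
  have h2 := sum_wt_mono (subset_univ _) fun x _ => g₁.leaf x
  push_cast
  linarith

theorem eq_chain (h : Greedy P R l) (hT : PlaneTree P R) (hu : orbs P l = univ) {x : α}
    (hx : R x ≠ x) (hn : ∀ i (hi : i + 1 < l.length), x ≠ l[i] ∧ R x ≠ l[i]) : False := by
  have key : ∀ l', Spine P R l' →
      (∀ i (hi : i + 1 < l'.length), x ≠ l'[i] ∧ R x ≠ l'[i]) →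
      (∃ z ∈ orbs P l', z ∈ side P R x) → orbs P l' ⊆ side P R x := by
    intro l' hs
    induction hs with
    | single a =>
      rintro - ⟨z, hz, hzx⟩
      simp only [orbs, union_empty] at hz ⊢
      rw [← orb_eq hz]
      exact orb_subset (hT.side_closed hx) hzx
    | @cons b a l' hs h1 h2 h3 ih =>
      rintro hn ⟨z, hz, hzx⟩
      have ih' := ih fun i hi => by
        have := hn (i + 1) (by simpa using hi)
        simpa using this
      have h0 := hn 0 (by simp)
      simp only [List.getElem_cons_zero] at h0
      have hPa : P a ∈ orbs P (a :: l') := orbs_closed _ _ _ (mem_orbs_self _ _ _)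
      have hRb : R b = P a := by rw [← h1, hT.invol]
      have hfst : orbs P (a :: l') ⊆ side P R x := by
        rcases mem_union.1 hz with hz | hz
        · refine ih' ⟨P a, hPa, ?_⟩
          rw [← hRb]
          exact hT.apply_mem_side hx ((mem_iff_of_mem_orb (hT.side_closed hx) hz).1 hzx) h0.1.symm
        · exact ih' ⟨z, hz, hzx⟩
      refine union_subset (orb_subset (hT.side_closed hx) ?_) hfst
      rw [← h1]
      refine hT.apply_mem_side hx (hfst hPa) ?_
      rintro e
      exact h0.2 (by rw [← e, h1])
  have := key l h.spine hn ⟨x, by rw [hu]; exact mem_univ _, PlaneTree.self_mem_side _ _ _⟩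
  exact hT.apply_notMem_side hx (this (by rw [hu]; exact mem_univ _))

end Greedy

end Greedy

section Flips

variable {α : Type*} [Fintype α] [DecidableEq α]

theorem OneCycle.zpow_eq {f : Perm α} (hf : OneCycle f) {i j : ℤ} {x : α}
    (h : (f ^ i) x = (f ^ j) x) : f ^ i = f ^ j := by
  ext y
  obtain ⟨k, rfl⟩ := hf x y
  rw [← Perm.mul_apply, ← Perm.mul_apply, ← zpow_add, ← zpow_add, add_comm i, add_comm j, zpow_add,
    zpow_add, Perm.mul_apply, Perm.mul_apply, h]

theorem OneCycle.pow_inj {f : Perm α} (hf : OneCycle f) {i j : ℕ} {x : α} (hi : i < orderOf f)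
    (hj : j < orderOf f) (h : (f ^ i) x = (f ^ j) x) : i = j := by
  have := hf.zpow_eq (i := i) (j := j) (x := x) (by simpa using h)
  rw [zpow_natCast, zpow_natCast] at this
  exact pow_injOn_Iio_orderOf hi hj this

/-- The reflection of the cycle `f` exchanging `x` and `y`. -/
theorem OneCycle.exists_reflection {f : Perm α} (hf : OneCycle f) (x y : α) :
    ∃ G : Perm α, (∀ t, G (G t) = t) ∧ (∀ t, G (f (G (f t))) = t) ∧
      ∀ s : ℤ, G ((f ^ s) x) = (f ^ (-s)) y := by
  choose s hs using hf x
  obtain ⟨k, hk⟩ := hf x y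
  set g : α → α := fun t => (f ^ (-s t)) y
  have hg : ∀ i : ℤ, g ((f ^ i) x) = (f ^ (-i)) y := fun i => by
    have := hf.zpow_eq (hs ((f ^ i) x))
    simp only [g]
    rw [zpow_neg, this, ← zpow_neg]
  have hg' : ∀ i : ℤ, g ((f ^ i) y) = (f ^ (-i)) x := fun i => by
    rw [← hk, ← Perm.mul_apply, ← zpow_add, hg, ← hk, ← Perm.mul_apply, ← zpow_add]
    congr 2
    ring
  have hinv : Function.Involutive g := fun t => by
    rw [← hs t, hg, hg', neg_neg]
  refine ⟨hinv.toPerm, hinv, fun t => ?_, hg⟩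
  obtain ⟨i, rfl⟩ := hf x t
  have e1 : f ((f ^ i) x) = (f ^ (1 + i)) x := by rw [zpow_one_add, Perm.mul_apply]
  have e2 : f ((f ^ (-(1 + i))) y) = (f ^ (-i)) y := by
    rw [← Perm.mul_apply, ← zpow_one_add]
    congr 2
    ring
  change g (f (g (f ((f ^ i) x)))) = _
  rw [e1, hg, e2, hg', neg_neg]

/-- Twist `R` by `(R * G) ^ m` on `T`. -/
theorem exists_twist {R G : Perm α} (hR : ∀ t, R (R t) = t) (hG : ∀ t, G (G t) = t)
    {T : Finset α} (hRT : ∀ t ∈ T, R t ∈ T) (hGT : ∀ t ∈ T, G t ∈ T) (m : ℕ) :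
    ∃ R' : Perm α, (∀ t, R' (R' t) = t) ∧ (∀ t ∈ T, R' t = R (((R * G) ^ m) t)) ∧
      ∀ t ∉ T, R' t = R t := by
  have hpow : ∀ m, ∀ t ∈ T, ((R * G) ^ m) t ∈ T := by
    intro m
    induction m with
    | zero => simp
    | succ m ih =>
      intro t ht
      rw [pow_succ', Perm.mul_apply]
      exact hRT _ (hGT _ (ih t ht))
  have hinv : ∀ m t, ((R * G) ^ m) (R (((R * G) ^ m) t)) = R t := by
    intro m
    induction m with
    | zero => simp
    | succ m ih =>
      intro t
      have e : (R * G) (R (((R * G) ^ (m + 1)) t)) = R (((R * G) ^ m) t) := by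
        rw [pow_succ', Perm.mul_apply (R * G) ((R * G) ^ m)]
        simp only [Perm.mul_apply, hR, hG]
      rw [pow_succ, Perm.mul_apply, ← pow_succ, e, ih]
  set g : α → α := fun t => if t ∈ T then R (((R * G) ^ m) t) else R t
  have h : Function.Involutive g := by
    intro t
    by_cases ht : t ∈ T
    · simp only [g, if_pos ht, if_pos (hRT _ (hpow m t ht)), hinv, hR]
    · have : R t ∉ T := fun h => ht (by rw [← hR t]; exact hRT _ h)
      simp only [g, if_neg ht, if_neg this, hR]
  exact ⟨h.toPerm, h, fun t ht => if_pos ht, fun t ht => if_neg ht⟩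

end Flips

section Legs

variable {α : Type*} [Fintype α] [DecidableEq α]

theorem card_fixed_le_card_fixed {R R' : Perm α} {z p : α} (hp : R' p = p)
    (h : ∀ x, R x = x → x ≠ z → R' x = x ∧ x ≠ p) :
    (univ.filter fun x => R x = x).card ≤ (univ.filter fun x => R' x = x).card := by
  have h1 : (univ.filter fun x => R x = x).erase z ⊆ (univ.filter fun x => R' x = x).erase p := by
    intro x hx
    obtain ⟨h1, h2⟩ := mem_erase.1 hx
    obtain ⟨h3, h4⟩ := h x (mem_filter.1 h2).2 h1
    exact mem_erase.2 ⟨h4, mem_filter.2 ⟨mem_univ _, h3⟩⟩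
  have h2 := card_le_card h1
  have h3 : p ∈ univ.filter fun x => R' x = x := mem_filter.2 ⟨mem_univ _, hp⟩
  rw [card_erase_of_mem h3] at h2
  have h4 := pred_card_le_card_erase (s := univ.filter fun x => R x = x) (a := z)
  have := card_pos.2 ⟨p, h3⟩
  omega

/-- `b` runs along the contour around a path of `P`-cycles of length two ending in the fixed point
`b A` of `P`, from and to a longer `P`-cycle. -/
structure Leg (P R : Perm α) (A : ℕ) (b : ℕ → α) : Prop where
  inj : ∀ s t, s ≤ 2 * A → t ≤ 2 * A → b s = b t → s = t
  vert : ∀ s, s < 2 * A → P (b s) = b (2 * A - s)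
  edge : ∀ s, 1 ≤ s → s ≤ 2 * A → R (b s) = b (2 * A + 1 - s)
  last : P (b (2 * A)) ≠ b 0

theorem Leg.pow_apply {P R : Perm α} {A : ℕ} {b : ℕ → α} (hb : Leg P R A b) {s : ℕ}
    (hs : s ≤ 2 * A) : ((R * P) ^ s) (b 0) = b s := by
  induction s with
  | zero => rfl
  | succ s ih =>
    rw [pow_succ', Perm.mul_apply, ih (by omega), Perm.mul_apply, hb.vert s (by omega),
      hb.edge _ (by omega) (by omega)]
    congr 1
    omega

namespace PlaneTree

variable {P R : Perm α}

theorem exists_move_leg (h : PlaneTree P R) {A : ℕ} (hA : 1 ≤ A) {b : ℕ → α} (hL : Leg P R A b)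
    (hz : R (b 0) = b 0) : ∃ R', Move P R R' ∧ PlaneTree P R' ∧ R' (b A) = b 0 := by
  set ρ := R * P with hρ
  have hc : OneCycle ρ := h.contour
  have hρb : ∀ s, s ≤ 2 * A → (ρ ^ s) (b 0) = b s := fun s hs => hL.pow_apply hs
  have hPb := hL.vert
  have hRb := hL.edge
  obtain ⟨G, hG, hGρ, hGz⟩ := hc.exists_reflection (b 0) (b (2 * A))
  have hGb : ∀ s, s ≤ 2 * A → G (b s) = b (2 * A - s) := fun s hs => by
    have := hGz s
    rw [zpow_natCast, hρb s hs] at this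
    rw [this, ← hρb _ le_rfl, ← hρb _ (Nat.sub_le _ _), ← zpow_natCast, ← zpow_natCast,
      ← Perm.mul_apply, ← zpow_add]
    congr 2
    push_cast [Nat.cast_sub hs]
    ring
  set T : Finset α := (range (2 * A + 1)).image b with hTdef
  have hT : ∀ s, s ≤ 2 * A → b s ∈ T := fun s hs =>
    mem_image_of_mem _ (mem_range.2 (by omega))
  have hT' : ∀ t ∈ T, ∃ s, s ≤ 2 * A ∧ b s = t := fun t ht => by
    obtain ⟨s, hs, rfl⟩ := mem_image.1 ht
    exact ⟨s, by have := mem_range.1 hs; omega, rfl⟩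
  have hRT : ∀ t ∈ T, R t ∈ T := by
    intro t ht
    obtain ⟨s, hs, rfl⟩ := hT' t ht
    rcases Nat.eq_zero_or_pos s with rfl | h0
    · rw [hz]
      exact hT 0 (by omega)
    · rw [hRb s h0 hs]
      exact hT _ (by omega)
  have hGT : ∀ t ∈ T, G t ∈ T := by
    intro t ht
    obtain ⟨s, hs, rfl⟩ := hT' t ht
    rw [hGb s hs]
    exact hT _ (by omega)
  have hstep : ∀ s, s < 2 * A → (R * G) (b s) = b (s + 1) := fun s hs => by
    rw [Perm.mul_apply, hGb s hs.le, hRb _ (by omega) (by omega)]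
    congr 1
    omega
  have hlast : (R * G) (b (2 * A)) = b 0 := by
    rw [Perm.mul_apply, hGb _ le_rfl, Nat.sub_self, hz]
  have hpow : ∀ m s, s + m ≤ 2 * A → ((R * G) ^ m) (b s) = b (s + m) := by
    intro m
    induction m with
    | zero => simp
    | succ m ih =>
      intro s hs
      rw [pow_succ', Perm.mul_apply, ih s (by omega), hstep _ (by omega), add_assoc]
  have hpow' : ∀ m s, s ≤ 2 * A → 2 * A + 1 ≤ s + m → s + m < 4 * A + 2 →
      ((R * G) ^ m) (b s) = b (s + m - (2 * A + 1)) := by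
    intro m s hs h1 h2
    obtain ⟨k, rfl⟩ : ∃ k, m = k + 1 + (2 * A - s) := ⟨m - 1 - (2 * A - s), by omega⟩
    rw [pow_add, Perm.mul_apply, hpow _ _ (by omega), pow_succ, Perm.mul_apply,
      show s + (2 * A - s) = 2 * A by omega, hlast, hpow _ _ (by omega)]
    congr 1
    omega
  obtain ⟨R', hR', hR'T, hR'n⟩ := exists_twist h.invol hG hRT hGT (A + 1)
  have hlo : ∀ s, s ≤ A → R' (b s) = b (A - s) := fun s hs => by
    rw [hR'T _ (hT s (by omega))]
    rcases hs.lt_or_eq with h1 | rfl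
    · rw [hpow _ _ (by omega), hRb _ (by omega) (by omega)]
      congr 1
      omega
    · rw [hpow' _ _ (by omega) (by omega) (by omega), show s + (s + 1) - (2 * s + 1) = 0 by omega,
        Nat.sub_self, hz]
  have hhi : ∀ s, A < s → s ≤ 2 * A → R' (b s) = b (3 * A + 1 - s) := fun s hs hs' => by
    rw [hR'T _ (hT s (by omega)), hpow' _ _ (by omega) (by omega) (by omega),
      hRb _ (by omega) (by omega)]
    congr 1
    omega
  have hsame : ∀ t, ρ t ∉ T → (R' * P) t = ρ t := fun t ht => by
    rw [Perm.mul_apply, hR'n _ fun h' => ht (hRT _ h')]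
    rfl
  have htree : PlaneTree P R' := by
    refine ⟨hR', ?_, h.fixed.trans ?_⟩
    · set S : Set α := {x | (R' * P).SameCycle (b 0) x} with hS
      have hmem : ∀ {t}, t ∈ S → (R' * P) t ∈ S := fun ht => sameCycle_apply_right.2 ht
      have hmem' : ∀ {t}, (R' * P) t ∈ S → t ∈ S := fun ht => sameCycle_apply_right.1 ht
      have hup : ∀ s, s < A → (R' * P) (b s) = b (A + 1 + s) := fun s hs => by
        rw [Perm.mul_apply, hPb s (by omega), hhi _ (by omega) (by omega)]
        congr 1
        omega
      have hdown : ∀ s, A ≤ s → s < 2 * A → (R' * P) (b s) = b (s - A) := fun s hs hs' => by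
        rw [Perm.mul_apply, hPb s (by omega), hlo _ (by omega)]
        congr 1
        omega
      have hblock : ∀ j, j < A → b j ∈ S ∧ b (A + 1 + j) ∈ S := by
        intro j
        induction j with
        | zero =>
          intro _
          have h0 : b 0 ∈ S := SameCycle.refl _ _
          exact ⟨h0, by rw [← hup 0 (by omega)]; exact hmem h0⟩
        | succ j ih =>
          intro hj
          have h1 := hmem (ih (by omega)).2
          rw [hdown _ (by omega) (by omega), show A + 1 + j - A = j + 1 by omega] at h1
          exact ⟨h1, by rw [← hup _ hj]; exact hmem h1⟩
      have hall : ∀ s, s ≤ 2 * A → b s ∈ S := by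
        intro s hs
        rcases lt_trichotomy s A with h1 | rfl | h1
        · exact (hblock s h1).1
        · apply hmem'
          rw [hdown _ le_rfl (by omega), Nat.sub_self]
          exact SameCycle.refl _ _
        · have := (hblock (s - (A + 1)) (by omega)).2
          rwa [show A + 1 + (s - (A + 1)) = s by omega] at this
      have hcl : ∀ t ∈ S, ρ t ∈ S := by
        intro t ht
        by_cases hρt : ρ t ∈ T
        · obtain ⟨s, hs, e⟩ := hT' _ hρt
          rw [← e]
          exact hall s hs
        · rw [← hsame t hρt]
          exact hmem ht
      have huniv : ∀ x, (R' * P).SameCycle (b 0) x := fun x =>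
        mem_of_sameCycle hcl (SameCycle.refl _ _) (h.contour (b 0) x)
      exact fun x y => (huniv x).symm.trans (huniv y)
    · obtain ⟨p, hp1, hp2, hp3⟩ : ∃ p, 1 ≤ p ∧ p ≤ 2 * A ∧ R' (b p) = b p := by
        rcases Nat.even_or_odd' A with ⟨k, hk | hk⟩
        · exact ⟨k, by omega, by omega, by rw [hlo _ (by omega)]; congr 1; omega⟩
        · exact ⟨3 * k + 2, by omega, by omega, by rw [hhi _ (by omega) (by omega)]; congr 1; omega⟩
      exact_mod_cast card_fixed_le_card_fixed (z := b 0) hp3 (by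
        intro x hx hxz
        have hxT : x ∉ T := by
          intro h'
          obtain ⟨s, hs, rfl⟩ := hT' _ h'
          rcases Nat.eq_zero_or_pos s with rfl | h0
          · exact hxz rfl
          · rw [hRb _ h0 hs] at hx
            have := hL.inj _ _ (by omega) (by omega) hx
            omega
        refine ⟨by rw [hR'n _ hxT, hx], ?_⟩
        rintro rfl
        exact hxT (hT _ hp2))
  refine ⟨R', ?_, htree, ?_⟩
  · refine .flip (x := (b 0)) (m := A + 1) h htree hG hGρ hRT hGT (hT 0 (by omega)) ?_ (by omega) hR'T
      hR'n
    intro S hSR hSG hzS t ht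
    obtain ⟨s, hs, rfl⟩ := hT' _ ht
    clear ht
    induction s with
    | zero => exact hzS
    | succ s ih =>
      rw [← hstep s (by omega)]
      exact hSR _ (hSG _ (ih (by omega)))
  · rw [hlo A le_rfl, Nat.sub_self]

end PlaneTree

end Legs

section Grafts

variable {α : Type*} [Fintype α] [DecidableEq α]

theorem PlaneTree.exists_move_graft {P R : Perm α} (h : PlaneTree P R) {w u e z e' z' : α}
    (hw : P w = w) (hu : R w = u) (he : P u = e) (hz : P e = z) (hRz : R z = z) (he' : R e = e')
    (hz' : P z' = e') (hRz' : R z' = z') (hnd : [w, u, e, z, e', z'].Nodup) :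
    ∃ R', Move P R R' ∧ PlaneTree P R' ∧ R' w = z' := by
  simp only [List.nodup_cons, List.mem_cons, List.not_mem_nil, not_or, or_false] at hnd
  obtain ⟨⟨n1, n2, n3, n4, n5⟩, ⟨n6, n7, n8, n9⟩, ⟨n10, n11, n12⟩, ⟨n13, n14⟩, n15, -⟩ := hnd
  have hu' : R u = w := by rw [← hu, h.invol]
  have he'' : R e' = e := by rw [← he', h.invol]
  obtain ⟨G, hG, hGρ, hGz⟩ := h.contour.exists_reflection z' e'
  have g1 : G z' = e' := by simpa using hGz 0
  have g1' : G e' = z' := by rw [← g1, hG]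
  have g2 : G e = u := by
    have := hGz 1
    rw [zpow_one, zpow_neg_one, Perm.mul_apply, hz', he''] at this
    rw [this, Perm.inv_eq_iff_eq, Perm.mul_apply, he, he']
  have g2' : G u = e := by rw [← g2, hG]
  have g3 : G z = w := by
    have := hGρ e
    rw [Perm.mul_apply, Perm.mul_apply, hz, hRz] at this
    have h2 : R (P (G z)) = u := by rw [← g2, ← this, hG]
    apply P.injective
    apply R.injective
    rw [h2, hw, hu]
  have g3' : G w = z := by rw [← g3, hG]
  set T : Finset α := {w, u, e, z, e', z'} with hTdef
  have hT : ∀ t, t ∈ T ↔ t = w ∨ t = u ∨ t = e ∨ t = z ∨ t = e' ∨ t = z' := by simp [hTdef]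
  have hRT : ∀ t ∈ T, R t ∈ T := by
    intro t ht
    rw [hT] at ht ⊢
    rcases ht with rfl | rfl | rfl | rfl | rfl | rfl <;> simp [*]
  have hGT : ∀ t ∈ T, G t ∈ T := by
    intro t ht
    rw [hT] at ht ⊢
    rcases ht with rfl | rfl | rfl | rfl | rfl | rfl <;> simp [*]
  obtain ⟨R', hR', hR'T, hR'n⟩ := exists_twist h.invol hG hRT hGT 4
  have hpow : ∀ t, ((R * G) ^ 4) t = R (G (R (G (R (G (R (G t))))))) := fun t => rfl
  have r1 : R' w = z' := by rw [hR'T _ ((hT _).2 (by simp)), hpow, g3', hRz, g3, hu, g2', he', g1',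
    hRz', hRz']
  have r1' : R' z' = w := by rw [← r1, hR']
  have r2 : R' u = u := by rw [hR'T _ ((hT _).2 (by simp)), hpow, g2', he', g1', hRz', g1, he'',
    g2, hu', hu]
  have r3 : R' e = e := by rw [hR'T _ ((hT _).2 (by simp)), hpow, g2, hu', g3', hRz, g3, hu, g2',
    he', he'']
  have r4 : R' z = e' := by rw [hR'T _ ((hT _).2 (by simp)), hpow, g3, hu, g2', he', g1', hRz', g1,
    he'', he']
  have r4' : R' e' = z := by rw [← r4, hR']
  have hsame : ∀ t, P t ∉ T → (R' * P) t = (R * P) t := fun t ht => by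
    rw [Perm.mul_apply, Perm.mul_apply, hR'n _ ht]
  have htree : PlaneTree P R' := by
    refine ⟨hR', ?_, h.fixed.trans ?_⟩
    · set S : Set α := {x | (R' * P).SameCycle w x} with hS
      have hmem : ∀ {t}, t ∈ S → R' (P t) ∈ S := fun ht => sameCycle_apply_right.2 ht
      have hmem' : ∀ {t}, R' (P t) ∈ S → t ∈ S := fun ht => sameCycle_apply_right.1 ht
      have m1 : w ∈ S := SameCycle.refl _ _
      have m2 : z' ∈ S := by simpa [hw, r1] using hmem m1
      have m3 : z ∈ S := by simpa [hz', r4'] using hmem m2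
      have hcases : ∀ t, t ≠ w → t ≠ u → t ≠ e → t ≠ z' → P t ≠ u → P t ≠ z' →
          (R' * P) t = (R * P) t := by
        intro t t1 t2 t3 t4 t5 t6
        apply hsame
        rw [hT]
        rintro (e1 | e1 | e1 | e1 | e1 | e1)
        · exact t1 (P.injective (e1.trans hw.symm))
        · exact t5 e1
        · exact t2 (P.injective (e1.trans he.symm))
        · exact t3 (P.injective (e1.trans hz.symm))
        · exact t4 (P.injective (e1.trans hz'.symm))
        · exact t6 e1
      have m4 : u ∈ S := by
        by_contra hnu
        have hcl : ∀ t ∈ {t | (t ∈ S ∨ t = e) ∧ t ≠ w}, (R * P) t ∈ {t | (t ∈ S ∨ t = e) ∧ t ≠ w} := by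
          rintro t ⟨ht, htw⟩
          by_cases h1 : t = e
          · subst h1
            rw [Perm.mul_apply, hz, hRz]
            exact ⟨Or.inl m3, Ne.symm n3⟩
          replace ht := ht.resolve_right h1
          by_cases h2 : t = z'
          · subst h2
            rw [Perm.mul_apply, hz', he'']
            exact ⟨Or.inr rfl, Ne.symm n2⟩
          by_cases h3 : P t = z'
          · rw [Perm.mul_apply, h3, hRz']
            exact ⟨Or.inl m2, Ne.symm n5⟩
          have h4 : P t ≠ u := fun h4 => hnu (by simpa [h4, r2] using hmem ht)
          have h5 : t ≠ u := fun h5 => hnu (h5 ▸ ht)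
          rw [← hcases t htw h5 h1 h2 h4 h3]
          refine ⟨Or.inl (hmem ht), fun h6 => h3 ?_⟩
          rw [← r1, ← h6, Perm.mul_apply, hR']
        exact (mem_of_sameCycle hcl ⟨Or.inl m2, Ne.symm n5⟩ (h.contour z' w)).2 rfl
      have m5 : e ∈ S := by simpa [he, r3] using hmem m4
      have m6 : e' ∈ S := by simpa [hz, r4] using hmem m5
      have hcl : ∀ t ∈ S, (R * P) t ∈ S := by
        intro t ht
        by_cases hPt : P t ∈ T
        · have h1 := hRT _ hPt
          rw [hT] at h1
          rw [Perm.mul_apply]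
          rcases h1 with h1 | h1 | h1 | h1 | h1 | h1 <;> rwa [h1]
        · rw [← hsame t hPt]
          exact hmem ht
      have huniv : ∀ x, (R' * P).SameCycle w x := fun x =>
        mem_of_sameCycle hcl (SameCycle.refl _ _) (h.contour w x)
      exact fun x y => (huniv x).symm.trans (huniv y)
    · have : (univ.filter fun x => R x = x).card ≤ (univ.filter fun x => R' x = x).card := by
        refine card_le_card_of_injOn (swap z e * swap z' u) ?_ (Equiv.injective _).injOn
        intro x hx
        have hx := (mem_filter.1 hx).2
        refine mem_filter.2 ⟨mem_univ _, ?_⟩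
        rw [Perm.mul_apply]
        by_cases h1 : x = z'
        · rw [h1, swap_apply_left, swap_apply_of_ne_of_ne n7 n6, r2]
        have h2 : x ≠ u := fun h2 => n1 (by rw [← hu', ← h2, hx])
        rw [swap_apply_of_ne_of_ne h1 h2]
        by_cases h3 : x = z
        · rw [h3, swap_apply_left, r3]
        have h4 : x ≠ e := fun h4 => n11 (by rw [← he', ← h4, hx])
        rw [swap_apply_of_ne_of_ne h3 h4, hR'n, hx]
        rw [hT]
        rintro (h5 | h5 | h5 | h5 | h5 | h5)
        · exact n1 (by rw [← hu, ← h5, hx])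
        · exact h2 h5
        · exact h4 h5
        · exact h3 h5
        · exact n11 (by rw [← he'', ← h5, hx])
        · exact h1 h5
      exact_mod_cast this
  refine ⟨R', ?_, htree, r1⟩
  refine .flip (x := w) (m := 4) h htree hG hGρ hRT hGT ((hT _).2 (by simp)) ?_ (by omega) hR'T hR'n
  intro S hSR hSG hw t ht
  have s1 : u ∈ S := by simpa [hu] using hSR _ hw
  have s2 : e ∈ S := by simpa [g2'] using hSG _ s1
  have s3 : e' ∈ S := by simpa [he'] using hSR _ s2
  have s4 : z' ∈ S := by simpa [g1'] using hSG _ s3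
  have s5 : z ∈ S := by simpa [g3'] using hSG _ hw
  rw [hT] at ht
  rcases ht with h1 | h1 | h1 | h1 | h1 | h1 <;> rwa [h1]

end Grafts

section Leaves

variable {α : Type*} [Fintype α] [DecidableEq α]

namespace PlaneTree

variable {P R : Perm α}

theorem exists_leg (h : PlaneTree P R) {w v : α} (hw : P w = w) (hv : P (P v) ≠ v) :
    ∃ A b, 1 ≤ A ∧ b A = w ∧ Leg P R A b := by
  set ρ := R * P with hρ
  have hc : OneCycle ρ := h.contour
  have hex : ∃ A, P (P ((ρ ^ A) w)) ≠ (ρ ^ A) w := by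
    obtain ⟨A, -, hA⟩ := (hc w v).exists_pow_eq'
    exact ⟨A, by rwa [hA]⟩
  obtain ⟨A, hA, hmin⟩ : ∃ A, P (P ((ρ ^ A) w)) ≠ (ρ ^ A) w ∧
      ∀ j < A, P (P ((ρ ^ j) w)) = (ρ ^ j) w := by
    classical
    exact ⟨Nat.find hex, Nat.find_spec hex, fun j hj => not_not.1 (Nat.find_min hex hj)⟩
  have hA0 : 1 ≤ A := by
    rcases Nat.eq_zero_or_pos A with rfl | h0
    · simp [hw] at hA
    · exact h0
  set b : ℤ → α := fun s => (ρ ^ (s - A)) w with hb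
  have hρb : ∀ s, R (P (b s)) = b (s + 1) := fun s => by
    change ρ ((ρ ^ (s - A)) w) = (ρ ^ (s + 1 - A)) w
    rw [← Perm.mul_apply, ← zpow_one_add]
    congr 2
    ring
  have hPb : ∀ s, P (b s) = R (b (s + 1)) := fun s => by rw [← hρb, h.invol]
  have hbn : ∀ j : ℕ, b (A + j) = (ρ ^ j) w := fun j => by simp [hb]
  have hvert : ∀ j : ℕ, j ≤ A → P (b (A - j)) = b (A + j) := by
    intro j
    induction j with
    | zero => simp [hb, hw]
    | succ j ih =>
      intro hj
      have h1 := ih (by omega)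
      have h2 : P (b (A + j)) = b (A - j) := by
        apply P.injective
        rw [h1, hbn]
        exact hmin j (by omega)
      push_cast
      rw [hPb, show (A : ℤ) - (j + 1) + 1 = A - j by ring, ← h2, hρb, add_assoc]
  have hvert' : ∀ j : ℕ, j < A → P (b (A + j)) = b (A - j) := by
    intro j hj
    apply P.injective
    rw [hvert j hj.le, hbn]
    exact hmin j hj
  have hord : 2 * A < orderOf ρ := by
    by_contra hle
    have hpos := orderOf_pos ρ
    have hper : ∀ s : ℤ, b (s - orderOf ρ) = b s := fun s => by
      simp only [hb]
      rw [show s - orderOf ρ - A = (s - A) + -orderOf ρ by ring, zpow_add, zpow_neg, zpow_natCast,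
        pow_orderOf_eq_one, inv_one, mul_one]
    have hlast : b (A + A) = (ρ ^ A) w := hbn A
    rw [← hlast, ← hper] at hA
    rcases lt_trichotomy (orderOf ρ) A with h1 | h1 | h1
    · obtain ⟨j, hj⟩ : ∃ j : ℕ, (A : ℤ) - orderOf ρ = j := ⟨A - orderOf ρ, by omega⟩
      rw [add_sub_assoc, hj, hbn] at hA
      exact hA (hmin j (by omega))
    · rw [h1, add_sub_cancel_right] at hA
      have h2 := hvert 0 (by omega)
      rw [Nat.cast_zero, sub_zero, add_zero] at h2
      exact hA (by rw [h2, h2])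
    · obtain ⟨j, hj⟩ : ∃ j : ℕ, (orderOf ρ : ℤ) - A = j := ⟨orderOf ρ - A, by omega⟩
      rw [show (A : ℤ) + A - orderOf ρ = A - j by omega] at hA
      rcases (show j ≤ A by omega).lt_or_eq with h2 | rfl
      · rw [hvert j h2.le, hvert' j h2] at hA
        exact hA rfl
      · have h3 := hper (j + j)
        rw [show (j : ℤ) + j - orderOf ρ = j - j by omega] at h3
        have h4 := hvert j le_rfl
        rw [h3] at h4
        rw [h3, h4, h4] at hA
        exact hA rfl
  refine ⟨A, fun s => b s, hA0, by simp [hb], ?_, ?_, ?_, ?_⟩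
  · intro s t hs ht e
    refine hc.pow_inj (x := b 0) (by omega) (by omega) ?_
    simp only [hb] at e ⊢
    rw [← Perm.mul_apply, ← Perm.mul_apply, ← zpow_natCast, ← zpow_natCast, ← zpow_add, ← zpow_add]
    convert e using 3 <;> ring
  · intro s hs
    rcases le_or_gt s A with h1 | h1
    · have := hvert (A - s) (by omega)
      convert this using 3 <;> omega
    · have := hvert' (s - A) (by omega)
      convert this using 3 <;> omega
  · intro s h1 hs
    have h2 : R (b s) = P (b (s - 1)) := by rw [hPb, sub_add_cancel]
    rw [h2]
    rcases le_or_gt (s - 1) A with h3 | h3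
    · have := hvert (A + 1 - s) (by omega)
      convert this using 3 <;> omega
    · have := hvert' (s - 1 - A) (by omega)
      convert this using 3 <;> omega
  · intro e
    have h1 := hvert A le_rfl
    rw [sub_self] at h1
    rw [← hbn, ← h1] at hA
    rw [Nat.cast_zero, show ((2 * A : ℕ) : ℤ) = A + A by push_cast; ring] at e
    exact hA (by rw [h1, e, h1])

theorem exists_free (h : PlaneTree P R) (c y : α) {S : Finset α}
    (hS : R c ≠ c → S ⊆ side P R c) (hleaf : ∀ x, P x = x → x ∈ S)
    (h0 : 0 ≤ ∑ x ∈ S, wt P x) :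
    ∃ R', Moves P 1 R R' ∧ PlaneTree P R' ∧ R' c = c ∧
      (∀ t, t ≠ c → t ≠ R c → R t ≠ t → R' t = R t) ∧
      (0 < ∑ x ∈ S, wt P x → y ∈ S → R y = y → R' y = y) := by
  by_cases hc : R c = c
  · exact ⟨R, .refl _ _, h, hc, fun _ _ _ _ => rfl, fun _ _ h => h⟩
  have hle : ∑ x ∈ S, wt P x ≤ ∑ x ∈ side P R c, wt P x :=
    sum_wt_mono (hS hc) fun x _ hx => hleaf x hx
  obtain ⟨x, hx, hRx, hxy⟩ : ∃ x ∈ side P R c, R x = x ∧ (0 < ∑ x ∈ S, wt P x → x ≠ y) := by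
    by_cases hpos : 0 < ∑ x ∈ S, wt P x
    · obtain ⟨x, h1, h2, h3⟩ := h.exists_fixed_mem_side_ne hc (hpos.trans_le hle) y
      exact ⟨x, h1, h2, fun _ => h3⟩
    · obtain ⟨x, h1, h2⟩ := h.exists_fixed_mem_side hc (h0.trans hle)
      exact ⟨x, h1, h2, fun h3 => absurd h3 hpos⟩
  have hc' := h.apply_apply_ne hc
  obtain ⟨z, hz, hRz⟩ := h.exists_fixed_mem_side hc' (sum_nonneg fun t ht => wt_nonneg fun e => by
    rw [h.side_apply hc, mem_compl] at ht
    exact ht (hS hc (hleaf t e)))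
  have happ := h.reconnect_apply hRx hRz hc
  refine ⟨_, (h.move_reconnect hc hx hz hRx hRz).moves, h.reconnect hc hx hz hRx hRz, ?_, ?_, ?_⟩
  · rw [happ, if_pos (Or.inl rfl)]
  · intro t h1 h2 h3
    rw [happ, if_neg (by tauto), if_neg, if_neg]
    · rintro rfl; exact h3 hRz
    · rintro rfl; exact h3 hRx
  · intro hpos hyS hy
    rw [happ, if_neg, if_neg (hxy hpos).symm, if_neg, hy]
    · rintro rfl
      rw [h.side_apply hc, mem_compl] at hz
      exact hz (hS hc hyS)
    · rintro (rfl | e)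
      · exact hc hy
      · rw [e, h.invol] at hy
        exact hc hy.symm

/-- The unique fixed point of `P` can be joined to a cycle of length at least three. -/
theorem exists_leaf_three_le (h : PlaneTree P R) {w v : α} (hw : P w = w)
    (hleaf : ∀ x, P x = x → x = w) (hv : 3 ≤ sz P v) :
    ∃ R', Moves P 2 R R' ∧ PlaneTree P R' ∧ 3 ≤ sz P (R' w) := by
  obtain ⟨A, b, hA, hbA, hL⟩ := h.exists_leg hw (three_le_sz.1 hv)
  have hPz : P (b 0) = b (2 * A) := hL.vert 0 (by omega)
  have hf : 3 ≤ sz P (b (2 * A)) := three_le_sz.2 fun e => hL.last (P.injective (e.trans hPz.symm))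
  have hdisj : Disjoint (orb P w) (orb P (b (2 * A))) := by
    refine disjoint_orb (orb_closed _ _) fun h' => ?_
    have := sz_eq h'
    have := sz_eq_one_iff.2 hw
    omega
  have hsum : ∑ x ∈ orb P w ∪ orb P (b (2 * A)), wt P x = (sz P (b (2 * A)) : ℚ) - 3 := by
    rw [sum_union hdisj, sum_wt_orb, sum_wt_orb, sz_eq_one_iff.2 hw]
    push_cast
    ring
  have h3 : (3 : ℚ) ≤ sz P (b (2 * A)) := by exact_mod_cast hf
  obtain ⟨R₁, m₁, t₁, hz, hsame, -⟩ := h.exists_free (b 0) w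
    (S := orb P w ∪ orb P (b (2 * A))) (by
      intro hz
      have hall : ∀ s, s ≤ 2 * A → b s ∈ side P R (b 0) := by
        intro s
        induction s with
        | zero => exact fun _ => self_mem_side _ _ _
        | succ s ih =>
          intro hs
          have h1 := h.side_closed hz _ (ih (by omega))
          rw [hL.vert s (by omega)] at h1
          have h2 := h.apply_mem_side hz h1 fun e => by
            have := hL.inj _ _ (by omega) (by omega) e
            omega
          rw [hL.edge _ (by omega) (by omega)] at h2
          rwa [show 2 * A + 1 - (2 * A - s) = s + 1 by omega] at h2
      refine union_subset (orb_subset (h.side_closed hz) ?_) (orb_subset (h.side_closed hz) ?_)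
      · rw [← hbA]
        exact hall A (by omega)
      · exact hall _ le_rfl)
    (fun x hx => mem_union_left _ (by rw [hleaf x hx]; exact self_mem_orb _ _))
    (by rw [hsum]; linarith)
  have hL₁ : Leg P R₁ A b := by
    refine ⟨hL.inj, hL.vert, fun s h1 hs => ?_, hL.last⟩
    rw [← hL.edge s h1 hs]
    apply hsame
    · intro e
      have := hL.inj _ _ (by omega) (by omega) e
      omega
    · intro e
      have h4 : R (b s) = b 0 := by rw [e, h.invol]
      rw [hL.edge s h1 hs] at h4
      have := hL.inj _ _ (by omega) (by omega) h4
      omega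
    · intro e
      rw [hL.edge s h1 hs] at e
      have := hL.inj _ _ (by omega) (by omega) e
      omega
  obtain ⟨R₂, m₂, t₂, e⟩ := t₁.exists_move_leg hA hL₁ hz
  refine ⟨R₂, m₁.trans m₂.moves, t₂, ?_⟩
  rwa [← hbA, e, ← sz_apply, hPz]

/-- The unique fixed point of `P` can be joined to a cycle of maximal length. -/
theorem exists_leaf_max (h : PlaneTree P R) {w v : α} (hw : P w = w)
    (hleaf : ∀ x, P x = x → x = w) (hv : 3 ≤ sz P v) (hmax : ∀ x, sz P x ≤ sz P v) :
    ∃ R', Moves P 8 R R' ∧ PlaneTree P R' ∧ sz P (R' w) = sz P v := by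
  obtain ⟨R₁, m₁, t₁, h3⟩ := h.exists_leaf_three_le hw hleaf hv
  rcases (hmax (R₁ w)).eq_or_lt with heq | hlt
  · exact ⟨R₁, m₁.mono (by omega), t₁, heq⟩
  have hw1 := sz_eq_one_iff.2 hw
  set u := R₁ w with hu
  have huw : u ∉ orb P w := fun h' => by
    have := sz_eq h'
    omega
  have hPu : P u ≠ u := fun e => by
    have := sz_eq_one_iff.2 e
    omega
  have hs : Spine P R₁ [u, w] := .cons (.single w) (by rw [hw]) hPu (by simpa [orbs] using huw)
  have hdisj : Disjoint (orb P u) (orb P w) := (disjoint_orb (orb_closed _ _) huw).symm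
  have hsum : ∑ x ∈ orbs P [u, w], wt P x = (sz P u : ℚ) - 3 := by
    simp only [orbs, union_empty]
    rw [sum_union hdisj, sum_wt_orb, sum_wt_orb, hw1]
    push_cast
    ring
  have h3' : (3 : ℚ) ≤ sz P u := by exact_mod_cast h3
  have hleafu : ∀ x, P x = x → x ∈ orbs P [u, w] := fun x hx => by
    rw [hleaf x hx, mem_orbs]
    exact ⟨w, by simp, self_mem_orb _ _⟩
  have hvn : v ∉ orbs P [u, w] := fun h' => by
    obtain ⟨a, ha, hva⟩ := mem_orbs.1 h'
    have := sz_eq hva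
    simp only [List.mem_cons, List.not_mem_nil, or_false] at ha
    rcases ha with rfl | rfl <;> omega
  obtain ⟨R₂, b, m₂, t₂, hbv, s₂⟩ := hs.extend t₁ hleafu (by rw [hsum]; linarith) hvn hv
  have hszb : sz P b = sz P v := sz_eq hbv
  obtain ⟨hRe, hRw, hbn⟩ : R₂ (P u) = b ∧ R₂ w = u ∧ b ∉ orbs P [u, w] := by
    cases s₂ with
    | cons s h1 h2 h3 =>
      cases s with
      | cons s h4 h5 h6 => exact ⟨h1, by rwa [hw] at h4, h3⟩
  have hbu : b ∉ orb P u := fun h' => hbn (mem_union_left _ h')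
  have hbw : b ∉ orb P w := fun h' => hbn (mem_union_right _ (mem_union_left _ h'))
  set e := P u with he
  set z := P e with hz
  set z' := P.symm b with hz'
  have hPz' : P z' = b := Equiv.apply_symm_apply _ _
  have hRb : R₂ b = e := by rw [← hRe, t₂.invol]
  have hRu : R₂ u = w := by rw [← hRw, t₂.invol]
  have mu : u ∈ orb P u := self_mem_orb _ _
  have me : e ∈ orb P u := apply_mem_orb _ _
  have mz : z ∈ orb P u := orb_closed _ _ _ me
  have mb : b ∈ orb P b := self_mem_orb _ _
  have mz' : z' ∈ orb P b := by
    rw [← mem_iff_of_mem_orb (orb_closed P b) (apply_mem_orb P z')]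
    rwa [hPz']
  have mw : w ∈ orb P w := self_mem_orb _ _
  have ne : ∀ {p q s t : α}, sz P p ≠ sz P q → s ∈ orb P p → t ∈ orb P q → s ≠ t := by
    rintro p q s t h1 h2 h3 rfl
    exact h1 ((sz_eq h2).symm.trans (sz_eq h3))
  have hzu : z ≠ u := three_le_sz.1 h3
  have hzb : z' ≠ b := fun h' => by
    have : P b = b := by rw [← h', hPz', h']
    have := sz_eq_one_iff.2 this
    omega
  have hez : e ≠ z := fun h' => hPu (P.injective h'.symm)
  have nwu : sz P w ≠ sz P u := by omega
  have nwb : sz P w ≠ sz P b := by omega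
  have nub : sz P u ≠ sz P b := by omega
  set S := orbs P [b, u, w] with hSdef
  have hSsub : ∀ {T : Finset α}, (∀ t ∈ T, P t ∈ T) → b ∈ T → u ∈ T → w ∈ T → S ⊆ T := by
    intro T hT h1 h2 h3
    simp only [hSdef, orbs, union_empty]
    exact union_subset (orb_subset hT h1) (union_subset (orb_subset hT h2) (orb_subset hT h3))
  have hleafS : ∀ x, P x = x → x ∈ S := fun x hx => mem_union_right _ (hleafu x hx)
  have hsumS : ∑ x ∈ S, wt P x = (sz P b : ℚ) - 2 + (sz P u - 3) := by
    rw [hSdef, orbs_cons, sum_union (disjoint_orb (orbs_closed _ _) hbn).symm, sum_wt_orb, hsum]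
  have hb3 : (3 : ℚ) ≤ sz P b := by rw [hszb]; exact_mod_cast hv
  obtain ⟨R₃, m₃, t₃, hz₃, hsame₃, -⟩ := t₂.exists_free z z (S := S) (fun hc => by
    have c1 := self_mem_side P R₂ z
    have c2 : orb P u ⊆ side P R₂ z := by
      rw [← orb_eq mz]
      exact orb_subset (t₂.side_closed hc) c1
    refine hSsub (t₂.side_closed hc) ?_ (c2 mu) ?_
    · rw [← hRe]
      exact t₂.apply_mem_side hc (c2 me) hez
    · rw [← hRu]
      exact t₂.apply_mem_side hc (c2 mu) hzu.symm) hleafS (by rw [hsumS]; linarith)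
  have hRe₃ : R₃ e = b := by
    rw [hsame₃ e hez, hRe]
    · intro h'
      rw [h', t₂.invol] at hRe
      exact ne nub mz mb hRe
    · rw [hRe]
      exact (ne nub me mb).symm
  have hRw₃ : R₃ w = u := by
    rw [hsame₃ w (ne nwu mw mz), hRw]
    · intro h'
      rw [h', t₂.invol] at hRw
      exact hzu hRw
    · rw [hRw]
      exact (ne nwu mw mu).symm
  have hRb₃ : R₃ b = e := by rw [← hRe₃, t₃.invol]
  have hRu₃ : R₃ u = w := by rw [← hRw₃, t₃.invol]
  obtain ⟨R₄, m₄, t₄, hz₄, hsame₄, hfix₄⟩ := t₃.exists_free z' z (S := S) (fun hc => by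
    have c1 := self_mem_side P R₃ z'
    have c2 : orb P b ⊆ side P R₃ z' := by
      rw [← orb_eq mz']
      exact orb_subset (t₃.side_closed hc) c1
    have c3 : orb P u ⊆ side P R₃ z' := by
      rw [← orb_eq me]
      refine orb_subset (t₃.side_closed hc) ?_
      rw [← hRb₃]
      exact t₃.apply_mem_side hc (c2 mb) hzb.symm
    refine hSsub (t₃.side_closed hc) (c2 mb) (c3 mu) ?_
    rw [← hRu₃]
    exact t₃.apply_mem_side hc (c3 mu) (ne nub mu mz')) hleafS (by rw [hsumS]; linarith)
  have hRz₄ : R₄ z = z :=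
    hfix₄ (by rw [hsumS]; linarith) (mem_union_right _ (mem_union_left _ mz)) hz₃
  have hRe₄ : R₄ e = b := by
    rw [hsame₄ e (ne nub me mz'), hRe₃]
    · intro h'
      rw [h', t₃.invol] at hRe₃
      exact hzb hRe₃
    · rw [hRe₃]
      exact (ne nub me mb).symm
  have hRw₄ : R₄ w = u := by
    rw [hsame₄ w (ne nwb mw mz'), hRw₃]
    · intro h'
      rw [h', t₃.invol] at hRw₃
      exact ne nub mu mz' hRw₃.symm
    · rw [hRw₃]
      exact (ne nwu mw mu).symm
  obtain ⟨R₅, m₅, t₅, e₅⟩ := t₄.exists_move_graft hw hRw₄ he.symm hz.symm hRz₄ hRe₄ hPz' hz₄ (by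
    simp only [List.nodup_cons, List.mem_cons, List.not_mem_nil, not_or, or_false]
    exact ⟨⟨ne nwu mw mu, ne nwu mw me, ne nwu mw mz, ne nwb mw mb, ne nwb mw mz'⟩,
      ⟨hPu.symm, hzu.symm, ne nub mu mb, ne nub mu mz'⟩, ⟨hez, ne nub me mb, ne nub me mz'⟩,
      ⟨ne nub mz mb, ne nub mz mz'⟩, hzb.symm, not_false, List.nodup_nil⟩)
  refine ⟨R₅, (((m₁.trans m₂).trans (m₃.trans m₄)).trans m₅.moves).mono (by omega), t₅, ?_⟩
  rw [e₅, ← hszb]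
  exact sz_eq mz'

end PlaneTree

end Leaves

section NormalForm

variable {α : Type*} [Fintype α] [DecidableEq α]

theorem sz_le_card (P : Perm α) (x : α) : sz P x ≤ Fintype.card α := card_le_univ _

theorem rank_le_card_add_one (P : Perm α) (x : α) : rank P x ≤ Fintype.card α + 1 := by
  rw [rank]
  split_ifs
  · exact le_rfl
  · exact (sz_le_card P x).trans (Nat.le_succ _)

/-- Every plane tree with at most one vertex of degree one is boundedly close to a normal form. -/
theorem PlaneTree.exists_greedy [Nonempty α] {P R : Perm α} (h : PlaneTree P R)
    (hleaf : ∀ x y, P x = x → P y = y → x = y) :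
    ∃ R' l N, Moves P N R R' ∧ (N : ℚ) ≤ 6 * ∑ x, wt P x + 14 ∧ PlaneTree P R' ∧
      Greedy P R' l ∧ orbs P l = univ := by
  obtain ⟨v, -, hv⟩ := exists_max_image univ (sz P) univ_nonempty
  replace hv : ∀ x, sz P x ≤ sz P v := fun x => hv x (mem_univ x)
  by_cases hex : ∃ w, P w = w
  · obtain ⟨w, hw⟩ := hex
    have hleaf' : ∀ x, P x = x → x = w := fun x hx => hleaf x w hx hw
    have hw1 := sz_eq_one_iff.2 hw
    have hrw : rank P w = Fintype.card α + 1 := if_pos hw1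
    rcases le_or_gt 3 (sz P v) with h3 | h3
    · obtain ⟨R₁, m₁, t₁, e₁⟩ := h.exists_leaf_max hw hleaf' h3 hv
      set u := R₁ w with hu
      have huw : u ∉ orb P w := fun h' => by
        have := sz_eq h'
        omega
      have hPu : P u ≠ u := fun e => by
        have := sz_eq_one_iff.2 e
        omega
      have hs : Spine P R₁ [u, w] :=
        .cons (.single w) (by rw [hw]) hPu (by simpa [orbs] using huw)
      have hru : rank P u = sz P u := if_neg (by omega)
      have hdisj : Disjoint (orb P u) (orb P w) := (disjoint_orb (orb_closed _ _) huw).symm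
      have hsum : ∑ x ∈ orbs P [u, w], wt P x = (sz P u : ℚ) - 3 := by
        simp only [orbs, union_empty]
        rw [sum_union hdisj, sum_wt_orb, sum_wt_orb, hw1]
        push_cast
        ring
      have hcard : (orbs P [u, w]).card = sz P u + 1 := by
        simp only [orbs, union_empty]
        rw [card_union_of_disjoint hdisj, ← sz, ← sz, hw1]
      have h3' : (3 : ℚ) ≤ sz P u := by rw [e₁]; exact_mod_cast h3
      have hmem : w ∈ orbs P [u, w] := mem_orbs.2 ⟨w, by simp, self_mem_orb _ _⟩
      have hg : Greedy P R₁ [u, w] := by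
        refine ⟨hs, fun x hx => by rwa [hleaf' x hx], ?_, ?_⟩
        · simp only [List.pairwise_cons, List.mem_cons, List.not_mem_nil, or_false, forall_eq,
            false_imp_iff, implies_true, List.Pairwise.nil, and_true]
          rw [hrw]
          exact rank_le_card_add_one _ _
        · intro x hx a ha
          have hx1 : rank P x = sz P x :=
            if_neg fun e => hx (by rwa [hleaf' x (sz_eq_one_iff.1 e)])
          simp only [List.mem_cons, List.not_mem_nil, or_false] at ha
          rcases ha with rfl | rfl
          · rw [hx1, hru, e₁]
            exact hv x
          · rw [hrw]
            exact rank_le_card_add_one _ _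
      obtain ⟨R₂, l, N, m₂, hN, rest⟩ := hg.exists_normal t₁ (by rw [hsum]; linarith)
        (by rw [hcard, hsum]; push_cast; linarith)
      refine ⟨R₂, l, 8 + N, m₁.trans m₂, ?_, rest⟩
      push_cast
      linarith
    · have horbs : orbs P [w] = orb P w := by simp [orbs]
      have hg : Greedy P R [w] := by
        refine ⟨.single w, fun x hx => ?_, by simp, ?_⟩
        · rw [horbs, hleaf' x hx]
          exact self_mem_orb _ _
        · intro x _ a ha
          rw [List.mem_singleton.1 ha, hrw]
          exact rank_le_card_add_one _ _
      obtain ⟨R', l, m, rest⟩ := hg.exhaust_small h fun x _ => by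
        have := hv x
        omega
      refine ⟨R', l, _, m, ?_, rest⟩
      have h1 : (Greedy.branches P R w []).card ≤ (orbs P [w]).card := card_filter_le _ _
      rw [horbs, ← sz, hw1] at h1
      have h2 : ((Greedy.branches P R w []).card : ℚ) ≤ 1 := by exact_mod_cast h1
      have h4 := sum_wt_mono (subset_univ _) fun x _ => hg.leaf x
      rw [horbs, sum_wt_orb, hw1] at h4
      push_cast at h4
      linarith
  · push Not at hex
    have hne : ∀ x, sz P x ≠ 1 := fun x e => hex x (sz_eq_one_iff.1 e)
    have hr : ∀ x, rank P x = sz P x := fun x => if_neg (hne x)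
    have horbs : orbs P [v] = orb P v := by simp [orbs]
    have hg : Greedy P R [v] := by
      refine ⟨.single v, fun x hx => absurd hx (hex x), by simp, ?_⟩
      intro x _ a ha
      rw [List.mem_singleton.1 ha, hr, hr]
      exact hv x
    have h2 : (2 : ℚ) ≤ sz P v := by
      have := hne v
      have := sz_pos P v
      exact_mod_cast (show 2 ≤ sz P v by omega)
    obtain ⟨R', l, N, m, hN, rest⟩ := hg.exists_normal h (by rw [horbs, sum_wt_orb]; linarith)
      (by rw [horbs, sum_wt_orb, ← sz]; linarith)
    exact ⟨R', l, N, m, by linarith, rest⟩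

theorem Spine.link {P R : Perm α} {l : List α} (h : Spine P R l) (i : ℕ) (hi : i + 1 < l.length) :
    R (P l[i + 1]) = l[i] := by
  induction h generalizing i with
  | single a => simp at hi
  | cons h h1 h2 h3 ih =>
    cases i with
    | zero => exact h1
    | succ i =>
      simp only [List.getElem_cons_succ]
      exact ih i (by simpa using hi)

theorem Spine.pairwise_notMem {P R : Perm α} {l : List α} (h : Spine P R l) :
    l.Pairwise fun b a => b ∉ orb P a := by
  induction h with
  | single a => simp
  | cons h h1 h2 h3 ih =>
    refine List.pairwise_cons.2 ⟨fun a ha hb => h3 (mem_orbs.2 ⟨a, ha, hb⟩), ih⟩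

theorem Spine.eq_of_mem_orb {P R : Perm α} {l : List α} (h : Spine P R l) {i j : ℕ}
    (hi : i < l.length) (hj : j < l.length) (hij : l[i] ∈ orb P l[j]) : i = j := by
  have hp := List.pairwise_iff_getElem.1 h.pairwise_notMem
  rcases lt_trichotomy i j with h1 | h1 | h1
  · exact absurd hij (hp i j hi hj h1)
  · exact h1
  · refine absurd ?_ (hp j i hj hi h1)
    rw [orb_eq hij]
    exact self_mem_orb _ _

theorem Spine.card_filter_rank {P R : Perm α} {l : List α} (h : Spine P R l) (r : ℕ) :
    ((orbs P l).filter fun x => rank P x = r).card =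
      (l.map (rank P)).count r * if r = Fintype.card α + 1 then 1 else r := by
  have horb : ∀ a, ((orb P a).filter fun x => rank P x = r).card =
      if rank P a = r then (if r = Fintype.card α + 1 then 1 else r) else 0 := by
    intro a
    split_ifs with h1 h2
    · rw [filter_true_of_mem fun x hx => (Greedy.rank_congr hx).trans h1, ← sz]
      by_contra h3
      rw [rank, if_neg h3] at h1
      have := sz_le_card P a
      omega
    · rw [filter_true_of_mem fun x hx => (Greedy.rank_congr hx).trans h1, ← sz]
      rw [rank] at h1
      split_ifs at h1 with h3
      · exact absurd h1.symm h2
      · exact h1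
    · rw [filter_false_of_mem fun x hx => by rwa [Greedy.rank_congr hx], card_empty]
  induction h with
  | single a =>
    simp only [orbs, union_empty, horb, List.map_cons, List.map_nil, List.count_singleton, beq_iff_eq]
    split_ifs <;> simp
  | @cons b a l h h1 h2 h3 ih =>
    rw [orbs_cons, filter_union, card_union_of_disjoint, horb, ih, List.map_cons (l := a :: l),
      List.count_cons]
    · simp only [beq_iff_eq]
      split_ifs <;> ring
    · exact disjoint_filter_filter (disjoint_orb (orbs_closed _ _) h3).symm

end NormalForm

section Uniqueness

variable {α : Type*} [Fintype α] [DecidableEq α]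

theorem sz_eq_minimalPeriod (P : Perm α) (x : α) : sz P x = Function.minimalPeriod P x := by
  have hpos : 0 < Function.minimalPeriod P x := by
    rw [Function.minimalPeriod_pos_iff_mem_periodicPts]
    exact P.injective.mem_periodicPts x
  have h : orb P x = (range (Function.minimalPeriod P x)).image fun k => P^[k] x := by
    ext y
    rw [mem_orb, mem_image]
    constructor
    · intro h
      obtain ⟨k, -, hk⟩ := h.exists_pow_eq'
      refine ⟨k % Function.minimalPeriod P x, mem_range.2 (Nat.mod_lt _ hpos), ?_⟩
      rw [Function.iterate_mod_minimalPeriod_eq, Equiv.Perm.iterate_eq_pow, hk]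
    · rintro ⟨k, -, rfl⟩
      rw [Equiv.Perm.iterate_eq_pow]
      exact ⟨k, by simp⟩
  rw [sz, h, card_image_of_injOn, card_range]
  intro i hi j hj hij
  exact Function.iterate_injOn_Iio_minimalPeriod (by simpa using hi) (by simpa using hj) hij

theorem pow_apply_eq_pow_apply_iff (P : Perm α) (x : α) (i j : ℕ) :
    (P ^ i) x = (P ^ j) x ↔ i ≡ j [MOD sz P x] := by
  rw [sz_eq_minimalPeriod]
  have hpos : 0 < Function.minimalPeriod P x := by
    rw [← sz_eq_minimalPeriod]
    exact sz_pos P x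
  rw [← Equiv.Perm.iterate_eq_pow, ← Equiv.Perm.iterate_eq_pow]
  rw [← Function.iterate_mod_minimalPeriod_eq, ← Function.iterate_mod_minimalPeriod_eq (n := j)]
  constructor
  · exact fun h => Function.iterate_injOn_Iio_minimalPeriod (Nat.mod_lt _ hpos)
      (Nat.mod_lt _ hpos) h
  · intro h
    rw [show i % _ = j % _ from h]

theorem exists_pow_getElem {P : Perm α} {l : List α} (h : orbs P l = univ) (x : α) :
    ∃ (i : ℕ) (hi : i < l.length) (k : ℕ), (P ^ k) l[i] = x := by
  obtain ⟨a, ha, hx⟩ := mem_orbs.1 (h ▸ mem_univ x)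
  obtain ⟨i, hi, rfl⟩ := List.getElem_of_mem ha
  obtain ⟨k, -, hk⟩ := (mem_orb.1 hx).exists_pow_eq'
  exact ⟨i, hi, k, hk⟩

theorem sz_conj {P P' σ : Perm α} (h : ∀ x, σ (P x) = P' (σ x)) (x : α) :
    sz P' (σ x) = sz P x := by
  have h' : P' = σ * P * σ⁻¹ := by
    ext y
    simp [h]
  rw [sz, sz, ← card_image_of_injective (orb P x) σ.injective]
  congr 1
  ext y
  rw [mem_image, mem_orb, h']
  constructor
  · intro hy
    refine ⟨σ⁻¹ y, ?_, by simp⟩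
    rw [mem_orb]
    simpa using sameCycle_conj.1 hy
  · rintro ⟨z, hz, rfl⟩
    rw [sameCycle_conj]
    simpa using mem_orb.1 hz

theorem rank_conj {P P' σ : Perm α} (h : ∀ x, σ (P x) = P' (σ x)) (x : α) :
    rank P' (σ x) = rank P x := by
  rw [rank, rank, sz_conj h]

theorem sz_eq_sz_of_rank_eq {P P' : Perm α} {x y : α} (h : rank P x = rank P' y) :
    sz P x = sz P' y := by
  have h1 := sz_le_card P x
  have h2 := sz_le_card P' y
  rw [rank, rank] at h
  split_ifs at h <;> omega

theorem zero_lt_rank (P : Perm α) (x : α) : 0 < rank P x := by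
  have := sz_pos P x
  rw [rank]
  split_ifs <;> omega

theorem Greedy.map_rank_eq {P P' R R' σ : Perm α} {l l' : List α} (hσ : ∀ x, σ (P x) = P' (σ x))
    (hg : Greedy P R l) (hg' : Greedy P' R' l') (hu : orbs P l = univ) (hu' : orbs P' l' = univ) :
    l.map (rank P) = l'.map (rank P') := by
  apply List.Perm.eq_of_pairwise' (r := (· ≤ ·))
  · exact List.pairwise_map.2 hg.sorted
  · exact List.pairwise_map.2 hg'.sorted
  rw [List.perm_iff_count]
  intro r
  rcases Nat.eq_zero_or_pos r with rfl | hr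
  · rw [List.count_eq_zero_of_not_mem, List.count_eq_zero_of_not_mem] <;>
    · rw [List.mem_map]
      rintro ⟨a, -, ha⟩
      exact (zero_lt_rank _ a).ne' ha
  have h1 := hg.spine.card_filter_rank r
  have h2 := hg'.spine.card_filter_rank r
  have h3 : (univ.filter fun x => rank P x = r).card = (univ.filter fun x => rank P' x = r).card := by
    rw [← card_image_of_injective _ σ.injective]
    congr 1
    ext y
    simp only [mem_image, mem_filter, mem_univ, true_and]
    constructor
    · rintro ⟨x, hx, rfl⟩
      rwa [rank_conj hσ]
    · intro hy
      refine ⟨σ⁻¹ y, ?_, by simp⟩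
      rw [← rank_conj hσ]
      simpa using hy
  rw [hu] at h1
  rw [hu', ← h3, h1] at h2
  refine Nat.eq_of_mul_eq_mul_right ?_ h2
  split_ifs <;> omega

/-- A normal form is determined up to conjugacy by the vertex permutation. -/
theorem Greedy.exists_conj {P P' R R' σ₀ : Perm α} {l l' : List α}
    (hσ₀ : ∀ x, σ₀ (P x) = P' (σ₀ x)) (h : PlaneTree P R) (h' : PlaneTree P' R')
    (hg : Greedy P R l) (hg' : Greedy P' R' l') (hu : orbs P l = univ) (hu' : orbs P' l' = univ) :
    ∃ σ : Perm α, (∀ x, σ (P x) = P' (σ x)) ∧ ∀ x, σ (R x) = R' (σ x) := by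
  have hmap := hg.map_rank_eq hσ₀ hg' hu hu'
  have hlen : l.length = l'.length := by simpa using congrArg List.length hmap
  have hsz : ∀ i (hi : i < l.length) (hi' : i < l'.length), sz P l[i] = sz P' l'[i] := by
    intro i hi hi'
    apply sz_eq_sz_of_rank_eq
    have : (l.map (rank P))[i]'(by simpa) = (l'.map (rank P'))[i]'(by simpa) := by simp [hmap]
    simpa using this
  choose ι hι κ hκ using fun x => exists_pow_getElem hu x
  let F : α → α := fun x => (P' ^ κ x) (l'[ι x]'(hlen ▸ hι x))
  have key : ∀ i (hi : i < l.length) (hi' : i < l'.length) k, F ((P ^ k) l[i]) = (P' ^ k) l'[i] := by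
    intro i hi hi' k
    have e := hκ ((P ^ k) l[i])
    have hi0 : ι ((P ^ k) l[i]) = i := by
      apply hg.spine.eq_of_mem_orb (hι _) hi
      rw [mem_orb]
      have h1 : P.SameCycle l[i] ((P ^ k) l[i]) := ⟨k, by simp⟩
      have h2 : P.SameCycle (l[ι ((P ^ k) l[i])]'(hι _)) ((P ^ k) l[i]) :=
        ⟨κ ((P ^ k) l[i]), by simpa using e⟩
      exact h1.trans h2.symm
    have : ∀ j (hj : j < l.length) (hj' : j < l'.length) m, j = i → (P ^ m) l[j] = (P ^ k) l[i] →
        (P' ^ m) l'[j] = (P' ^ k) l'[i] := by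
      rintro j hj hj' m rfl hm
      rw [pow_apply_eq_pow_apply_iff] at hm ⊢
      rwa [← hsz j hj hj']
    exact this _ (hι _) (hlen ▸ hι _) _ hi0 e
  have hsurj : Function.Surjective F := by
    intro y
    obtain ⟨i, hi, k, rfl⟩ := exists_pow_getElem hu' y
    exact ⟨_, key i (hlen ▸ hi) hi k⟩
  let σ : Perm α := Equiv.ofBijective F (Finite.surjective_iff_bijective.1 hsurj)
  have hσ : ∀ x, σ x = F x := fun _ => rfl
  have hP : ∀ x, σ (P x) = P' (σ x) := by
    intro x
    obtain ⟨i, hi, k, rfl⟩ := exists_pow_getElem hu x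
    have e : P ((P ^ k) l[i]) = (P ^ (k + 1)) l[i] := by rw [pow_succ', Perm.mul_apply]
    rw [e, hσ, hσ, key i hi (hlen ▸ hi), key i hi (hlen ▸ hi), pow_succ', Perm.mul_apply]
  have hl : ∀ i (hi : i < l.length) (hi' : i < l'.length), σ l[i] = l'[i] := fun i hi hi' => by
    have := key i hi hi' 0
    rwa [pow_zero, pow_zero] at this
  have hlink : ∀ i (hi : i + 1 < l.length), σ (R l[i]) = R' (σ l[i]) := by
    intro i hi
    have e1 := hg.spine.link i hi
    have e2 := hg'.spine.link i (hlen ▸ hi)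
    rw [hl i (by omega) (by omega)]
    rw [← e1, ← e2, h.invol, h'.invol, hP, hl (i + 1) hi (hlen ▸ hi)]
  have hlink' : ∀ i (hi : i + 1 < l.length) x, R x = l[i] → σ (R x) = R' (σ x) := by
    intro i hi x hx
    have e := hlink i hi
    rw [← hx, h.invol] at e
    rw [e, h'.invol]
  have hmove : ∀ x, R x ≠ x → σ (R x) = R' (σ x) := by
    intro x hx
    by_contra hne
    refine hg.eq_chain h hu hx fun i hi => ⟨?_, fun e => hne (hlink' i hi x e)⟩
    rintro rfl
    exact hne (hlink i hi)
  refine ⟨σ, hP, fun x => ?_⟩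
  by_cases hx : R x = x
  · rw [hx]
    by_contra hne
    refine hg'.eq_chain h' hu' (x := σ x) (Ne.symm hne) fun i hi => ?_
    have hi0 : i + 1 < l.length := hlen ▸ hi
    have hmem : R l[i] ≠ l[i] := by
      rw [← hg.spine.link i hi0, h.invol, hg.spine.link i hi0]
      intro e
      have h1 : l[i] ∈ orb P l[i + 1] := by
        rw [← e]
        exact apply_mem_orb _ _
      have := hg.spine.eq_of_mem_orb (by omega) hi0 h1
      omega
    rw [← hl i (by omega) (by omega)]
    constructor
    · intro e
      exact hmem (σ.injective e ▸ hx)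
    · intro e
      rw [← h'.invol (σ l[i]), ← hlink i hi0] at e
      have := σ.injective (R'.injective e)
      rw [this, h.invol] at hx
      exact hmem hx.symm
  · exact hmove x hx

end Uniqueness

section Shears

theorem restrictPerm_apply {α : Type*} [Finite α] {σ : Perm α} {c : Set α}
    (h : ∀ t ∈ c, σ t ∈ c) (t : α) [Decidable (t ∈ c)] :
    restrictPerm σ c t = if t ∈ c then σ t else t := by
  classical
  rw [restrictPerm, dif_pos]
  · simp only [Equiv.coe_fn_mk]
    congr
  · have := Fintype.ofFinite α
    exact apply_mem_iff_of_closed h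

theorem apply_mem_iff_of_mem_closure {α : Type*} [Finite α] {p s t : Perm α} {S : Set α}
    (hs : ∀ x ∈ S, s x ∈ S) (ht : ∀ x ∈ S, t x ∈ S)
    (hp : p ∈ Subgroup.closure ({s, t} : Set (Perm α))) (x : α) : p x ∈ S ↔ x ∈ S := by
  classical
  have := Fintype.ofFinite α
  induction hp using Subgroup.closure_induction generalizing x with
  | mem p hp =>
    rcases hp with rfl | rfl
    · exact apply_mem_iff_of_closed hs x
    · exact apply_mem_iff_of_closed ht x
  | one => simp
  | mul p q _ _ hp hq => simp [hp, hq]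
  | inv p _ ih =>
    simpa using (ih (p⁻¹ x)).symm

variable {n : ℕ} {f g : Surf n} {i j : Color} {c : Set (Fin n)}

theorem IsComponent.of_minimal {x : Fin n} (hx : x ∈ c) (hi : ∀ t ∈ c, f i t ∈ c)
    (hj : ∀ t ∈ c, f j t ∈ c)
    (hmin : ∀ S : Set (Fin n), (∀ t ∈ S, f i t ∈ S) → (∀ t ∈ S, f j t ∈ S) → x ∈ S →
      ∀ t ∈ c, t ∈ S) : IsComponent n f i j c := by
  refine ⟨x, Set.Subset.antisymm (hmin _ ?_ ?_ (MulAction.mem_orbit_self x)) ?_⟩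
  · rintro t ⟨p, rfl⟩
    exact ⟨⟨f i, Subgroup.subset_closure (by simp)⟩ * p, mul_smul _ _ _⟩
  · rintro t ⟨p, rfl⟩
    exact ⟨⟨f j, Subgroup.subset_closure (by simp)⟩ * p, mul_smul _ _ _⟩
  · rintro t ⟨⟨p, hp⟩, rfl⟩
    change p x ∈ c
    rwa [apply_mem_iff_of_mem_closure hi hj hp]

theorem IsComponent.exists_minimal (h : IsComponent n f i j c) :
    ∃ x ∈ c, (∀ t ∈ c, f i t ∈ c) ∧ (∀ t ∈ c, f j t ∈ c) ∧
      ∀ S : Set (Fin n), (∀ t ∈ S, f i t ∈ S) → (∀ t ∈ S, f j t ∈ S) → x ∈ S →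
        ∀ t ∈ c, t ∈ S := by
  obtain ⟨x, rfl⟩ := h
  refine ⟨x, MulAction.mem_orbit_self x, ?_, ?_, ?_⟩
  · rintro t ⟨p, rfl⟩
    exact ⟨⟨f i, Subgroup.subset_closure (by simp)⟩ * p, mul_smul _ _ _⟩
  · rintro t ⟨p, rfl⟩
    exact ⟨⟨f j, Subgroup.subset_closure (by simp)⟩ * p, mul_smul _ _ _⟩
  · rintro S hi hj hx t ⟨⟨p, hp⟩, rfl⟩
    change p x ∈ S
    rwa [apply_mem_iff_of_mem_closure hi hj hp]

theorem pow_apply_mem {α : Type*} {p : Perm α} {c : Set α} (h : ∀ t ∈ c, p t ∈ c) (m : ℕ) :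
    ∀ t ∈ c, (p ^ m) t ∈ c := by
  induction m with
  | zero => simp
  | succ m ih =>
    intro t ht
    rw [pow_succ', Perm.mul_apply]
    exact h _ (ih t ht)

theorem pow_apply_reflect {α : Type*} {p s : Perm α} (h : ∀ x, p (s (p x)) = s x) (m : ℕ) (x : α) :
    (p ^ m) (s ((p ^ m) x)) = s x := by
  induction m generalizing x with
  | zero => simp
  | succ m ih =>
    rw [pow_succ, Perm.mul_apply, ← pow_succ, pow_succ', Perm.mul_apply p, h]
    exact ih x

open Classical in
theorem shearPow_apply (hf : ∀ X t, f X (f X t) = t) (hi : ∀ t ∈ c, f i t ∈ c)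
    (hj : ∀ t ∈ c, f j t ∈ c) (m : ℕ) (X : Color) (t : Fin n) :
    shearPow f i j c m X t =
      if (X = i ∨ X = j) ∧ t ∈ c then f X (((f i * f j) ^ m) t) else f X t := by
  have hp := pow_apply_mem (p := f i * f j) (c := c) fun t ht => hi _ (hj t ht)
  have hjj : ∀ x, (f i * f j) (f j ((f i * f j) x)) = f j x := by simp [hf]
  induction m generalizing X t with
  | zero => simp [shearPow]
  | succ m ih =>
    rw [shearPow, shear]
    by_cases hX : X = i ∨ X = j
    · rw [if_pos hX]
      have hi' : ∀ t ∈ c, shearPow f i j c m i t ∈ c := by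
        intro t ht
        rw [ih, if_pos ⟨Or.inl rfl, ht⟩]
        exact hi _ (hp m t ht)
      have hj' : ∀ t ∈ c, shearPow f i j c m j t ∈ c := by
        intro t ht
        rw [ih, if_pos ⟨Or.inr rfl, ht⟩]
        exact hj _ (hp m t ht)
      rw [Perm.mul_apply, Perm.mul_apply, restrictPerm_apply hj']
      by_cases ht : t ∈ c
      · rw [if_pos ht, restrictPerm_apply hi', if_pos (hj' t ht), ih X, if_pos ⟨hX, hi' _ (hj' t ht)⟩,
          if_pos ⟨hX, ht⟩, ih i, if_pos ⟨Or.inl rfl, hj' t ht⟩, ih j, if_pos ⟨Or.inr rfl, ht⟩,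
          pow_apply_reflect hjj, pow_succ, Perm.mul_apply]
        rfl
      · rw [if_neg ht, restrictPerm_apply hi', if_neg ht, ih]
        simp [ht]
    · rw [if_neg hX, ih]
      simp [hX]

theorem shearPow_add (f : Surf n) (i j : Color) (c : Set (Fin n)) (a b : ℕ) :
    shearPow (shearPow f i j c a) i j c b = shearPow f i j c (a + b) := by
  induction b with
  | zero => rfl
  | succ b ih => rw [shearPow, ih, ← Nat.add_assoc, shearPow]

theorem ShearPowStep.invol (h : ShearPowStep n f g) (hf : ∀ X t, f X (f X t) = t) (X : Color)
    (t : Fin n) : g X (g X t) = t := by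
  classical
  obtain ⟨i, j, c, m, hG, hc, -, rfl⟩ := h
  obtain ⟨x, -, hi, hj, -⟩ := hc.exists_minimal
  have hp := pow_apply_mem (p := f i * f j) (c := c) (fun t ht => hi _ (hj t ht)) m
  have key := shearPow_apply hf hi hj m
  have hii := pow_apply_reflect (p := f i * f j) (s := f i) (by simp [hf]) m
  have hjj := pow_apply_reflect (p := f i * f j) (s := f j) (by simp [hf]) m
  by_cases hX : (X = i ∨ X = j) ∧ t ∈ c
  · rw [key, key X t, if_pos hX]
    obtain ⟨rfl | rfl, ht⟩ := hX
    · rw [if_pos ⟨Or.inl rfl, hi _ (hp t ht)⟩, hii, hf]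
    · rw [if_pos ⟨Or.inr rfl, hj _ (hp t ht)⟩, hjj, hf]
  · have : ¬ ((X = i ∨ X = j) ∧ f X t ∈ c) := by
      rintro ⟨hX', ht⟩
      refine hX ⟨hX', ?_⟩
      rw [← hf X t]
      rcases hX' with rfl | rfl
      · exact hi _ ht
      · exact hj _ ht
    rw [key, key X t, if_neg hX, if_neg this, hf]

theorem ShearPowStep.symm (h : ShearPowStep n f g) (hf : ∀ X t, f X (f X t) = t) :
    ShearPowStep n g f := by
  classical
  obtain ⟨i, j, c, m, hG, hc, hm, rfl⟩ := h
  obtain ⟨x, hx, hi, hj, hmin⟩ := hc.exists_minimal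
  have hp := pow_apply_mem (p := f i * f j) (c := c) fun t ht => hi _ (hj t ht)
  have key := shearPow_apply hf hi hj
  set N := orderOf (f i * f j) with hN
  have hNpos : 0 < N := orderOf_pos _
  refine ⟨i, j, c, N * (m + 1) - m, hG, ?_, ?_, ?_⟩
  · have hpow : ∀ S : Set (Fin n), (∀ t ∈ S, shearPow f i j c m i t ∈ S) →
        (∀ t ∈ S, shearPow f i j c m j t ∈ S) → ∀ t ∈ S, t ∈ c → (f i * f j) t ∈ S := by
      intro S hSi hSj t ht htc
      have hjj : ∀ x, (f i * f j) (f j ((f i * f j) x)) = f j x := by simp [hf]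
      have := hSi _ (hSj t ht)
      rwa [key m j, if_pos ⟨Or.inr rfl, htc⟩, key, if_pos ⟨Or.inl rfl, hj _ (hp m _ htc)⟩,
        pow_apply_reflect hjj] at this
    have hpow' : ∀ S : Set (Fin n), (∀ t ∈ S, shearPow f i j c m i t ∈ S) →
        (∀ t ∈ S, shearPow f i j c m j t ∈ S) → ∀ X, (X = i ∨ X = j) → ∀ t ∈ S, t ∈ c → f X t ∈ S := by
      intro S hSi hSj X hX t ht htc
      have h1 : ((f i * f j) ^ (N * (m + 1) - m)) t ∈ S ∩ c :=
        pow_apply_mem (c := S ∩ c) (fun t ht =>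
          ⟨hpow S hSi hSj t ht.1 ht.2, hi _ (hj _ ht.2)⟩) _ _ ⟨ht, htc⟩
      have h2 : shearPow f i j c m X (((f i * f j) ^ (N * (m + 1) - m)) t) ∈ S := by
        rcases hX with rfl | rfl
        · exact hSi _ h1.1
        · exact hSj _ h1.1
      have hle : m ≤ N * (m + 1) := by nlinarith
      rw [key, if_pos ⟨hX, h1.2⟩, ← Perm.mul_apply (_ ^ m), ← pow_add, Nat.add_sub_cancel' hle, pow_mul,
        hN, pow_orderOf_eq_one, one_pow] at h2
      exact h2
    refine IsComponent.of_minimal hx ?_ ?_ fun S hSi hSj hxS t ht => ?_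
    · intro t ht
      rw [key, if_pos ⟨Or.inl rfl, ht⟩]
      exact hi _ (hp m t ht)
    · intro t ht
      rw [key, if_pos ⟨Or.inr rfl, ht⟩]
      exact hj _ (hp m t ht)
    · exact (hmin (S ∩ c)
        (fun t ht => ⟨hpow' S hSi hSj i (.inl rfl) t ht.1 ht.2, hi _ ht.2⟩)
        (fun t ht => ⟨hpow' S hSi hSj j (.inr rfl) t ht.1 ht.2, hj _ ht.2⟩) ⟨hxS, hx⟩ t ht).1
  · have : m + 1 ≤ N * (m + 1) := Nat.le_mul_of_pos_left _ hNpos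
    omega
  · have hle : m ≤ N * (m + 1) := by nlinarith
    rw [shearPow_add, Nat.add_sub_cancel' hle]
    funext X
    ext t
    rw [key, pow_mul, hN, pow_orderOf_eq_one, one_pow]
    simp

/-- The surface obtained by relabelling the squares. -/
def Surf.conj (σ : Perm (Fin n)) (f : Surf n) : Surf n := fun X => σ * f X * σ⁻¹

theorem Surf.conj_apply (σ : Perm (Fin n)) (f : Surf n) (X : Color) (t : Fin n) :
    f.conj σ X (σ t) = σ (f X t) := by simp [Surf.conj]

theorem ShearPowStep.conj (h : ShearPowStep n f g) (hf : ∀ X t, f X (f X t) = t)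
    (σ : Perm (Fin n)) : ShearPowStep n (f.conj σ) (g.conj σ) := by
  classical
  obtain ⟨i, j, c, m, hG, hc, hm, rfl⟩ := h
  obtain ⟨x, hx, hi, hj, hmin⟩ := hc.exists_minimal
  have hf' : ∀ X t, f.conj σ X (f.conj σ X t) = t := fun X t => by
    simp [Surf.conj, hf]
  have hi' : ∀ t ∈ σ '' c, f.conj σ i t ∈ σ '' c := by
    rintro _ ⟨t, ht, rfl⟩
    exact ⟨_, hi t ht, (f.conj_apply σ i t).symm⟩
  have hj' : ∀ t ∈ σ '' c, f.conj σ j t ∈ σ '' c := by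
    rintro _ ⟨t, ht, rfl⟩
    exact ⟨_, hj t ht, (f.conj_apply σ j t).symm⟩
  refine ⟨i, j, σ '' c, m, hG, .of_minimal ⟨x, hx, rfl⟩ hi' hj' ?_, hm, ?_⟩
  · rintro S hSi hSj hxS _ ⟨t, ht, rfl⟩
    refine hmin (σ ⁻¹' S) (fun t ht => ?_) (fun t ht => ?_) hxS t ht
    · rw [Set.mem_preimage, ← f.conj_apply]
      exact hSi _ ht
    · rw [Set.mem_preimage, ← f.conj_apply]
      exact hSj _ ht
  · have hp : f.conj σ i * f.conj σ j = σ * (f i * f j) * σ⁻¹ := by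
      simp [Surf.conj, mul_assoc]
    funext X
    ext t
    obtain ⟨t, rfl⟩ := σ.surjective t
    rw [shearPow_apply hf' hi' hj', Surf.conj_apply, shearPow_apply hf hi hj, hp,
      conj_pow]
    simp only [σ.injective.mem_set_image]
    split_ifs <;> simp [Surf.conj]

theorem ShearPowSeq.trans {h : Surf n} {L M : ℕ} (h₁ : ShearPowSeq n L f g)
    (h₂ : ShearPowSeq n M g h) : ShearPowSeq n (L + M) f h := by
  induction L generalizing f with
  | zero =>
    obtain rfl : f = g := h₁
    rwa [Nat.zero_add]
  | succ L ih =>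
    obtain ⟨e, hs, ht⟩ := h₁
    rw [Nat.add_right_comm]
    exact ⟨e, hs, ih ht⟩

theorem ShearPowStep.seq (h : ShearPowStep n f g) : ShearPowSeq n 1 f g := ⟨g, h, rfl⟩

theorem ShearPowSeq.symm {L : ℕ} (h : ShearPowSeq n L f g) (hf : ∀ X t, f X (f X t) = t) :
    ShearPowSeq n L g f := by
  induction L generalizing f with
  | zero => exact Eq.symm h
  | succ L ih =>
    obtain ⟨e, hs, ht⟩ := h
    exact (ih ht (hs.invol hf)).trans (hs.symm hf).seq

theorem ShearPowSeq.conj {L : ℕ} (h : ShearPowSeq n L f g) (hf : ∀ X t, f X (f X t) = t)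
    (σ : Perm (Fin n)) : ShearPowSeq n L (f.conj σ) (g.conj σ) := by
  induction L generalizing f with
  | zero =>
    obtain rfl : f = g := h
    rfl
  | succ L ih =>
    obtain ⟨e, hs, ht⟩ := h
    exact ⟨_, hs.conj hf σ, ih ht (hs.invol hf)⟩

end Shears

section Frames

variable {n : ℕ} {f g : Surf n} {i j : Color} {c : Set (Fin n)}

theorem shearPow_mul (hf : ∀ X t, f X (f X t) = t) (hi : ∀ t ∈ c, f i t ∈ c)
    (hj : ∀ t ∈ c, f j t ∈ c) (m : ℕ) :
    shearPow f i j c m i * shearPow f i j c m j = f i * f j := by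
  classical
  have hp := pow_apply_mem (p := f i * f j) (c := c) (fun t ht => hi _ (hj t ht)) m
  have key := shearPow_apply hf hi hj m
  ext t
  rw [Perm.mul_apply, Perm.mul_apply, key j]
  by_cases ht : t ∈ c
  · rw [if_pos ⟨Or.inr rfl, ht⟩, key, if_pos ⟨Or.inl rfl, hj _ (hp t ht)⟩, pow_apply_reflect]
    simp [hf]
  · have : f j t ∉ c := fun h => ht (by rw [← hf j t]; exact hj _ h)
    simp [key, ht, this]

theorem shearPow_eq_self (hf : ∀ X t, f X (f X t) = t) (hi : ∀ t ∈ c, f i t ∈ c)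
    (hj : ∀ t ∈ c, f j t ∈ c) (m : ℕ) {X : Color} (hX : X ≠ i) (hX' : X ≠ j) :
    shearPow f i j c m X = f X := by
  classical
  ext t
  rw [shearPow_apply hf hi hj, if_neg]
  tauto

variable {P R G : Perm (Fin n)}

/-- The triple of involutions with given product and given first two members. -/
def surf (P R G : Perm (Fin n)) : Surf n
  | .R => R
  | .G => G
  | .B => G * (R * P)

/-- `surf P R G` consists of involutions. -/
structure Frame (P R G : Perm (Fin n)) : Prop where
  red : ∀ t, R (R t) = t
  green : ∀ t, G (G t) = t
  blue : ∀ t, G (R (P (G (R (P t))))) = t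

theorem eq_surf (hg : ∀ X t, g X (g X t) = t) (hP : prodRGB g = P) :
    g = surf P (g .R) (g .G) ∧ Frame P (g .R) (g .G) := by
  have h : g = surf P (g .R) (g .G) := by
    funext X
    cases X
    · rfl
    · rfl
    · ext t
      simp [surf, ← hP, prodRGB, hg]
  refine ⟨h, hg _, hg _, fun t => ?_⟩
  have := hg .B t
  rw [h] at this
  exact this

namespace Frame

theorem invol (h : Frame P R G) : ∀ X t, surf P R G X (surf P R G X t) = t
  | .R, t => h.red t
  | .G, t => h.green t
  | .B, t => h.blue t

theorem inverts (h : Frame P R G) (t : Fin n) : (R * P) (G ((R * P) t)) = G t := by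
  have := h.blue t
  rw [← h.green ((R * P) _)]
  exact congrArg G this

theorem sameCycle_apply (h : Frame P R G) {u s : Fin n} (hs : (R * P).SameCycle u s) :
    (R * P).SameCycle (G u) (G s) := by
  refine mem_of_sameCycle (f := R * P) (T := {s | (R * P).SameCycle (G u) (G s)})
    (fun t ht => ?_) (SameCycle.refl _ _) hs
  change (R * P).SameCycle _ _
  rw [← sameCycle_apply_right, h.inverts]
  exact ht

theorem exists_green_step (h : Frame P R G) {u t : Fin n} (ht : (R * P).SameCycle u (G t)) :
    ∃ G', Frame P R G' ∧ ShearPowStep n (surf P R G) (surf P R G') ∧ G' u = t ∧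
      ∀ s, ¬ (R * P).SameCycle u s → ¬ (R * P).SameCycle (G u) s → G' s = G s := by
  classical
  set f := surf P R G with hf
  set c : Set (Fin n) := {s | (R * P).SameCycle u s ∨ (R * P).SameCycle (G u) s} with hc
  have hρ : f .G * f .B = R * P := by
    ext s
    simp [hf, surf, h.green]
  have hcρ : ∀ s ∈ c, (R * P) s ∈ c := by
    rintro s (hs | hs)
    · exact Or.inl (sameCycle_apply_right.2 hs)
    · exact Or.inr (sameCycle_apply_right.2 hs)
  have hcG : ∀ s ∈ c, f .G s ∈ c := by
    rintro s (hs | hs)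
    · exact Or.inr (h.sameCycle_apply hs)
    · have := h.sameCycle_apply hs
      rw [h.green] at this
      exact Or.inl this
  have hcB : ∀ s ∈ c, f .B s ∈ c := fun s hs => hcG _ (hcρ s hs)
  have hu : u ∈ c := Or.inl (SameCycle.refl _ _)
  obtain ⟨m, hm, -, e⟩ := ht.exists_pow_eq''
  have hstep : ShearPowStep n f (shearPow f .G .B c m) := by
    refine ⟨.G, .B, c, m, Or.inr rfl, .of_minimal hu hcG hcB ?_, hm, rfl⟩
    intro S hG hB hx s hs
    have hS : ∀ s ∈ S, (R * P) s ∈ S := by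
      intro s hs
      rw [← hρ]
      exact hG _ (hB s hs)
    rcases hs with hs | hs
    · exact mem_of_sameCycle hS hx hs
    · exact mem_of_sameCycle hS (hG _ hx) hs
  set g := shearPow f .G .B c m
  have hR : g .R = R := shearPow_eq_self h.invol hcG hcB m (by simp) (by simp)
  have hP : prodRGB g = P := by
    rw [prodRGB, mul_assoc, shearPow_mul h.invol hcG hcB, hR, hρ]
    ext s
    simp [h.red]
  obtain ⟨e₁, e₂⟩ := eq_surf (hstep.invol h.invol) hP
  rw [hR] at e₁ e₂
  refine ⟨g .G, e₂, e₁ ▸ hstep, ?_, fun s h₁ h₂ => ?_⟩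
  · rw [shearPow_apply h.invol hcG hcB, if_pos ⟨Or.inl rfl, hu⟩, hρ, e]
    exact h.green t
  · rw [shearPow_apply h.invol hcG hcB, if_neg]
    · rfl
    · rintro ⟨-, hs | hs⟩
      · exact h₁ hs
      · exact h₂ hs

/-- The step of `exists_green_step` reaches every second reflection of a one-cylinder surface. -/
theorem green_step (h : Frame P R G) (hc : OneCycle (R * P)) [NeZero n] {G' : Perm (Fin n)}
    (h' : Frame P R G') : ShearPowStep n (surf P R G) (surf P R G') := by
  obtain ⟨G₁, h₁, hs, e, -⟩ := h.exists_green_step (u := 0) (t := G' 0) (hc _ _)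
  suffices G₁ = G' by rwa [← this]
  ext t : 1
  refine mem_of_sameCycle (f := R * P) (T := {t | G₁ t = G' t}) (fun t ht => ?_) e (hc 0 t)
  apply (R * P).injective
  rw [h₁.inverts, h'.inverts]
  exact ht

theorem red_step (h : Frame P R G) {T : Set (Fin n)} {x : Fin n} (hR : ∀ t ∈ T, R t ∈ T)
    (hG : ∀ t ∈ T, G t ∈ T) (hx : x ∈ T)
    (hmin : ∀ S : Set (Fin n), (∀ t ∈ S, R t ∈ S) → (∀ t ∈ S, G t ∈ S) → x ∈ S → ∀ t ∈ T, t ∈ S)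
    {m : ℕ} (hm : 1 ≤ m) :
    ∃ R' G', Frame P R' G' ∧ ShearPowStep n (surf P R G) (surf P R' G') ∧
      (∀ t ∈ T, R' t = R (((R * G) ^ m) t)) ∧ (∀ t ∈ T, G' t = G (((R * G) ^ m) t)) ∧
      ∀ t ∉ T, R' t = R t ∧ G' t = G t := by
  classical
  set f := surf P R G with hf
  have hstep : ShearPowStep n f (shearPow f .R .G T m) :=
    ⟨.R, .G, T, m, Or.inl rfl, .of_minimal hx hR hG hmin, hm, rfl⟩
  have key := shearPow_apply (i := .R) (j := .G) h.invol hR hG m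
  set g := shearPow f .R .G T m
  have hB : g .B = surf P R G .B :=
    shearPow_eq_self (i := .R) (j := .G) (X := .B) h.invol hR hG m (by simp) (by simp)
  have hP : prodRGB g = P := by
    rw [prodRGB, shearPow_mul h.invol hR hG, hB]
    ext s
    simp [surf, h.red, h.green]
  obtain ⟨e₁, e₂⟩ := eq_surf (hstep.invol h.invol) hP
  refine ⟨g .R, g .G, e₂, e₁ ▸ hstep, fun t ht => ?_, fun t ht => ?_, fun t ht => ⟨?_, ?_⟩⟩
  · rw [key, if_pos ⟨Or.inl rfl, ht⟩]
    rfl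
  · rw [key, if_pos ⟨Or.inr rfl, ht⟩]
    rfl
  · rw [key, if_neg (by tauto)]
    rfl
  · rw [key, if_neg (by tauto)]
    rfl

theorem swap_step (h : Frame P R G) {x y : Fin n} (hx : R (G x) = y) (hy : R (G y) = x)
    (hR : R x = x ∨ R x = y) :
    Frame P (R * swap x y) (G * swap x y) ∧
      ShearPowStep n (surf P R G) (surf P (R * swap x y) (G * swap x y)) := by
  have hGx : G x = R y := by rw [← hx, h.red]
  have hGy : G y = R x := by rw [← hy, h.red]
  have hRy : R y = x ∨ R y = y := by
    rcases hR with hR | hR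
    · right
      rw [← hGx, ← h.green y, hGy, hR]
    · left
      rw [← hR, h.red]
  obtain ⟨R', G', hF, hs, e₁, e₂, e₃⟩ := h.red_step (T := {x, y}) (x := x) (m := 1)
    (by rintro t (rfl | rfl) <;> simp <;> tauto)
    (by rintro t (rfl | rfl) <;> simp [hGx, hGy] <;> tauto) (by simp)
    (by
      rintro S hSR hSG hxS t (rfl | rfl)
      · exact hxS
      · rw [← hx]
        exact hSR _ (hSG _ hxS))
    le_rfl
  have hR' : R' = R * swap x y := by
    ext t : 1
    by_cases ht : t ∈ ({x, y} : Set (Fin n))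
    · rw [e₁ t ht]
      rcases ht with rfl | rfl <;> simp [hx, hy]
    · rw [(e₃ t ht).1]
      simp only [Set.mem_insert_iff, Set.mem_singleton_iff, not_or] at ht
      rw [Perm.mul_apply, swap_apply_of_ne_of_ne ht.1 ht.2]
  have hG' : G' = G * swap x y := by
    ext t : 1
    by_cases ht : t ∈ ({x, y} : Set (Fin n))
    · rw [e₂ t ht]
      rcases ht with rfl | rfl <;> simp [hx, hy]
    · rw [(e₃ t ht).2]
      simp only [Set.mem_insert_iff, Set.mem_singleton_iff, not_or] at ht
      rw [Perm.mul_apply, swap_apply_of_ne_of_ne ht.1 ht.2]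
  subst hR' hG'
  exact ⟨hF, hs⟩

end Frame

end Frames

section Realisation

variable {n : ℕ} {P R G : Perm (Fin n)}

theorem ShearPowStep.cons {f g h : Surf n} {L : ℕ} (hs : ShearPowStep n f g)
    (ht : ShearPowSeq n L g h) : ShearPowSeq n (L + 1) f h := ⟨g, hs, ht⟩

theorem Frame.exists_fixing_step (h : Frame P R G) {u : Fin n}
    (hu : (R * P).SameCycle u (G u)) :
    ∃ G', Frame P R G' ∧ ShearPowStep n (surf P R G) (surf P R G') ∧ G' u = u ∧
      ∀ s, ¬ (R * P).SameCycle u s → G' s = G s := by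
  obtain ⟨G', hF, hs, e, e'⟩ := h.exists_green_step hu
  exact ⟨G', hF, hs, e, fun s h' => e' s h' fun h'' => h' (hu.trans h'')⟩

theorem Frame.sameCycle_of_fixed (h : Frame P R G) {x t : Fin n} (hx : G x = x)
    (ht : (R * P).SameCycle x t) : (R * P).SameCycle t (G t) := by
  have := h.sameCycle_apply ht
  rw [hx] at this
  exact ht.symm.trans this

theorem Frame.reconnect (h : Frame P R G) {c x y : Fin n} (hT : PlaneTree P R)
    (hT' : PlaneTree P (reconnect R c x y)) (hc : R c ≠ c) (hx : R x = x) (hy : R y = y) :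
    ∃ G', Frame P (_root_.reconnect R c x y) G' ∧
      ShearPowSeq n 5 (surf P R G) (surf P (_root_.reconnect R c x y) G') := by
  obtain ⟨G₁, h₁, s₁, e₁, -⟩ := h.exists_green_step (u := x) (t := y) (hT.contour _ _)
  have e₁' : G₁ y = x := by rw [← e₁, h₁.green]
  obtain ⟨h₂, s₂⟩ := h₁.swap_step (x := x) (y := y) (by rw [e₁, hy]) (by rw [e₁', hx]) (Or.inl hx)
  have hcomm : R * swap x y = swap x y * R := by
    rw [mul_swap_eq_swap_mul, hx, hy]
  set R₂ := R * swap x y with hR₂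
  set G₂ := G₁ * swap x y with hG₂
  have hGx : G₂ x = x := by simp [hG₂, e₁']
  have hGy : G₂ y = y := by simp [hG₂, e₁]
  have hcx : c ≠ x := fun e => hc (e ▸ hx)
  have hcy : c ≠ y := fun e => hc (e ▸ hy)
  have hcx' : R c ≠ x := fun e => hcx (R.injective (e.trans hx.symm))
  have hcy' : R c ≠ y := fun e => hcy (R.injective (e.trans hy.symm))
  have hRc : R₂ c = R c := by rw [hR₂, Perm.mul_apply, swap_apply_of_ne_of_ne hcx hcy]
  have hRc' : R₂ (R c) = c := by
    rw [hR₂, Perm.mul_apply, swap_apply_of_ne_of_ne hcx' hcy', hT.invol]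
  have hfin : _root_.reconnect R c x y = swap c (R c) * R₂ := by
    rw [_root_.reconnect, ← mul_assoc, mul_swap_eq_swap_mul, swap_apply_of_ne_of_ne hcx hcy,
      swap_apply_of_ne_of_ne hcx' hcy', mul_assoc, hcomm]
  have hfin' : _root_.reconnect R c x y = R₂ * swap c (R c) := by
    rw [hfin, mul_swap_eq_swap_mul, hRc, hRc', swap_comm]
  have hρ : R₂ * P = swap x y * (R * P) := by rw [hcomm, mul_assoc]
  have hcover : ∀ t, (R₂ * P).SameCycle t (G₂ t) := by
    intro t
    have := swap_mul_cover (f := R * P) (x := x) (y := y) (fun t => Or.inl (hT.contour x t)) t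
    rw [← hρ] at this
    rcases this with ht | ht
    · exact h₂.sameCycle_of_fixed hGx ht
    · exact h₂.sameCycle_of_fixed hGy ht
  have hsep : ¬ (R₂ * P).SameCycle c (R c) := by
    intro h'
    apply not_sameCycle_swap_mul (Ne.symm hc) h'
    rw [← mul_assoc, ← hfin]
    exact hT'.contour _ _
  obtain ⟨G₃, h₃, s₃, e₃, f₃⟩ := h₂.exists_fixing_step (hcover c)
  obtain ⟨G₄, h₄, s₄, e₄, f₄⟩ := h₃.exists_fixing_step (u := R c)
    (by rw [f₃ _ hsep]; exact hcover _)
  have e₄' : G₄ c = c := by rw [f₄ _ fun h' => hsep h'.symm, e₃]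
  obtain ⟨h₅, s₅⟩ := h₄.swap_step (x := c) (y := R c) (by rw [e₄', hRc]) (by rw [e₄, hRc'])
    (Or.inr hRc)
  rw [hfin']
  exact ⟨_, h₅, s₁.cons (s₂.cons (s₃.cons (s₄.cons s₅.seq)))⟩

theorem Move.exists_shears [NeZero n] {R' : Perm (Fin n)} (hm : Move P R R') (h : Frame P R G) :
    ∃ G' L, L ≤ 5 ∧ Frame P R' G' ∧ ShearPowSeq n L (surf P R G) (surf P R' G') := by
  cases hm with
  | reconnect hT hT' hc hx hy _ =>
    obtain ⟨G', hF, hs⟩ := h.reconnect hT hT' hc hx hy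
    exact ⟨G', 5, le_rfl, hF, hs⟩
  | @flip _ G₀ T x m hT hT' hG hGR hRT hGT hx hmin hm hin hout =>
    have h₀ : Frame P R G₀ := ⟨hT.invol, hG, hGR⟩
    obtain ⟨R₁, G₁, hF, hs, e₁, -, e₂⟩ := h₀.red_step (T := (T : Set (Fin n)))
      (by simpa using hRT) (by simpa using hGT) (by simpa using hx) (by simpa using hmin) hm
    obtain rfl : R₁ = R' := by
      ext t : 1
      by_cases ht : t ∈ T
      · rw [hin t ht, e₁ t (by simpa using ht)]
      · rw [hout t ht, (e₂ t (by simpa using ht)).1]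
    exact ⟨G₁, 2, by norm_num, hF, (h.green_step hT.contour h₀).cons hs.seq⟩

theorem Moves.exists_shears [NeZero n] {N : ℕ} {R' : Perm (Fin n)} (hm : Moves P N R R')
    (h : Frame P R G) :
    ∃ G' L, L ≤ 5 * N ∧ Frame P R' G' ∧ ShearPowSeq n L (surf P R G) (surf P R' G') := by
  induction hm with
  | refl => exact ⟨G, 0, Nat.zero_le _, h, rfl⟩
  | step _ hm ih =>
    obtain ⟨G₁, L, hL, h₁, hs⟩ := ih h
    obtain ⟨G₂, M, hM, h₂, hs'⟩ := hm.exists_shears h₁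
    exact ⟨G₂, L + M, by omega, h₂, hs.trans hs'⟩

end Realisation

section Profiles

variable {n : ℕ} {P P' : Perm (Fin n)}

theorem sz_eq_card_support_cycleOf {x : Fin n} (hx : P x ≠ x) :
    sz P x = (P.cycleOf x).support.card := by
  rw [sz]
  congr 1
  ext y
  rw [mem_orb, mem_support_cycleOf_iff' hx]

theorem card_filter_sz (P : Perm (Fin n)) {i : ℕ} (hi : 1 ≤ i) :
    (univ.filter fun x => sz P x = i).card = i * cycleCount P i := by
  rw [cycleCount]
  split_ifs with h1
  · subst h1
    simp only [sz_eq_one_iff, fixedCount, one_mul]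
  have h : (univ.filter fun x => sz P x = i) =
      (P.cycleFactorsFinset.filter fun c => c.support.card = i).biUnion fun c => c.support := by
    ext x
    simp only [mem_filter, mem_univ, true_and, mem_biUnion]
    constructor
    · intro hx
      have hP : P x ≠ x := fun e => h1 (by rw [← hx, sz_eq_one_iff.2 e])
      refine ⟨P.cycleOf x, ⟨?_, ?_⟩, ?_⟩
      · rw [cycleOf_mem_cycleFactorsFinset_iff, mem_support]
        exact hP
      · rw [← sz_eq_card_support_cycleOf hP, hx]
      · rw [mem_support_cycleOf_iff' hP]
    · rintro ⟨c, ⟨hc, hci⟩, hx⟩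
      have hP : P x ≠ x := mem_support.1 (mem_cycleFactorsFinset_support_le hc hx)
      rw [sz_eq_card_support_cycleOf hP, ← cycle_is_cycleOf hx hc, hci]
  rw [h, card_biUnion, sum_congr rfl fun c hc => (mem_filter.1 hc).2, sum_const, smul_eq_mul,
    mul_comm, cycleType_def, Multiset.count_map]
  · congr 1
    rw [card_def, filter_val]
    congr 2
    ext c
    exact eq_comm
  · intro c hc d hd hcd
    exact (P.cycleFactorsFinset_pairwise_disjoint (mem_filter.1 hc).1 (mem_filter.1 hd).1
      hcd).disjoint_support

theorem sum_wt_eq (P : Perm (Fin n)) :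
    ∑ x, wt P x = ∑ i ∈ Icc 1 n, (cycleCount P i : ℚ) * ((i : ℚ) - 2) := by
  rw [← sum_fiberwise_of_maps_to (t := Icc 1 n) (g := sz P)
    fun x _ => mem_Icc.2 ⟨sz_pos P x, by simpa using sz_le_card P x⟩]
  refine sum_congr rfl fun i hi => ?_
  have hi1 := (mem_Icc.1 hi).1
  have hi0 : (i : ℚ) ≠ 0 := by positivity
  rw [sum_congr rfl fun x hx => by rw [wt, (mem_filter.1 hx).2], sum_const, nsmul_eq_mul,
    card_filter_sz P hi1]
  push_cast
  field_simp

theorem exists_conj_of_cycleCount (h : ∀ i, 1 ≤ i → cycleCount P i = cycleCount P' i) :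
    ∃ σ : Perm (Fin n), ∀ x, σ (P x) = P' (σ x) := by
  have : IsConj P P' := by
    rw [isConj_iff_cycleType_eq]
    ext i
    rcases Nat.lt_or_ge 1 i with hi | hi
    · simpa [cycleCount, hi.ne'] using h i hi.le
    · rw [Multiset.count_eq_zero_of_notMem fun h => (one_lt_of_mem_cycleType h).not_ge hi,
        Multiset.count_eq_zero_of_notMem fun h => (one_lt_of_mem_cycleType h).not_ge hi]
  obtain ⟨σ, rfl⟩ := isConj_iff.1 this
  exact ⟨σ, by simp⟩

theorem IsPathLike.oneCycle {f : Surf n} (hf : ∀ X t, f X (f X t) = t) (h : IsPathLike n f) :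
    OneCycle (f .G * f .B) := by
  set ρ := f .G * f .B
  have hρ : ∀ t, ρ (f .G (ρ t)) = f .G t := fun t => by simp [ρ, hf]
  have key : ∀ u s, ρ.SameCycle u s → ρ.SameCycle (f .G u) (f .G s) := by
    intro u s hs
    refine mem_of_sameCycle (f := ρ) (T := {s | ρ.SameCycle (f .G u) (f .G s)})
      (fun t ht => ?_) (SameCycle.refl _ _) hs
    change ρ.SameCycle _ _
    rw [← sameCycle_apply_right, hρ]
    exact ht
  obtain ⟨x, hx⟩ : ∃ x, ρ.SameCycle x (f .G x) := by
    by_contra! hno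
    have hG : fixedCount (f .G) = 0 := by
      rw [fixedCount, card_eq_zero, filter_eq_empty_iff]
      exact fun x _ hx => hno x (by rw [hx])
    have hB : fixedCount (f .B) = 0 := by
      rw [fixedCount, card_eq_zero, filter_eq_empty_iff]
      refine fun x _ hx => hno x ?_
      have e : ρ x = f .G x := congrArg (f .G) hx
      rw [← e, sameCycle_apply_right]
    have := h.2
    omega
  have hall : ∀ y, ρ.SameCycle x y := by
    intro y
    obtain ⟨p, hp, rfl⟩ := h.1 x y
    have hG : ∀ t ∈ {t | ρ.SameCycle x t}, f .G t ∈ {t | ρ.SameCycle x t} :=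
      fun t ht => hx.trans (key _ _ ht)
    refine (apply_mem_iff_of_mem_closure (S := {t | ρ.SameCycle x t}) hG (fun t ht => ?_) hp x).2
      (SameCycle.refl _ _)
    have := hG (ρ t) (sameCycle_apply_right.2 ht)
    rwa [Perm.mul_apply, hf] at this
  exact fun y z => (hall y).symm.trans (hall z)

theorem exists_normal_surf {f : Surf n} {μ : ℕ → ℕ} {k : ℕ} (hs : IsSTS n f)
    (hp : HasProfile f μ k)
    (hsph : (∑ i ∈ Finset.Icc 1 n, (μ i : ℤ) * ((i : ℤ) - 2)) = (k : ℤ) - 4) (hμ : μ 1 ≤ 1)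
    (hl : IsPathLike n f) :
    ∃ R G l L, L ≤ 30 * k ∧ ShearPowSeq n L f (surf (prodRGB f) R G) ∧
      Frame (prodRGB f) R G ∧ PlaneTree (prodRGB f) R ∧ Greedy (prodRGB f) R l ∧
      orbs (prodRGB f) l = univ := by
  have hf : ∀ X t, f X (f X t) = t := fun X t => by
    rw [← Perm.mul_apply, hs.2.1, Perm.one_apply]
  have : NeZero n := ⟨by have := hs.1; omega⟩
  obtain ⟨e, hF⟩ := eq_surf hf rfl
  have hwt : ∑ x, wt (prodRGB f) x = (k : ℚ) - 4 := by
    have hq := congrArg (Int.cast : ℤ → ℚ) hsph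
    push_cast at hq
    rw [sum_wt_eq, ← hq]
    refine sum_congr rfl fun i hi => ?_
    rw [hp.1 i (mem_Icc.1 hi).1]
  have hcont : OneCycle (f .R * prodRGB f) := by
    have : f .R * prodRGB f = f .G * f .B := by
      rw [prodRGB, ← mul_assoc, ← mul_assoc, hs.2.1, one_mul]
    rw [this]
    exact hl.oneCycle hf
  have hT : PlaneTree (prodRGB f) (f .R) := by
    refine ⟨hF.red, hcont, ?_⟩
    have h1 := hp.2
    have h2 := hl.2
    rw [totalFixed, add_assoc, h2] at h1
    rw [hwt, ← h1, fixedCount]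
    push_cast
    linarith
  have hleaf : ∀ x y, prodRGB f x = x → prodRGB f y = y → x = y := by
    have h1 := hp.1 1 le_rfl
    rw [cycleCount, if_pos rfl, fixedCount] at h1
    rw [← h1, card_le_one] at hμ
    exact fun x y hx hy => hμ x (by simpa using hx) y (by simpa using hy)
  obtain ⟨R, l, N, hm, hN, hT', hg, hu⟩ := hT.exists_greedy hleaf
  obtain ⟨G, L, hL, hF', hseq⟩ := hm.exists_shears hF
  rw [← e] at hseq
  have hNk : N ≤ 6 * k := by
    rw [hwt] at hN
    have : (N : ℚ) ≤ 6 * k := by linarith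
    exact_mod_cast this
  exact ⟨R, G, l, L, by omega, hseq, hF', hT', hg, hu⟩

end Profiles

end

/-- There is a constant `C > 0` such that any two path-like
square-tiled surfaces with the same spherical profile `(μ, k)`, `μ_1 ≤ 1`, are
connected by at most `C·k` powers of cylinder shears, up to isomorphism. -/
theorem stmt14 :
    ∃ C : ℕ, 0 < C ∧
      ∀ (n : ℕ) (τ τ' : Surf n) (μ : ℕ → ℕ) (k : ℕ),
        IsSTS n τ → IsSTS n τ' →
        HasProfile τ μ k → HasProfile τ' μ k →
        (∑ i ∈ Finset.Icc 1 n, (μ i : ℤ) * ((i : ℤ) - 2)) = (k : ℤ) - 4 →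
        μ 1 ≤ 1 →
        IsPathLike n τ → IsPathLike n τ' →
        ∃ (L : ℕ) (f'' : Surf n),
          L ≤ C * k ∧ ShearPowSeq n L τ f'' ∧ Isomorphic n τ' f'' := by
  refine ⟨61, by norm_num, fun n τ τ' μ k hs hs' hp hp' hsph hμ hl hl' => ?_⟩
  have : NeZero n := ⟨by have := hs.1; omega⟩
  have hτ' : ∀ X t, τ' X (τ' X t) = t := fun X t => by
    rw [← Equiv.Perm.mul_apply, hs'.2.1, Equiv.Perm.one_apply]
  obtain ⟨R, G, l, L, hL, hseq, hF, hT, hg, hu⟩ := exists_normal_surf hs hp hsph hμ hl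
  obtain ⟨R', G', l', L', hL', hseq', hF', hT', hg', hu'⟩ := exists_normal_surf hs' hp' hsph hμ hl'
  obtain ⟨σ₀, hσ₀⟩ := exists_conj_of_cycleCount
    fun i hi => (hp.1 i hi).trans (hp'.1 i hi).symm
  obtain ⟨σ, hσP, hσR⟩ := hg.exists_conj hσ₀ hT hT' hg' hu hu'
  have hP : prodRGB τ = σ⁻¹ * prodRGB τ' * σ := by
    ext t
    simp [← hσP]
  have hR : R = σ⁻¹ * R' * σ := by
    ext t
    simp [← hσR]
  have hconj : (surf (prodRGB τ') R' G').conj σ⁻¹ = surf (prodRGB τ) R (σ⁻¹ * G' * σ) := by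
    rw [hP, hR]
    funext X
    cases X <;> simp [Surf.conj, surf, mul_assoc]
  have hF'' : Frame (prodRGB τ) R (σ⁻¹ * G' * σ) := by
    rw [hP, hR]
    refine ⟨fun t => ?_, fun t => ?_, fun t => ?_⟩ <;>
      simp [hF'.red, hF'.green, hF'.blue]
  have hback := (hseq'.symm hτ').conj hF'.invol σ⁻¹
  rw [hconj] at hback
  have hk : 1 ≤ k := by
    have h1 := hp.2
    have h2 := hl.2
    rw [totalFixed] at h1
    omega
  exact ⟨L + 1 + L', τ'.conj σ⁻¹, by omega,
    (hseq.trans (hF.green_step hT.contour hF'').seq).trans hback, σ⁻¹, fun _ => rfl⟩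
end

section
/- Let g ≥ 2 and μ_2 ≥ 0. (1) If τ is an Abelian hyperelliptic square-tiled surface with profile ([2^{μ_2}, 4g−2], 0) and hyperelliptic involution α, then the quotient τ/⟨α⟩ has profile ([1^{μ'_1}, 2^{μ'_2}, 2g−1], k') for some non-negative integers μ'_1, μ'_2, k' satisfying k' + μ'_1 = 2g+1 and μ'_1 + 2μ'_2 = μ_2. (2) If τ is an Abelian hyperelliptic square-tiled surface with profile ([2^{μ_2}, (2g)^2], 0) whose hyperelliptic involution α exchanges the two cycles of length 2g of τ_R·τ_G·τ_B, then τ/⟨α⟩ has profile ([1^{μ'_1}, 2^{μ'_2}, 2g], k') for some non-negative integers μ'_1, μ'_2, k' satisfying k' + μ'_1 = 2g+2 and μ'_1 + 2μ'_2 = μ_2. -/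
/-- The length of the cycle of `π` through `x`, fixed points having length `1`. -/
def cycleLength {n : ℕ} (π : Equiv.Perm (Fin n)) (x : Fin n) : ℕ :=
  (Finset.univ.filter fun z => π.SameCycle x z).card

lemma cycleLength_pos {n : ℕ} (π : Equiv.Perm (Fin n)) (x : Fin n) : 1 ≤ cycleLength π x :=
  Finset.card_pos.mpr ⟨x, by simp [Equiv.Perm.SameCycle.refl]⟩

lemma cycleLength_eq_one_iff {n : ℕ} (π : Equiv.Perm (Fin n)) (x : Fin n) :
    cycleLength π x = 1 ↔ π x = x := by
  constructor
  · intro h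
    refine Finset.card_le_one.mp h.le _ ?_ _ ?_
    · simp [Equiv.Perm.SameCycle.refl]
    · simp [Equiv.Perm.SameCycle.refl]
  · intro h
    refine Finset.card_eq_one.mpr ⟨x, ?_⟩
    ext z
    simp only [Finset.mem_filter, Finset.mem_univ, true_and, Finset.mem_singleton]
    constructor
    · intro hz
      exact (Equiv.Perm.SameCycle.eq_of_left hz h).symm
    · rintro rfl
      exact Equiv.Perm.SameCycle.refl _ _

lemma support_cycleOf_eq {n : ℕ} {π : Equiv.Perm (Fin n)} {x : Fin n} (hx : π x ≠ x) :
    (π.cycleOf x).support = Finset.univ.filter fun z => π.SameCycle x z := by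
  ext z
  rw [Equiv.Perm.mem_support_cycleOf_iff]
  simp [hx]

/-- The points on cycles of length `i` number `i` times the cycles of length `i`. -/
lemma mul_cycleCount {n : ℕ} (π : Equiv.Perm (Fin n)) {i : ℕ} (hi : 1 ≤ i) :
    i * cycleCount π i = (Finset.univ.filter fun x => cycleLength π x = i).card := by
  rcases eq_or_ne i 1 with rfl | h1
  · simp [cycleCount, fixedCount, cycleLength_eq_one_iff]
  have hne : ∀ x, cycleLength π x = i → π x ≠ x := fun x hx h =>
    h1 (hx ▸ (cycleLength_eq_one_iff π x).mpr h)
  have hcount : cycleCount π i = (π.cycleFactorsFinset.filter fun c => c.support.card = i).card := by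
    rw [cycleCount, if_neg h1, Equiv.Perm.cycleType_def, Multiset.count_map]
    simp only [Function.comp, eq_comm]
    rfl
  rw [hcount, Finset.card_eq_sum_card_fiberwise (f := fun x => π.cycleOf x)
    (t := π.cycleFactorsFinset.filter fun c => c.support.card = i)]
  · rw [Finset.sum_const_nat (m := i), mul_comm]
    intro c hc
    obtain ⟨hc, hci⟩ := Finset.mem_filter.mp hc
    rw [← hci]
    congr 1
    ext x
    simp only [Finset.mem_filter, Finset.mem_univ, true_and]
    constructor
    · rintro ⟨hx, rfl⟩
      rw [support_cycleOf_eq (hne x (by omega))]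
      simp [Equiv.Perm.SameCycle.refl]
    · intro hx
      have h := Equiv.Perm.cycle_is_cycleOf hx hc
      refine ⟨?_, h.symm⟩
      have hx' : π x ≠ x := by
        have := Equiv.Perm.mem_cycleFactorsFinset_support_le hc hx
        simpa using this
      rw [cycleLength, ← support_cycleOf_eq hx', ← h]
  · intro x hx
    have hx : cycleLength π x = i := by simpa using hx
    have h := hne x hx
    simp only [Finset.coe_filter, Set.mem_ofPred_eq]
    refine ⟨Equiv.Perm.cycleOf_mem_cycleFactorsFinset_iff.mpr (by simpa using h), ?_⟩
    rw [support_cycleOf_eq h]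
    exact hx

lemma cycleLength_ne_of_cycleCount_eq_zero {n : ℕ} {π : Equiv.Perm (Fin n)} {i : ℕ} (hi : 1 ≤ i)
    (h : cycleCount π i = 0) (x : Fin n) : cycleLength π x ≠ i := by
  have := mul_cycleCount π hi
  rw [h, mul_zero, eq_comm, Finset.card_eq_zero, Finset.filter_eq_empty_iff] at this
  exact this (Finset.mem_univ x)

/-- A nontrivial automorphism of a square-tiled surface has no fixed point. -/
lemma IsAut.apply_ne {n : ℕ} {τ : Surf n} {α : Equiv.Perm (Fin n)} (hτ : IsSTS n τ)
    (hα : IsAut τ α) (h1 : α ≠ 1) (x : Fin n) : α x ≠ x := by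
  intro hx
  apply h1
  ext1 y
  obtain ⟨p, hp, rfl⟩ := hτ.2.2 x y
  have hc : p ∈ Subgroup.centralizer {α} := by
    refine (Subgroup.closure_le _).mpr ?_ hp
    rintro _ (rfl | rfl | rfl) <;>
    · rw [SetLike.mem_coe, Subgroup.mem_centralizer_singleton_iff]
      exact (hα _).symm
  rw [Subgroup.mem_centralizer_singleton_iff] at hc
  calc α (p x) = (p * α) x := by rw [hc]; rfl
    _ = p x := by simp [hx]

/-- `p` is a two-to-one map onto `Fin m` whose fibres are the orbits of the
fixed-point-free involution `α`. -/
structure IsFreeQuotient {n m : ℕ} (α : Equiv.Perm (Fin n)) (p : Fin n → Fin m) : Prop where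
  surjective : Function.Surjective p
  eq_iff : ∀ x y, p x = p y ↔ (y = x ∨ y = α x)
  apply_ne : ∀ x, α x ≠ x
  apply_apply : ∀ x, α (α x) = x

section Quotient

variable {n m : ℕ} {α : Equiv.Perm (Fin n)} {p : Fin n → Fin m}
  {π : Equiv.Perm (Fin n)} {σ : Equiv.Perm (Fin m)}

lemma IsFreeQuotient.two_mul_card_filter (hp : IsFreeQuotient α p) (P : Fin m → Prop)
    [DecidablePred P] :
    2 * (Finset.univ.filter P).card = (Finset.univ.filter fun x => P (p x)).card := by
  rw [Finset.card_eq_sum_card_fiberwise (f := p) (t := Finset.univ.filter P)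
    (fun x hx => by simpa using hx), Finset.sum_const_nat (m := 2), mul_comm]
  intro y hy
  obtain ⟨x, rfl⟩ := hp.surjective y
  refine Finset.card_eq_two.mpr ⟨x, α x, (hp.apply_ne x).symm, ?_⟩
  ext z
  have h := hp.eq_iff x z
  simp only [Finset.mem_filter, Finset.mem_univ, true_and, Finset.mem_insert,
    Finset.mem_singleton] at hy ⊢
  rw [← h]
  exact ⟨fun h => h.2.symm, fun h => ⟨h ▸ hy, h.symm⟩⟩

lemma IsFreeQuotient.two_mul_fixedCount (hp : IsFreeQuotient α p) (h : ∀ x, p (π x) = σ (p x)) :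
    2 * fixedCount σ = (Finset.univ.filter fun x => π x = x ∨ π x = α x).card := by
  rw [fixedCount, hp.two_mul_card_filter]
  congr 1
  ext x
  simp only [Finset.mem_filter, Finset.mem_univ, true_and]
  rw [← h, eq_comm, hp.eq_iff]

lemma IsFreeQuotient.sameCycle_iff (hp : IsFreeQuotient α p) (h : ∀ x, p (π x) = σ (p x))
    (x y : Fin n) : σ.SameCycle (p x) (p y) ↔ π.SameCycle x y ∨ π.SameCycle x (α y) := by
  have hpow : ∀ (k : ℕ) (x : Fin n), p ((π ^ k) x) = (σ ^ k) (p x) := by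
    intro k
    induction k with
    | zero => simp
    | succ k ih => intro x; rw [pow_succ, pow_succ, Equiv.Perm.mul_apply, ih, h]; rfl
  have hpα : p (α y) = p y := ((hp.eq_iff y (α y)).mpr (Or.inr rfl)).symm
  constructor
  · intro hs
    obtain ⟨k, hk⟩ := hs.exists_nat_pow_eq
    rw [← hpow, eq_comm, hp.eq_iff] at hk
    rcases hk with hk | hk
    · exact Or.inl ⟨k, by simpa using hk⟩
    · exact Or.inr ⟨k, by simpa using hk⟩
  · rintro (hs | hs)
    · obtain ⟨k, hk⟩ := hs.exists_nat_pow_eq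
      exact ⟨k, by rw [zpow_natCast, ← hpow, hk]⟩
    · obtain ⟨k, hk⟩ := hs.exists_nat_pow_eq
      exact ⟨k, by rw [zpow_natCast, ← hpow, hk, hpα]⟩

lemma sameCycle_apply_apply (hc : ∀ x, α (π x) = π (α x)) {x y : Fin n}
    (h : π.SameCycle x y) : π.SameCycle (α x) (α y) := by
  have hconj : α * π * α⁻¹ = π := by
    ext1 x
    simp [hc]
  rw [← hconj]
  simpa using h

/-- A cycle preserved by `α` is folded in half by the quotient map. -/
lemma IsFreeQuotient.two_mul_cycleLength_of_sameCycle (hp : IsFreeQuotient α p)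
    (h : ∀ x, p (π x) = σ (p x)) (hc : ∀ x, α (π x) = π (α x)) {x : Fin n}
    (hx : π.SameCycle x (α x)) : 2 * cycleLength σ (p x) = cycleLength π x := by
  rw [cycleLength, hp.two_mul_card_filter, cycleLength]
  congr 1
  ext y
  simp only [Finset.mem_filter, Finset.mem_univ, true_and, hp.sameCycle_iff h]
  refine ⟨?_, Or.inl⟩
  rintro (hy | hy)
  · exact hy
  · have := sameCycle_apply_apply hc hy
    rw [hp.apply_apply] at this
    exact hx.trans this

/-- A cycle not preserved by `α` is mapped isomorphically by the quotient map. -/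
lemma IsFreeQuotient.cycleLength_of_not_sameCycle (hp : IsFreeQuotient α p)
    (h : ∀ x, p (π x) = σ (p x)) (hc : ∀ x, α (π x) = π (α x)) {x : Fin n}
    (hx : ¬ π.SameCycle x (α x)) : cycleLength σ (p x) = cycleLength π x := by
  have key : 2 * cycleLength σ (p x) = cycleLength π x + cycleLength π x := by
    rw [cycleLength, hp.two_mul_card_filter]
    simp only [hp.sameCycle_iff h]
    rw [Finset.filter_or, Finset.card_union_of_disjoint]
    · congr 1
      refine Finset.card_bij' (fun y _ => α y) (fun y _ => α y) ?_ ?_ ?_ ?_ <;>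
        simp [hp.apply_apply]
    · rw [Finset.disjoint_filter]
      intro y _ h1 h2
      have := sameCycle_apply_apply hc h2
      rw [hp.apply_apply] at this
      exact hx (h1.trans this.symm)
  omega

lemma cycleLength_apply (hc : ∀ x, α (π x) = π (α x)) (hα : ∀ x, α (α x) = x) (x : Fin n) :
    cycleLength π (α x) = cycleLength π x := by
  refine Finset.card_bij' (fun y _ => α y) (fun y _ => α y) ?_ ?_ ?_ ?_
  · intro y hy
    have := sameCycle_apply_apply hc (x := α x) (y := y) (by simpa using hy)
    rw [hα] at this
    simpa using this
  · intro y hy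
    simpa using sameCycle_apply_apply hc (by simpa using hy)
  · simp [hα]
  · simp [hα]

/-- If all cycles of `π` have length `2` or `M > 2`, and those of length `M` have image of
length `L > 2` with `M * (number of them) = 2 * L`, then the quotient permutation has exactly
one `L`-cycle, and its other cycles have length `1` or `2`. -/
lemma IsFreeQuotient.cycleCount_quotient (hp : IsFreeQuotient α p)
    (h : ∀ x, p (π x) = σ (p x)) (hc : ∀ x, α (π x) = π (α x)) {M L : ℕ} (hM : 2 < M) (hL : 2 < L)
    (hπ : ∀ i, 1 ≤ i → i ≠ 2 → i ≠ M → cycleCount π i = 0)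
    (hMc : M * cycleCount π M = 2 * L)
    (hlen : ∀ x, cycleLength π x = M → cycleLength σ (p x) = L) :
    cycleCount σ 1 + 2 * cycleCount σ 2 = cycleCount π 2 ∧ cycleCount σ L = 1 ∧
      ∀ i, 1 ≤ i → i ≠ 1 → i ≠ 2 → i ≠ L → cycleCount σ i = 0 := by
  have hcase : ∀ x, (cycleLength π x = M ∧ cycleLength σ (p x) = L) ∨
      (cycleLength π x = 2 ∧ (cycleLength σ (p x) = 1 ∨ cycleLength σ (p x) = 2)) := by
    intro x
    by_cases hxM : cycleLength π x = M
    · exact Or.inl ⟨hxM, hlen x hxM⟩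
    have hx2 : cycleLength π x = 2 := by
      by_contra h2
      exact cycleLength_ne_of_cycleCount_eq_zero (cycleLength_pos π x)
        (hπ _ (cycleLength_pos π x) h2 hxM) x rfl
    refine Or.inr ⟨hx2, ?_⟩
    by_cases hs : π.SameCycle x (α x)
    · have := hp.two_mul_cycleLength_of_sameCycle h hc hs
      omega
    · have := hp.cycleLength_of_not_sameCycle h hc hs
      omega
  have hcount : ∀ i, 1 ≤ i → 2 * (i * cycleCount σ i) =
      (Finset.univ.filter fun x => cycleLength σ (p x) = i).card := fun i hi => by
    rw [mul_cycleCount σ hi, hp.two_mul_card_filter]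
  refine ⟨?_, ?_, ?_⟩
  · have h1 := hcount 1 le_rfl
    have h2 := hcount 2 (by norm_num)
    have h3 := mul_cycleCount π (i := 2) (by norm_num)
    have h4 : (Finset.univ.filter fun x => cycleLength π x = 2) =
        (Finset.univ.filter fun x => cycleLength σ (p x) = 1) ∪
          (Finset.univ.filter fun x => cycleLength σ (p x) = 2) := by
      ext x
      have := hcase x
      simp only [Finset.mem_union, Finset.mem_filter, Finset.mem_univ, true_and]
      omega
    rw [h4, Finset.card_union_of_disjoint, ← h1, ← h2] at h3
    · omega
    · rw [Finset.disjoint_filter]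
      intro x _ h1 h2
      omega
  · have h1 := hcount L (by omega)
    have h2 := mul_cycleCount π (i := M) (by omega)
    have h3 : (Finset.univ.filter fun x => cycleLength σ (p x) = L) =
        Finset.univ.filter fun x => cycleLength π x = M := by
      ext x
      have := hcase x
      simp only [Finset.mem_filter, Finset.mem_univ, true_and]
      omega
    rw [h3, ← h2, hMc] at h1
    have : L * cycleCount σ L = L * 1 := by omega
    exact Nat.eq_of_mul_eq_mul_left (by omega) this
  · intro i hi h1 h2 hiL
    have h := hcount i hi
    rw [Finset.filter_false_of_mem, Finset.card_empty] at h
    · have : i * cycleCount σ i = 0 := by omega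
      rcases Nat.mul_eq_zero.mp this with h0 | h0
      · omega
      · exact h0
    · intro x _
      have := hcase x
      omega

end Quotient

/-- `genusFour` of a surface whose product has one `L`-cycle and otherwise only cycles of
length `1` and `2`. -/
lemma genusFour_eq {m : ℕ} {q : Surf m} (hm : 1 ≤ m) {L : ℕ} (hL : 2 < L)
    (h1 : cycleCount (prodRGB q) L = 1)
    (h0 : ∀ i, 1 ≤ i → i ≠ 1 → i ≠ 2 → i ≠ L → cycleCount (prodRGB q) i = 0) :
    genusFour q = (L : ℤ) - 2 - cycleCount (prodRGB q) 1 - totalFixed q := by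
  have hLm : L ≤ m := by
    have h := mul_cycleCount (prodRGB q) (i := L) (by omega)
    rw [h1, mul_one] at h
    rw [h]
    exact (Finset.card_le_univ _).trans_eq (Fintype.card_fin m)
  rw [genusFour, Finset.sum_eq_add (1 : ℕ) L (by omega)]
  · rw [h1]
    push_cast
    ring
  · rintro i hi ⟨hi1, hiL⟩
    rcases eq_or_ne i 2 with rfl | hi2
    · simp
    · rw [h0 i (Finset.mem_Icc.mp hi).1 hi1 hi2 hiL]
      simp
  · intro h
    exact absurd (Finset.mem_Icc.mpr ⟨le_rfl, hm⟩) h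
  · intro h
    exact absurd (Finset.mem_Icc.mpr ⟨by omega, hLm⟩) h

lemma IsQuotientBy.map_prodRGB {n m : ℕ} {τ : Surf n} {q : Surf m} {p : Fin n → Fin m}
    (hX : ∀ X x, p (τ X x) = q X (p x)) (x : Fin n) : p (prodRGB τ x) = prodRGB q (p x) := by
  simp [prodRGB, hX]

lemma IsAut.apply_prodRGB {n : ℕ} {τ : Surf n} {α : Equiv.Perm (Fin n)} (hα : IsAut τ α)
    (x : Fin n) : α (prodRGB τ x) = prodRGB τ (α x) := by
  have h : ∀ X x, α (τ X x) = τ X (α x) := fun X x => by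
    rw [← Equiv.Perm.mul_apply, hα X, Equiv.Perm.mul_apply]
  simp [prodRGB, h]

/-- The profile of the quotient by a hyperelliptic involution, when the product has cycles of
length `2` and `M` only and the `M`-cycles map onto an `L`-cycle. -/
lemma IsHyperInvolution.profile_quotient {n m : ℕ} {τ : Surf n} {α : Equiv.Perm (Fin n)}
    {q : Surf m} (hτ : IsSTS n τ) (hα : IsHyperInvolution τ α) (hq : IsQuotientBy n m τ α q)
    {M L : ℕ} (hM : 2 < M) (hL : 2 < L)
    (hπ : ∀ i, 1 ≤ i → i ≠ 2 → i ≠ M → cycleCount (prodRGB τ) i = 0)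
    (hMc : M * cycleCount (prodRGB τ) M = 2 * L)
    (hlen : ∀ x, cycleLength (prodRGB τ) x = M →
      ((prodRGB τ).SameCycle x (α x) ∧ M = 2 * L) ∨
        (¬ (prodRGB τ).SameCycle x (α x) ∧ M = L)) :
    totalFixed q + cycleCount (prodRGB q) 1 = L + 2 ∧
      cycleCount (prodRGB q) 1 + 2 * cycleCount (prodRGB q) 2 = cycleCount (prodRGB τ) 2 ∧
      cycleCount (prodRGB q) L = 1 ∧
      ∀ i, 1 ≤ i → i ≠ 1 → i ≠ 2 → i ≠ L → cycleCount (prodRGB q) i = 0 := by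
  obtain ⟨haut, hinv, hne, m₀, q₀, hq₀, hquot₀, hgenus⟩ := hα
  have hfree : ∀ {k : ℕ} {p : Fin n → Fin k}, Function.Surjective p →
      (∀ x y, p x = p y ↔ (y = x ∨ y = α x)) → IsFreeQuotient α p := fun hs he =>
    ⟨hs, he, haut.apply_ne hτ hne, fun x => by rw [← Equiv.Perm.mul_apply, hinv]; rfl⟩
  have hcycle : ∀ {k : ℕ} {r : Surf k} {p : Fin n → Fin k}, IsFreeQuotient α p →
      (∀ X x, p (τ X x) = r X (p x)) → _ := fun {k r p} hp hX =>
    hp.cycleCount_quotient (IsQuotientBy.map_prodRGB hX) haut.apply_prodRGB hM hL hπ hMc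
      (fun x hx => by
        rcases hlen x hx with ⟨hs, hML⟩ | ⟨hs, hML⟩
        · have := hp.two_mul_cycleLength_of_sameCycle (IsQuotientBy.map_prodRGB hX)
            haut.apply_prodRGB hs
          omega
        · have := hp.cycleLength_of_not_sameCycle (IsQuotientBy.map_prodRGB hX)
            haut.apply_prodRGB hs
          omega)
  obtain ⟨p, hs, he, hX⟩ := hq
  obtain ⟨p₀, hs₀, he₀, hX₀⟩ := hquot₀
  have hp := hfree hs he
  have hp₀ := hfree hs₀ he₀
  have hC := hcycle hp hX
  have hC₀ := hcycle hp₀ hX₀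
  have hfix : ∀ X, fixedCount (q X) = fixedCount (q₀ X) := fun X => by
    have h1 := hp.two_mul_fixedCount (hX X)
    have h2 := hp₀.two_mul_fixedCount (hX₀ X)
    omega
  have hone : cycleCount (prodRGB q) 1 = cycleCount (prodRGB q₀) 1 := by
    have h1 := hp.two_mul_fixedCount (IsQuotientBy.map_prodRGB hX)
    have h2 := hp₀.two_mul_fixedCount (IsQuotientBy.map_prodRGB hX₀)
    simp only [cycleCount, if_true]
    omega
  have htotal : totalFixed q = totalFixed q₀ := by simp [totalFixed, hfix]
  rw [genusFour_eq hq₀.1 hL hC₀.2.1 hC₀.2.2] at hgenus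
  exact ⟨by omega, hC⟩

/-- A permutation with a single `M`-cycle has all its points of cycle length `M` on it. -/
lemma sameCycle_of_cycleCount_eq_one {n M : ℕ} {π : Equiv.Perm (Fin n)} (hM : 1 ≤ M)
    (h : cycleCount π M = 1) {x y : Fin n} (hx : cycleLength π x = M)
    (hy : cycleLength π y = M) : π.SameCycle x y := by
  have hcard := mul_cycleCount π hM
  rw [h, mul_one] at hcard
  have hsub : (Finset.univ.filter fun z => π.SameCycle x z) ⊆
      Finset.univ.filter fun z => cycleLength π z = M := by
    intro z hz
    have hz : π.SameCycle x z := by simpa using hz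
    simp only [Finset.mem_filter, Finset.mem_univ, true_and]
    rw [← hx, cycleLength, cycleLength]
    congr 1
    ext w
    simp only [Finset.mem_filter, Finset.mem_univ, true_and]
    exact ⟨hz.trans, hz.symm.trans⟩
  have heq := Finset.eq_of_subset_of_card_le hsub (hcard.symm.trans hx.symm).le
  have : y ∈ Finset.univ.filter fun z => cycleLength π z = M := by simpa using hy
  rw [← heq] at this
  simpa using this

/-- The quotient of a hyperelliptic Abelian square-tiled surface of
profile `([2^{μ2}, 4g-2], 0)` (resp. `([2^{μ2}, (2g)^2], 0)` with involution
exchanging the two `2g`-cycles) by its hyperelliptic involution has profile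
`([1^{μ'_1}, 2^{μ'_2}, 2g-1], k')` with `k' + μ'_1 = 2g+1` and `μ'_1 + 2μ'_2 = μ2`
(resp. `([1^{μ'_1}, 2^{μ'_2}, 2g], k')` with `k' + μ'_1 = 2g+2` and
`μ'_1 + 2μ'_2 = μ2`). -/
theorem stmt17 (g μ2 : ℕ) (hg : 2 ≤ g) :
    (∀ (n : ℕ) (τ : Surf n) (α : Equiv.Perm (Fin n)),
      IsSTS n τ → IsAbelian n τ → ProfileA n g μ2 τ → IsHyperInvolution τ α →
      ∀ (m : ℕ) (q : Surf m), IsSTS m q → IsQuotientBy n m τ α q →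
        ∃ μ'1 μ'2 k' : ℕ, k' + μ'1 = 2 * g + 1 ∧ μ'1 + 2 * μ'2 = μ2 ∧
          totalFixed q = k' ∧
          cycleCount (prodRGB q) 1 = μ'1 ∧ cycleCount (prodRGB q) 2 = μ'2 ∧
          cycleCount (prodRGB q) (2 * g - 1) = 1 ∧
          ∀ i, 1 ≤ i → i ≠ 1 → i ≠ 2 → i ≠ 2 * g - 1 → cycleCount (prodRGB q) i = 0) ∧
    (∀ (n : ℕ) (τ : Surf n) (α : Equiv.Perm (Fin n)),
      IsSTS n τ → IsAbelian n τ → ProfileB n g μ2 τ → IsHyperInvolution τ α →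
      ExchangesTwoCycles τ α g →
      ∀ (m : ℕ) (q : Surf m), IsSTS m q → IsQuotientBy n m τ α q →
        ∃ μ'1 μ'2 k' : ℕ, k' + μ'1 = 2 * g + 2 ∧ μ'1 + 2 * μ'2 = μ2 ∧
          totalFixed q = k' ∧
          cycleCount (prodRGB q) 1 = μ'1 ∧ cycleCount (prodRGB q) 2 = μ'2 ∧
          cycleCount (prodRGB q) (2 * g) = 1 ∧
          ∀ i, 1 ≤ i → i ≠ 1 → i ≠ 2 → i ≠ 2 * g → cycleCount (prodRGB q) i = 0) := by

  constructor
  · rintro n τ α hτ - ⟨-, h2, hM, h0⟩ hα m q - hq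
    obtain ⟨hk, h12, hL, hz⟩ := hα.profile_quotient hτ hq (M := 4 * g - 2) (L := 2 * g - 1)
      (by omega) (by omega) h0 (by rw [hM]; omega) (fun x hx => Or.inl
        ⟨sameCycle_of_cycleCount_eq_one (by omega) hM hx
          (by
            have hinv : ∀ x, α (α x) = x := fun x => by
              rw [← Equiv.Perm.mul_apply, hα.2.1]; rfl
            rw [cycleLength_apply hα.1.apply_prodRGB hinv, hx]), by omega⟩)
    exact ⟨_, _, _, by omega, h12.trans h2, rfl, rfl, rfl, hL, hz⟩
  · rintro n τ α hτ - ⟨-, h2, hM, h0⟩ hα hex m q - hq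
    obtain ⟨hk, h12, hL, hz⟩ := hα.profile_quotient hτ hq (M := 2 * g) (L := 2 * g)
      (by omega) (by omega) h0 (by rw [hM]; omega) (fun x hx => Or.inr
        ⟨hex x (by
          rw [support_cycleOf_eq]
          · exact hx
          · intro hfix
            have := (cycleLength_eq_one_iff _ x).mpr hfix
            omega), rfl⟩)
    exact ⟨_, _, _, by omega, h12.trans h2, rfl, rfl, rfl, hL, hz⟩
end
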